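/- Let 𝕂 = ℚ(√d) be a real quadratic field of class number one with d > 1 squarefree, d ≡ 3 (mod 4), and fix 𝒞 ∈ ℕ. With c = (2/π) · ∑_{a=𝒞}^{2𝒞} ∑_{b=𝒞}^{2𝒞} (−1)^{a+b} · binom(𝒞, 2𝒞−a) · binom(𝒞, 2𝒞−b) · ∫_{−∞}^{∞} (a·ϵ^{2y} + b·ϵ^{−2y})^{−1} dy > 0, one has ∑_{𝔰∈ℙ} Ψ(𝔰) = c · N/log N + O(N·log log N / log² N) as N → ∞, where the sum runs over all nonzero prime ideals 𝔰 of 𝒪. -/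

import Mathlib

open NumberField

open scoped Classical

set_option synthInstance.maxHeartbeats 1000000
set_option maxHeartbeats 1000000

/-- The weight `f(x) = (exp(−πx²) − exp(−2πx²))^𝒞`. -/
noncomputable def fwt (C : ℕ) (x : ℝ) : ℝ :=
  (Real.exp (-Real.pi * x^2) - Real.exp (-2 * Real.pi * x^2)) ^ C

/-- The smooth weight `Ψ(𝔫) = ∑_{k ∈ 𝒪, (k) = 𝔫} f(σ₁(k)/√N) f(σ₂(k)/√N)`,
where `σ₁` is the inclusion `K ⊆ ℝ` and `σ₂` the second real embedding. -/
noncomputable def PsiW (K : Subfield ℝ) [NumberField K] (σ₂ : K →+* ℝ) (C : ℕ) (N : ℝ)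
    (n : Ideal (𝓞 K)) : ℝ :=
  ∑' k : 𝓞 K, if Ideal.span {k} = n then
    fwt C (((k : K) : ℝ) / Real.sqrt N) * fwt C (σ₂ (k : K) / Real.sqrt N) else 0

/-- The constant `(2/π) ∑_{a=𝒞}^{2𝒞} ∑_{b=𝒞}^{2𝒞} (−1)^{a+b} binom(𝒞,2𝒞−a) binom(𝒞,2𝒞−b)
∫_ℝ (a E^{2y} + b E^{−2y})^{−1} dy`, where `E = ϵ` is the fundamental unit. -/
noncomputable def sieveConst (C : ℕ) (E : ℝ) : ℝ :=
  (2 / Real.pi) * ∑ a ∈ Finset.Icc C (2*C), ∑ b ∈ Finset.Icc C (2*C),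
    (-1 : ℝ)^(a+b) * (C.choose (2*C - a)) * (C.choose (2*C - b)) *
      ∫ y : ℝ, ((a : ℝ) * E ^ (2*y) + (b : ℝ) * E ^ (-(2*y)))⁻¹

section PartD
open Complex Filter Topology Set

theorem pd_cauchy {f : ℂ → ℂ} (hf : DifferentiableOn ℂ f {s | 1/2 < s.re}) {α β r K X0 : ℝ} {B : ℕ}
    (hα : 1/2 < α) (hr : 0 < r) (hr1 : r ≤ 1) (hX0 : 0 ≤ X0) (hK : 0 ≤ K)
    (hb : ∀ s : ℂ, α ≤ s.re → s.re ≤ β → ‖f s‖ ≤ K * (1 + |s.im| + X0) ^ B) :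
    ∀ s : ℂ, α + r ≤ s.re → s.re ≤ β - r → ‖deriv f s‖ ≤ (K * 2 ^ B / r) * (1 + |s.im| + X0) ^ B := by
  intro s h1 h2
  have key : ‖deriv f s‖ ≤ (K * (2 * (1 + |s.im| + X0)) ^ B) / r := by
    apply Complex.norm_deriv_le_of_forall_mem_sphere_norm_le hr
    · apply DifferentiableOn.diffContOnCl
      rw [closure_ball _ hr.ne']
      apply hf.mono
      intro z hz
      have h := (abs_re_le_norm (z - s)).trans (mem_closedBall_iff_norm.mp hz)
      rw [abs_le] at h; simp at h
      simp only [mem_ofPred_eq]; linarith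
    · intro z hz
      have hz' : ‖z - s‖ = r := mem_sphere_iff_norm.mp hz
      have h := (abs_re_le_norm (z - s)).trans hz'.le
      have h' := (abs_im_le_norm (z - s)).trans hz'.le
      rw [abs_le] at h; simp at h
      have h3 : |z.im| ≤ |s.im| + 1 := by
        simp at h'
        have := abs_sub_abs_le_abs_sub z.im s.im
        linarith
      refine (hb z (by linarith) (by linarith)).trans ?_
      gcongr
      have := abs_nonneg s.im
      linarith
  refine key.trans (le_of_eq ?_)
  rw [mul_pow]; ring

theorem pd_341 (Z D : ℤ → ℂ → ℂ)
    (h1 : ∀ m s, 1 < s.re → HasDerivAt (Z m) (-(D m s * Z m s)) s)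
    (h3 : ∀ m : ℤ, ∀ σ t : ℝ, 1 < σ →
      0 ≤ (3 * D 0 σ + 4 * D m (σ + t * I) + D (2 * m) (σ + 2 * t * I)).re)
    (h4 : ∀ m : ℤ, ∀ t : ℝ, Tendsto (fun σ : ℝ => Z m (σ + t * I)) atTop (𝓝 1))
    (m : ℤ) (σ t : ℝ) (hσ : 1 < σ) :
    1 ≤ ‖Z 0 σ‖ ^ 3 * ‖Z m (σ + t * I)‖ ^ 4 * ‖Z (2 * m) (σ + 2 * t * I)‖ := by
  set Φ : ℝ → ℂ := fun x => Z 0 x ^ 3 * Z m (x + t * I) ^ 4 * Z (2 * m) (x + 2 * t * I) with hΦ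
  set S : ℝ → ℂ := fun x => 3 * D 0 x + 4 * D m (x + t * I) + D (2 * m) (x + 2 * t * I) with hS
  have hd : ∀ x : ℝ, 1 < x → HasDerivAt Φ (-(S x) * Φ x) x := by
    intro x hx
    have e : ∀ (m : ℤ) (c : ℂ), c.re = 0 → HasDerivAt (fun y : ℝ => Z m (y + c)) (-(D m (x + c) * Z m (x + c))) x := by
      intro m c hc
      have := (h1 m (x + c) (by simp [hc, hx]))
      exact (HasDerivAt.comp_add_const (x : ℂ) c this).comp_ofReal
    have e0 := e 0 0 rfl
    have e1 := e m (t * I) (by simp)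
    have e2 := e (2 * m) (2 * t * I) (by simp)
    simp only [add_zero] at e0
    refine (((e0.pow 3).mul (e1.pow 4)).mul e2).congr_deriv ?_
    simp only [hΦ, hS, Pi.pow_apply, Pi.mul_apply]
    push_cast
    ring
  have hn : ∀ x : ℝ, 1 < x → HasDerivAt (fun x => ‖Φ x‖ ^ 2) (2 * ((-(S x)).re * ‖Φ x‖ ^ 2)) x := by
    intro x hx
    have hre : HasDerivAt (fun y => (Φ y).re) ((-(S x) * Φ x).re) x :=
      (Complex.reCLM.hasFDerivAt.comp_hasDerivAt x (hd x hx))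
    have him : HasDerivAt (fun y => (Φ y).im) ((-(S x) * Φ x).im) x :=
      (Complex.imCLM.hasFDerivAt.comp_hasDerivAt x (hd x hx))
    have := (hre.mul hre).add (him.mul him)
    have ef : (fun x => ‖Φ x‖ ^ 2) = (fun y => (Φ y).re) * (fun y => (Φ y).re) + (fun y => (Φ y).im) * (fun y => (Φ y).im) := by
      ext x; simp [Complex.sq_norm, Complex.normSq_apply]
    rw [ef]
    refine this.congr_deriv ?_
    rw [Complex.sq_norm, Complex.normSq_apply]
    simp only [mul_re, mul_im]
    ring
  have hanti : AntitoneOn (fun x => ‖Φ x‖ ^ 2) (Ioi 1) := by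
    apply antitoneOn_of_deriv_nonpos (convex_Ioi 1)
    · intro x hx; exact (hn x hx).continuousAt.continuousWithinAt
    · intro x hx; rw [interior_Ioi] at hx; exact (hn x hx).differentiableAt.differentiableWithinAt
    · intro x hx
      rw [interior_Ioi] at hx
      rw [(hn x hx).deriv]
      have := h3 m x t hx
      have h5 : 0 ≤ (S x).re := this
      have : 0 ≤ (S x).re * ‖Φ x‖ ^ 2 := by positivity
      simp only [neg_re]; nlinarith
  have hlim : Tendsto (fun x => ‖Φ x‖ ^ 2) atTop (𝓝 1) := by
    have a0 := h4 0 0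
    have a1 := h4 m t
    have a2 := h4 (2 * m) (2 * t)
    simp only [ofReal_zero, zero_mul, add_zero] at a0
    push_cast at a2
    have := (((a0.pow 3).mul (a1.pow 4)).mul a2).norm.pow 2
    simpa [hΦ] using this
  have hge : (1 : ℝ) ≤ ‖Φ σ‖ ^ 2 := by
    refine le_of_tendsto hlim ?_
    filter_upwards [eventually_ge_atTop σ] with x hx
    exact hanti hσ (hσ.trans_le hx) hx
  have : 1 ≤ ‖Φ σ‖ := by
    by_contra hh
    push Not at hh
    have := norm_nonneg (Φ σ)
    nlinarith
  simpa [hΦ] using this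


theorem pd_lower (Z D U : ℤ → ℂ → ℂ) (κ K2 : ℝ) (B : ℕ) (hκ : 0 < κ) (hK2 : 1 ≤ K2)
    (h1 : ∀ m s, 1 < s.re → HasDerivAt (Z m) (-(D m s * Z m s)) s)
    (hU : ∀ m, DifferentiableOn ℂ (U m) {s | 1/2 < s.re})
    (hUZ : ∀ m s, 1 < s.re → U m s = (if m = 0 then (s - 1) else 1) * Z m s)
    (hU1 : U 0 1 = κ)
    (hb0 : ∀ (m : ℤ) s, 1 ≤ s.re → s.re ≤ 2 → ‖U m s‖ ≤ K2 * (1 + |s.im| + |(m : ℝ)|) ^ B)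
    (hb1 : ∀ (m : ℤ) s, 1 ≤ s.re → s.re ≤ 2 → ‖deriv (U m) s‖ ≤ K2 * (1 + |s.im| + |(m : ℝ)|) ^ B)
    (h3 : ∀ m : ℤ, ∀ σ t : ℝ, 1 < σ →
      0 ≤ (3 * D 0 σ + 4 * D m (σ + t * I) + D (2 * m) (σ + 2 * t * I)).re)
    (h4 : ∀ m : ℤ, ∀ t : ℝ, Tendsto (fun σ : ℝ => Z m (σ + t * I)) atTop (𝓝 1)) :
    ∃ r0 c : ℝ, 0 < r0 ∧ r0 ≤ 1 ∧ 0 < c ∧ ∀ (m : ℤ) s, 1 < s.re → s.re ≤ 1 + r0 →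
      c ≤ ‖U m s‖ * (1 + |s.im| + |(m : ℝ)|) ^ (4 * B) := by
  have hopen : IsOpen {s : ℂ | 1/2 < s.re} := isOpen_lt continuous_const Complex.continuous_re
  -- near the pole
  have hcont : ContinuousAt (U 0) 1 :=
    ((hU 0).differentiableAt (hopen.mem_nhds (by simp; norm_num))).continuousAt
  have hnear : ∀ᶠ s in 𝓝 (1 : ℂ), κ / 2 < ‖U 0 s‖ := by
    have := hcont.norm
    apply this.eventually_const_lt
    change κ / 2 < ‖U 0 1‖
    rw [hU1]; simp [abs_of_pos hκ]; linarith
  obtain ⟨ρ, hρ, hball⟩ := Metric.eventually_nhds_iff.mp hnear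
  set r0 := min (ρ / 3) 1 with hr0
  have hr0p : 0 < r0 := by positivity
  have hr0l : r0 ≤ ρ / 3 := min_le_left _ _
  have hr01 : r0 ≤ 1 := min_le_right _ _
  have hK2p : 0 < K2 := by linarith
  -- the constant
  set c1 : ℝ := r0 ^ 5 / (K2 ^ 4 * 2 ^ B) with hc1
  have hc1p : 0 < c1 := by positivity
  have hc11 : c1 ≤ 1 := by
    rw [hc1, div_le_one (by positivity)]
    calc r0 ^ 5 ≤ 1 := pow_le_one₀ hr0p.le hr01
      _ ≤ K2 ^ 4 * 2 ^ B := by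
        have := one_le_pow₀ hK2 (n := 4)
        have h2 : (1:ℝ) ≤ 2 ^ B := one_le_pow₀ (by norm_num)
        nlinarith
  refine ⟨r0, min (κ / 2) (c1 / (16 * K2 ^ 3)), hr0p, hr01, by positivity, ?_⟩
  intro m s hs1 hs2
  set X : ℝ := 1 + |s.im| + |(m : ℝ)| with hX
  have hX1 : 1 ≤ X := by rw [hX]; have := abs_nonneg s.im; have := abs_nonneg (m : ℝ); linarith
  have hXp : 0 < X := by linarith
  by_cases hcase : m = 0 ∧ |s.im| ≤ r0
  · obtain ⟨hm, him⟩ := hcase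
    refine (min_le_left _ _).trans ?_
    have : κ / 2 < ‖U 0 s‖ := by
      apply hball
      rw [dist_eq_norm]
      refine (Complex.norm_le_abs_re_add_abs_im _).trans_lt ?_
      simp only [sub_re, one_re, sub_im, one_im, sub_zero]
      rw [abs_of_pos (by linarith)]
      linarith
    rw [hm]
    have h1 : (1:ℝ) ≤ X ^ (4 * B) := one_le_pow₀ hX1
    nlinarith [norm_nonneg (U 0 s)]
  · refine (min_le_right _ _).trans ?_
    have hcase' : m ≠ 0 ∨ r0 < |s.im| := by
      by_contra h; push Not at h; exact hcase ⟨h.1, h.2⟩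
    -- quartic bound
    have hq : ∀ σ : ℝ, 1 < σ → σ ≤ 2 → c1 * (σ - 1) ^ 3 ≤ ‖U m (σ + s.im * I)‖ ^ 4 * X ^ B := by
      intro σ hσ hσ2
      have h := pd_341 Z D h1 h3 h4 m σ s.im hσ
      have hσ0 : 0 < σ - 1 := by linarith
      have e0 : ‖Z 0 σ‖ ≤ K2 / (σ - 1) := by
        have h' := hb0 0 σ (by simp; linarith) (by simpa using hσ2)
        rw [hUZ 0 σ (by simpa using hσ)] at h'
        simp only [if_true, norm_mul] at h'
        have : ‖(σ : ℂ) - 1‖ = σ - 1 := by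
          rw [show (σ : ℂ) - 1 = ((σ - 1 : ℝ) : ℂ) by push_cast; ring, Complex.norm_real, Real.norm_eq_abs, abs_of_pos hσ0]
        rw [this] at h'
        simp at h'
        rw [le_div_iff₀ hσ0]; linarith
      have e1 : ‖Z m (σ + s.im * I)‖ ≤ ‖U m (σ + s.im * I)‖ / r0 := by
        rw [hUZ m (σ + s.im * I) (by simpa using hσ), norm_mul, le_div_iff₀ hr0p, mul_comm]
        gcongr
        split_ifs with hm
        · have : r0 < |s.im| := by tauto
          refine this.le.trans ?_
          have := Complex.abs_im_le_norm ((σ:ℂ) + s.im * I - 1)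
          simpa using this
        · simpa using hr01
      have e2 : ‖Z (2 * m) (σ + 2 * s.im * I)‖ ≤ K2 * (2 * X) ^ B / r0 := by
        have h' := hb0 (2 * m) (σ + 2 * s.im * I) (by simp; linarith) (by simpa using hσ2)
        have h'' : ‖U (2 * m) (σ + 2 * s.im * I)‖ ≤ K2 * (2 * X) ^ B := by
          refine h'.trans ?_
          gcongr
          simp [abs_mul]
          rw [hX]; linarith
        rw [le_div_iff₀ hr0p]
        refine le_trans ?_ h''
        rw [hUZ (2 * m) (σ + 2 * s.im * I) (by simpa using hσ), norm_mul, mul_comm]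
        gcongr
        split_ifs with hm
        · have : r0 < |s.im| := by
            rcases hcase' with h | h
            · exact absurd (by omega) h
            · exact h
          have h5 := Complex.abs_im_le_norm ((σ:ℂ) + 2 * s.im * I - 1)
          simp [abs_mul] at h5
          linarith
        · simpa using hr01
      have hall : 1 ≤ (K2 / (σ - 1)) ^ 3 * (‖U m (σ + s.im * I)‖ / r0) ^ 4 * (K2 * (2 * X) ^ B / r0) := by
        refine h.trans ?_
        gcongr
      have : (K2 / (σ - 1)) ^ 3 * (‖U m (σ + s.im * I)‖ / r0) ^ 4 * (K2 * (2 * X) ^ B / r0)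
          = (‖U m (σ + s.im * I)‖ ^ 4 * X ^ B) / (c1 * (σ - 1) ^ 3) := by
        rw [hc1, mul_pow]; field_simp
      rw [this, one_le_div (by positivity)] at hall
      exact hall
    set η : ℝ := c1 / (16 * K2 ^ 4 * X ^ (5 * B)) with hη
    have hηp : 0 < η := by positivity
    have hη1 : η ≤ 1 := by
      rw [hη, div_le_one (by positivity)]
      have a1 := one_le_pow₀ hK2 (n := 4)
      have a2 := one_le_pow₀ hX1 (n := 5 * B)
      nlinarith
    have hηlow : ∀ σ : ℝ, 1 + η ≤ σ → σ ≤ 2 → 2 * K2 * X ^ B * η ≤ ‖U m (σ + s.im * I)‖ := by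
      intro σ h1 h2
      have h := hq σ (by linarith) h2
      have h' : c1 * η ^ 3 ≤ ‖U m (σ + s.im * I)‖ ^ 4 * X ^ B := by
        refine le_trans ?_ h
        gcongr; linarith
      have : (2 * K2 * X ^ B * η) ^ 4 * X ^ B = c1 * η ^ 3 := by
        have : η * (16 * K2 ^ 4 * X ^ (5 * B)) = c1 := by rw [hη]; field_simp
        rw [← this]; ring
      rw [← this] at h'
      have h'' := le_of_mul_le_mul_right h' (by positivity)
      exact le_of_pow_le_pow_left₀ (by norm_num) (norm_nonneg _) h''
    have hfin : K2 * X ^ B * η ≤ ‖U m s‖ := by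
      have hs : s = (s.re : ℂ) + s.im * I := (Complex.re_add_im s).symm
      by_cases hσ : 1 + η ≤ s.re
      · have := hηlow s.re hσ (by linarith)
        rw [← hs] at this
        have : 0 < K2 * X ^ B * η := by positivity
        linarith
      · push Not at hσ
        have h5 := hηlow (1 + η) le_rfl (by linarith)
        have hconv : Convex ℝ {z : ℂ | 1 ≤ z.re ∧ z.re ≤ 2 ∧ z.im = s.im} := by
          have : {z : ℂ | 1 ≤ z.re ∧ z.re ≤ 2 ∧ z.im = s.im} = (re ⁻¹' Icc 1 2) ∩ (im ⁻¹' {s.im}) := by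
            ext z; simp [and_assoc]
          rw [this]
          exact ((convex_Icc 1 2).linear_preimage Complex.reLm).inter ((convex_singleton _).linear_preimage Complex.imLm)
        have h6 := hconv.norm_image_sub_le_of_norm_deriv_le (𝕜 := ℂ) (f := U m) (C := K2 * X ^ B)
          (x := s) (y := ((1 + η : ℝ) : ℂ) + s.im * I)
          (fun z hz => (hU m).differentiableAt (hopen.mem_nhds (by
            have := hz.1
            simp only [mem_ofPred_eq]; linarith)))
          (fun z hz => by
            have := hb1 m z hz.1 hz.2.1
            rw [hz.2.2] at this; exact this)
          ⟨hs1.le, by linarith, rfl⟩ (by simp; constructor <;> linarith)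
        have h7 : ‖((1 + η : ℝ) : ℂ) + s.im * I - s‖ ≤ η := by
          have : ((1 + η : ℝ) : ℂ) + s.im * I - s = ((1 + η - s.re : ℝ) : ℂ) := by
            nth_rw 2 [hs]; push_cast; ring
          rw [this, Complex.norm_real, Real.norm_eq_abs, abs_of_pos (by linarith)]
          linarith
        have h8 : ‖U m (((1 + η : ℝ) : ℂ) + s.im * I)‖ ≤ ‖U m s‖ + K2 * X ^ B * η := by
          have h9 := norm_sub_norm_le (U m (((1 + η : ℝ) : ℂ) + s.im * I)) (U m s)
          have : K2 * X ^ B * ‖((1 + η : ℝ) : ℂ) + s.im * I - s‖ ≤ K2 * X ^ B * η := by gcongr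
          linarith
        linarith
    calc c1 / (16 * K2 ^ 3) = (K2 * X ^ B * η) * X ^ (4 * B) := by
          rw [hη, show 5 * B = B + 4 * B by ring, pow_add]; field_simp
      _ ≤ _ := by gcongr

theorem pd_main (Z D R : ℤ → ℂ → ℂ) (κ K0 : ℝ) (A : ℕ) (hκ : 0 < κ)
    (h1 : ∀ m s, 1 < s.re → HasDerivAt (Z m) (-(D m s * Z m s)) s)
    (h2 : ∀ m s, 1 < s.re → Z m s = (if m = 0 then (κ : ℂ) / (s - 1) else 0) + R m s)
    (hR : ∀ m, DifferentiableOn ℂ (R m) {s | 1/2 < s.re})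
    (hRb : ∀ (m : ℤ) s, 3/4 ≤ s.re → s.re ≤ 3 → ‖R m s‖ ≤ K0 * (1 + |s.im| + |(m : ℝ)|) ^ A)
    (h3 : ∀ m : ℤ, ∀ σ t : ℝ, 1 < σ →
      0 ≤ (3 * D 0 σ + 4 * D m (σ + t * I) + D (2 * m) (σ + 2 * t * I)).re)
    (h4 : ∀ m : ℤ, ∀ t : ℝ, Tendsto (fun σ : ℝ => Z m (σ + t * I)) atTop (𝓝 1)) :
    ∃ (r0 K : ℝ) (B : ℕ), 0 < r0 ∧ r0 ≤ 1 ∧ 0 < K ∧ ∀ (m : ℤ) s, 1 < s.re → s.re ≤ 1 + r0 →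
      ‖D m s - (if m = 0 then 1 / (s - 1) else 0)‖ ≤ K * (1 + |s.im| + |(m : ℝ)|) ^ B ∧
      ‖deriv (D m) s + (if m = 0 then 1 / (s - 1) ^ 2 else 0)‖ ≤ K * (1 + |s.im| + |(m : ℝ)|) ^ B := by
  have hopen : IsOpen {s : ℂ | 1/2 < s.re} := isOpen_lt continuous_const Complex.continuous_re
  have hopen1 : IsOpen {s : ℂ | 1 < s.re} := isOpen_lt continuous_const Complex.continuous_re
  set U : ℤ → ℂ → ℂ := fun m s => if m = 0 then κ + (s - 1) * R m s else R m s with hUdef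
  have hU : ∀ m, DifferentiableOn ℂ (U m) {s | 1/2 < s.re} := by
    intro m
    by_cases hm : m = 0
    · simp only [hUdef, hm, if_true]
      exact (differentiableOn_const _).add ((differentiableOn_id.sub_const _).mul (hR 0))
    · simp only [hUdef, hm, if_false]; exact hR m
  have hUZ : ∀ m s, 1 < s.re → U m s = (if m = 0 then (s - 1) else 1) * Z m s := by
    intro m s hs
    have hne : s - 1 ≠ 0 := by
      intro h; have := congrArg re h; simp at this; linarith
    rw [h2 m s hs]
    by_cases hm : m = 0
    · simp only [hUdef, hm, if_true]; field_simp
    · simp [hUdef, hm]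
  have hK0 : 0 ≤ K0 := by
    have h := hRb 0 1 (by norm_num) (by norm_num)
    simp at h
    exact (norm_nonneg _).trans h
  set K1 : ℝ := 1 + κ + 3 * K0 with hK1
  have hUb : ∀ (m : ℤ) s, 3/4 ≤ s.re → s.re ≤ 3 → ‖U m s‖ ≤ K1 * (1 + |s.im| + |(m : ℝ)|) ^ (A + 1) := by
    intro m s hs1 hs2
    have h := hRb m s hs1 hs2
    set X : ℝ := 1 + |s.im| + |(m : ℝ)| with hX
    have hX1 : 1 ≤ X := by rw [hX]; have := abs_nonneg s.im; have := abs_nonneg (m : ℝ); linarith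
    have hXA : 1 ≤ X ^ A := one_le_pow₀ hX1
    by_cases hm : m = 0
    · simp only [hUdef, hm, if_true]
      rw [hm] at h
      have hn : ‖s - 1‖ ≤ 3 * X := by
        refine (Complex.norm_le_abs_re_add_abs_im _).trans ?_
        simp only [sub_re, one_re, sub_im, one_im, sub_zero]
        have : |s.re - 1| ≤ 2 := by rw [abs_le]; constructor <;> linarith
        have := abs_nonneg (m : ℝ); have := abs_nonneg s.im
        linarith
      calc ‖(κ : ℂ) + (s - 1) * R 0 s‖ ≤ κ + (3 * X) * (K0 * X ^ A) := by
            refine (norm_add_le _ _).trans ?_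
            rw [norm_mul, Complex.norm_real, Real.norm_of_nonneg hκ.le]
            gcongr
        _ ≤ K1 * X ^ (A + 1) := by
            rw [hK1, pow_succ]
            have : 1 ≤ X ^ A * X := by nlinarith
            nlinarith
    · simp only [hUdef, hm, if_false]
      refine h.trans ?_
      have : X ^ A ≤ X ^ (A + 1) := pow_le_pow_right₀ hX1 (by omega)
      calc K0 * X ^ A ≤ K0 * X ^ (A + 1) := by gcongr
        _ ≤ K1 * X ^ (A + 1) := by gcongr; rw [hK1]; linarith
  have hK1p : 0 ≤ K1 := by rw [hK1]; positivity
  have hd1 : ∀ (m : ℤ) s, 7/8 ≤ s.re → s.re ≤ 23/8 →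
      ‖deriv (U m) s‖ ≤ (K1 * 2 ^ (A+1) / (1/8)) * (1 + |s.im| + |(m : ℝ)|) ^ (A + 1) := by
    intro m s hs1 hs2
    exact pd_cauchy (hU m) (α := 3/4) (β := 3) (r := 1/8) (by norm_num) (by norm_num) (by norm_num)
      (abs_nonneg _) hK1p (hUb m) s (by linarith) (by linarith)
  have hd2 : ∀ (m : ℤ) s, 1 ≤ s.re → s.re ≤ 2 →
      ‖deriv (deriv (U m)) s‖ ≤ ((K1 * 2 ^ (A+1) / (1/8)) * 2 ^ (A+1) / (1/8)) * (1 + |s.im| + |(m : ℝ)|) ^ (A + 1) := by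
    intro m s hs1 hs2
    exact pd_cauchy ((hU m).deriv hopen) (α := 7/8) (β := 23/8) (r := 1/8) (by norm_num) (by norm_num) (by norm_num)
      (abs_nonneg _) (by positivity) (hd1 m) s (by linarith) (by linarith)
  set K2 : ℝ := K1 * 2 ^ (A+1) / (1/8) * 2 ^ (A+1) / (1/8) with hK2
  have hp2 : (1:ℝ) ≤ 2 ^ (A + 1) := one_le_pow₀ (by norm_num)
  have hle12 : K1 * 2 ^ (A+1) / (1/8) ≤ K2 := by
    rw [hK2]
    have : 0 ≤ K1 * 2 ^ (A+1) := by positivity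
    have h' : K1 * 2 ^ (A+1) ≤ K1 * 2 ^ (A+1) * 2 ^ (A+1) := le_mul_of_one_le_right this hp2
    have e1 : K1 * 2 ^ (A+1) / (1/8) = 8 * (K1 * 2 ^ (A+1)) := by ring
    have e2 : K1 * 2 ^ (A+1) / (1/8) * 2 ^ (A+1) / (1/8) = 64 * (K1 * 2 ^ (A+1) * 2 ^ (A+1)) := by ring
    rw [e2, e1]; nlinarith
  have hle02 : K1 ≤ K2 := by
    refine le_trans ?_ hle12
    have h' : K1 ≤ K1 * 2 ^ (A+1) := le_mul_of_one_le_right hK1p hp2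
    have e1 : K1 * 2 ^ (A+1) / (1/8) = 8 * (K1 * 2 ^ (A+1)) := by ring
    rw [e1]; nlinarith
  have hK21 : 1 ≤ K2 := by
    refine le_trans ?_ hle02
    rw [hK1]; linarith
  have hb0 : ∀ (m : ℤ) s, 1 ≤ s.re → s.re ≤ 2 → ‖U m s‖ ≤ K2 * (1 + |s.im| + |(m : ℝ)|) ^ (A+1) :=
    fun m s a b => (hUb m s (by linarith) (by linarith)).trans (by gcongr)
  have hb1 : ∀ (m : ℤ) s, 1 ≤ s.re → s.re ≤ 2 → ‖deriv (U m) s‖ ≤ K2 * (1 + |s.im| + |(m : ℝ)|) ^ (A+1) :=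
    fun m s a b => (hd1 m s (by linarith) (by linarith)).trans (by gcongr)
  obtain ⟨r0, c, hr0, hr01, hc, hlow⟩ := pd_lower Z D U κ K2 (A+1) hκ hK21 h1 hU hUZ (by simp [hUdef]) hb0 hb1 h3 h4
  -- nonvanishing
  have hUne : ∀ (m : ℤ) s, 1 < s.re → U m s ≠ 0 → D m s = -(deriv (U m) s / U m s) + (if m = 0 then 1 / (s - 1) else 0) := by
    intro m s hs hne
    have hne1 : s - 1 ≠ 0 := by
      intro h; have := congrArg re h; simp at this; linarith
    have hev : U m =ᶠ[𝓝 s] fun z => (if m = 0 then (z - 1) else 1) * Z m z := by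
      filter_upwards [hopen1.mem_nhds hs] with z hz using hUZ m z hz
    have hder : HasDerivAt (U m) ((if m = 0 then 1 else 0) * Z m s + (if m = 0 then (s - 1) else 1) * (-(D m s * Z m s))) s := by
      refine HasDerivAt.congr_of_eventuallyEq ?_ hev
      refine HasDerivAt.mul ?_ (h1 m s hs)
      by_cases hm : m = 0
      · simp only [hm, if_true]; exact (hasDerivAt_id s).sub_const 1
      · simp only [hm, if_false]; exact hasDerivAt_const s 1
    rw [hder.deriv]
    rw [hUZ m s hs] at hne ⊢
    have hZ : Z m s ≠ 0 := right_ne_zero_of_mul hne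
    by_cases hm : m = 0
    · simp only [hm, if_true] at *
      field_simp; ring
    · simp only [hm, if_false] at *
      field_simp; ring
  refine ⟨r0 / 2, 2 * (K2 / c) + 2 * (K2 ^ 2 / c ^ 2) + 1, 10 * (A + 1), by positivity, by linarith, by positivity, ?_⟩
  intro m s hs1 hs2
  have hlow' : ∀ z, 1 < z.re → z.re ≤ 1 + r0 → U m z ≠ 0 := by
    intro z a b h
    have := hlow m z a b
    rw [h] at this; simp at this; linarith
  have hne := hlow' s hs1 (by linarith)
  have hne1 : s - 1 ≠ 0 := by
    intro h; have := congrArg re h; simp at this; linarith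
  have hl := hlow m s hs1 (by linarith)
  have u0 := hb0 m s hs1.le (by linarith)
  have u1 := hb1 m s hs1.le (by linarith)
  have u2 := hd2 m s hs1.le (by linarith)
  set X : ℝ := 1 + |s.im| + |(m : ℝ)| with hX
  have hX1 : 1 ≤ X := by rw [hX]; have := abs_nonneg s.im; have := abs_nonneg (m : ℝ); linarith
  have hUpos : 0 < ‖U m s‖ := norm_pos_iff.mpr hne
  have hinv : ‖U m s‖⁻¹ ≤ X ^ (4 * (A+1)) / c := by
    rw [inv_le_comm₀ hUpos (by positivity), inv_div, div_le_iff₀ (by positivity)]; exact hl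
  have q1 : ‖deriv (U m) s / U m s‖ ≤ (K2 / c) * X ^ (5 * (A+1)) := by
    rw [div_eq_mul_inv, norm_mul, norm_inv]
    calc _ ≤ (K2 * X ^ (A+1)) * (X ^ (4 * (A+1)) / c) := by gcongr
      _ = _ := by rw [show 5 * (A+1) = (A+1) + 4 * (A+1) by ring, pow_add]; ring
  have q2 : ‖deriv (deriv (U m)) s / U m s‖ ≤ (K2 / c) * X ^ (5 * (A+1)) := by
    rw [div_eq_mul_inv, norm_mul, norm_inv]
    calc _ ≤ (K2 * X ^ (A+1)) * (X ^ (4 * (A+1)) / c) := by gcongr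
      _ = _ := by rw [show 5 * (A+1) = (A+1) + 4 * (A+1) by ring, pow_add]; ring
  have hXX : X ^ (5 * (A+1)) ≤ X ^ (10 * (A+1)) := pow_le_pow_right₀ hX1 (by omega)
  have hXone : 1 ≤ X ^ (10 * (A+1)) := one_le_pow₀ hX1
  have hpos1 : 0 < K2 / c := by positivity
  constructor
  · rw [hUne m s hs1 hne, add_sub_cancel_right, norm_neg]
    refine q1.trans ?_
    have : 0 < K2 ^ 2 / c ^ 2 := by positivity
    gcongr
    linarith
  · have hev : D m =ᶠ[𝓝 s] fun z => -(deriv (U m) z / U m z) + (if m = 0 then 1 / (z - 1) else 0) := by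
      have ho : IsOpen {z : ℂ | 1 < z.re ∧ z.re < 1 + r0} :=
        hopen1.inter (isOpen_lt Complex.continuous_re continuous_const)
      filter_upwards [ho.mem_nhds ⟨hs1, by linarith⟩] with z hz
      exact hUne m z hz.1 (hlow' z hz.1 hz.2.le)
    have hUd : HasDerivAt (U m) (deriv (U m) s) s :=
      ((hU m).differentiableAt (hopen.mem_nhds (by simp only [mem_ofPred_eq]; linarith))).hasDerivAt
    have hUd2 : HasDerivAt (deriv (U m)) (deriv (deriv (U m)) s) s :=
      (((hU m).deriv hopen).differentiableAt (hopen.mem_nhds (by simp only [mem_ofPred_eq]; linarith))).hasDerivAt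
    have hpole : HasDerivAt (fun z : ℂ => if m = 0 then 1 / (z - 1) else 0) (if m = 0 then -(1 / (s-1)^2) else 0) s := by
      by_cases hm : m = 0
      · simp only [hm, if_true]
        have := ((hasDerivAt_id s).sub_const 1).inv hne1
        simp only [id] at this
        refine (this.congr_of_eventuallyEq ?_).congr_deriv ?_
        · filter_upwards with z; simp
        · simp [neg_div]
      · simp only [hm, if_false]; exact hasDerivAt_const _ _
    have hD := (((hUd2.div hUd hne).neg).add hpole)
    have hD' : deriv (D m) s = _ := (hD.congr_of_eventuallyEq hev).deriv
    rw [hD']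
    have : -((deriv (deriv (U m)) s * U m s - deriv (U m) s * deriv (U m) s) / U m s ^ 2) + (if m = 0 then -(1 / (s-1)^2) else 0)
        + (if m = 0 then 1 / (s - 1) ^ 2 else 0) = (deriv (U m) s / U m s) ^ 2 - deriv (deriv (U m)) s / U m s := by
      split_ifs <;> field_simp <;> ring
    rw [this]
    refine (norm_sub_le _ _).trans ?_
    rw [norm_pow]
    calc ‖deriv (U m) s / U m s‖ ^ 2 + ‖deriv (deriv (U m)) s / U m s‖
        ≤ ((K2 / c) * X ^ (5 * (A+1))) ^ 2 + (K2 / c) * X ^ (5 * (A+1)) := by gcongr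
      _ ≤ (K2 ^ 2 / c ^ 2) * X ^ (10 * (A+1)) + (K2 / c) * X ^ (10 * (A+1)) := by
          have : ((K2 / c) * X ^ (5 * (A+1))) ^ 2 = (K2 ^ 2 / c ^ 2) * X ^ (10 * (A+1)) := by
            rw [mul_pow, ← pow_mul, div_pow]; congr 2; ring
          rw [this]; gcongr
      _ ≤ _ := by
          have : 0 < K2 ^ 2 / c ^ 2 := by positivity
          nlinarith
end PartD

section PartA
open Complex Filter Topology Set MeasureTheory

theorem pa_norm_Gamma_le {s : ℂ} (hs : 0 < s.re) : ‖Gamma s‖ ≤ Real.Gamma s.re := by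
  rw [Complex.Gamma_eq_integral hs, Real.Gamma_eq_integral hs]
  unfold Complex.GammaIntegral
  refine (norm_integral_le_integral_norm _).trans (le_of_eq ?_)
  apply setIntegral_congr_fun measurableSet_Ioi
  intro x hx
  have hx' : 0 < x := hx
  simp only [norm_mul, Complex.norm_real, Complex.norm_cpow_eq_rpow_re_of_pos hx', sub_re, one_re, Real.norm_eq_abs, abs_of_pos (Real.exp_pos _)]

theorem pa_Gamma_bdd (σ0 X : ℝ) (h0 : 0 < σ0) : ∃ C, ∀ σ : ℝ, σ0 ≤ σ → σ ≤ X → Real.Gamma σ ≤ C := by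
  have hc : ContinuousOn Real.Gamma (Icc σ0 X) := by
    intro x hx
    refine (Real.differentiableAt_Gamma fun m => ?_).continuousAt.continuousWithinAt
    have := hx.1
    have hm : (0:ℝ) ≤ m := by positivity
    intro h; linarith
  obtain ⟨C, hC⟩ := isCompact_Icc.bddAbove_image hc
  exact ⟨C, fun σ h1 h2 => hC ⟨σ, ⟨h1, h2⟩, rfl⟩⟩

theorem pa_Gamma_decay (k : ℕ) : ∀ (σ0 X : ℝ), 0 < σ0 → ∃ C, 0 < C ∧ ∀ s : ℂ, σ0 ≤ s.re → s.re ≤ X →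
    ‖Gamma s‖ * (1 + ‖s‖) ^ k ≤ C := by
  induction k with
  | zero =>
    intro σ0 X h0
    obtain ⟨C, hC⟩ := pa_Gamma_bdd σ0 X h0
    refine ⟨max C 1, by positivity, fun s h1 h2 => ?_⟩
    simp only [pow_zero, mul_one]
    exact (pa_norm_Gamma_le (by linarith)).trans ((hC _ h1 h2).trans (le_max_left _ _))
  | succ k ih =>
    intro σ0 X h0
    obtain ⟨C, hCp, hC⟩ := ih σ0 (X + 1) h0
    refine ⟨C * (1 + 1 / σ0), by positivity, fun s h1 h2 => ?_⟩
    have hs0 : s ≠ 0 := by intro h; rw [h] at h1; simp at h1; linarith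
    have h := hC (s + 1) (by simp; linarith) (by simp; linarith)
    rw [Complex.Gamma_add_one s hs0, norm_mul] at h
    have hn : σ0 ≤ ‖s‖ := h1.trans (Complex.re_le_norm s)
    have e1 : (1 + ‖s‖) ≤ ‖s‖ * (1 + 1 / σ0) := by
      have : 1 ≤ ‖s‖ / σ0 := by rw [one_le_div h0]; exact hn
      have e : ‖s‖ * (1 + 1 / σ0) = ‖s‖ + ‖s‖ / σ0 := by ring
      linarith
    have e2 : ‖s‖ ≤ ‖s + 1‖ := by
      refine le_of_pow_le_pow_left₀ two_ne_zero (norm_nonneg _) ?_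
      rw [Complex.sq_norm, Complex.sq_norm, Complex.normSq_apply, Complex.normSq_apply]
      simp only [add_re, one_re, add_im, one_im]
      nlinarith
    calc ‖Gamma s‖ * (1 + ‖s‖) ^ (k+1) = ‖Gamma s‖ * (1 + ‖s‖) ^ k * (1 + ‖s‖) := by ring
      _ ≤ ‖Gamma s‖ * (1 + ‖s + 1‖) ^ k * (‖s‖ * (1 + 1 / σ0)) := by gcongr
      _ = (‖s‖ * ‖Gamma s‖ * (1 + ‖s + 1‖) ^ k) * (1 + 1 / σ0) := by ring
      _ ≤ C * (1 + 1 / σ0) := by gcongr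

theorem pa_continuous_Gamma_line {σ : ℝ} (hσ : 0 < σ) : Continuous fun t : ℝ => Gamma (σ + t * I) := by
  rw [continuous_iff_continuousAt]
  intro t
  have : ContinuousAt Gamma (σ + t * I) := by
    refine (Complex.differentiableAt_Gamma _ fun m h => ?_).continuousAt
    have := congrArg re h
    simp at this
    have hm : (0:ℝ) ≤ m := by positivity
    linarith
  exact ContinuousAt.comp (f := fun t : ℝ => (σ : ℂ) + t * I) this (by fun_prop)

theorem pa_Gamma_integrable {σ : ℝ} (hσ : 0 < σ) : Integrable fun t : ℝ => Gamma (σ + t * I) := by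
  obtain ⟨C, hCp, hC⟩ := pa_Gamma_decay 2 σ σ hσ
  have hi : Integrable fun t : ℝ => C * (1 + t ^ 2)⁻¹ := integrable_inv_one_add_sq.const_mul C
  refine hi.mono' (pa_continuous_Gamma_line hσ).aestronglyMeasurable (Eventually.of_forall fun t => ?_)
  have h := hC (σ + t * I) (by simp) (by simp)
  rw [← div_eq_mul_inv, le_div_iff₀ (by positivity)]
  refine le_trans ?_ h
  gcongr
  have := Complex.abs_im_le_norm (σ + t * I)
  simp at this
  have h2 : t ^ 2 = |t| ^ 2 := (sq_abs t).symm
  nlinarith [abs_nonneg t, norm_nonneg ((σ:ℂ) + t * I)]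

theorem pa_inversion {σ : ℝ} (hσ : 0 < σ) {x : ℝ} (hx : 0 < x) :
    ((Real.exp (-x) : ℝ) : ℂ) = (1 / (2 * Real.pi) : ℂ) * ∫ t : ℝ, (x : ℂ) ^ (-((σ:ℂ) + t * I)) * Gamma (σ + t * I) := by
  have hm : ∀ s : ℂ, 0 < s.re → mellin (fun x : ℝ => ((Real.exp (-x) : ℝ) : ℂ)) s = Gamma s := by
    intro s hs
    rw [Complex.Gamma_eq_integral hs, Complex.GammaIntegral_eq_mellin]
  have h := mellinInv_mellin_eq σ (fun x : ℝ => ((Real.exp (-x) : ℝ) : ℂ)) hx ?_ ?_ ?_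
  · rw [← h, mellinInv]
    simp only [one_div, smul_eq_mul]
    rw [Complex.real_smul]
    push_cast
    congr 1
    congr 1
    ext t
    have := hm (σ + t * I) (by simpa using hσ)
    push_cast at this
    rw [this]
  · have := Complex.GammaIntegral_convergent (s := σ) (by simpa using hσ)
    unfold MellinConvergent
    refine this.congr_fun (fun x hx => ?_) measurableSet_Ioi
    simp [mul_comm]
  · unfold VerticalIntegrable
    refine (pa_Gamma_integrable hσ).congr (Eventually.of_forall fun t => ?_)
    simp only
    rw [hm _ (by simpa using hσ)]
  · fun_prop
end PartA

section PB
open Complex MeasureTheory Set Filter Topology FourierTransform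

/-- the weight `w(y) = a e^{2Ly} + b e^{-2Ly}` -/
noncomputable def pw (a b L y : ℝ) : ℝ := a * Real.exp (2 * L * y) + b * Real.exp (-(2 * L * y))

/-- `w(y)^{-s}` -/
noncomputable def pphi (a b L : ℝ) (s : ℂ) (y : ℝ) : ℂ := cexp (-s * (Real.log (pw a b L y) : ℝ))

noncomputable def pJ (a b L : ℝ) (s : ℂ) (m : ℤ) : ℂ := 𝓕 (pphi a b L s) (m : ℝ)

variable {a b L : ℝ}

theorem pw_pos (ha : 0 < a) (hb : 0 < b) (y : ℝ) : 0 < pw a b L y := by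
  unfold pw; positivity

theorem pw_ge (ha : 0 < a) (hb : 0 < b) (_hL : 0 < L) (y : ℝ) :
    min a b * Real.exp (2 * L * |y|) ≤ pw a b L y := by
  unfold pw
  have h1 := min_le_left a b
  have h2 := min_le_right a b
  have e1 := Real.exp_pos (2 * L * y)
  have e2 := Real.exp_pos (-(2 * L * y))
  rcases abs_cases y with ⟨h, _⟩ | ⟨h, _⟩ <;> rw [h]
  · nlinarith [mul_pos hb e2]
  · rw [show 2 * L * -y = -(2 * L * y) by ring]; nlinarith [mul_pos ha e1]

theorem pw_cont : Continuous (pw a b L) := by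
  unfold pw; fun_prop

theorem pw_hasDeriv (y : ℝ) : HasDerivAt (pw a b L)
    (2 * L * (a * Real.exp (2 * L * y) - b * Real.exp (-(2 * L * y)))) y := by
  unfold pw
  have h1 : HasDerivAt (fun y : ℝ => 2 * L * y) (2 * L) y := by
    simpa using (hasDerivAt_id y).const_mul (2 * L)
  refine ((h1.exp.const_mul a).add (h1.neg.exp.const_mul b)).congr_deriv ?_
  simp only [Pi.neg_apply]
  ring

theorem pphi_cont (ha : 0 < a) (hb : 0 < b) (s : ℂ) : Continuous (pphi a b L s) := by
  unfold pphi
  have : Continuous fun y => Real.log (pw a b L y) := pw_cont.log fun y => (pw_pos ha hb y).ne'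
  fun_prop

theorem pphi_norm (s : ℂ) (y : ℝ) : ‖pphi a b L s y‖ = Real.exp (-s.re * Real.log (pw a b L y)) := by
  unfold pphi
  rw [Complex.norm_exp]
  simp

theorem pphi_bound (ha : 0 < a) (hb : 0 < b) (hL : 0 < L) (σ0 X : ℝ) (h0 : 0 < σ0) :
    ∃ C, 0 < C ∧ ∀ s : ℂ, σ0 ≤ s.re → s.re ≤ X → ∀ y, ‖pphi a b L s y‖ ≤ C * (1 + y ^ 2)⁻¹ := by
  have hc0 : 0 < min a b := lt_min ha hb
  refine ⟨Real.exp (X * |Real.log (min a b)|) * (1 + 2 / (2 * L * σ0) ^ 2), by positivity, fun s h1 h2 y => ?_⟩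
  rw [pphi_norm]
  have hlw : Real.log (min a b) + 2 * L * |y| ≤ Real.log (pw a b L y) := by
    have := Real.log_le_log (by positivity) (pw_ge ha hb hL y)
    rwa [Real.log_mul hc0.ne' (Real.exp_pos _).ne', Real.log_exp] at this
  set u := 2 * L * σ0 * |y| with hu
  have hu0 : 0 ≤ u := by positivity
  have hle : -s.re * Real.log (pw a b L y) ≤ X * |Real.log (min a b)| + -u := by
    have e1 : s.re * (Real.log (min a b) + 2 * L * |y|) ≤ s.re * Real.log (pw a b L y) :=
      mul_le_mul_of_nonneg_left hlw (by linarith)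
    have e2 : u ≤ s.re * (2 * L * |y|) := by
      have : 0 ≤ 2 * L * |y| := by positivity
      rw [hu]; nlinarith
    have e3 : -(s.re * Real.log (min a b)) ≤ X * |Real.log (min a b)| := by
      have := neg_abs_le (Real.log (min a b))
      have h4 := abs_nonneg (Real.log (min a b))
      nlinarith
    linarith
  refine (Real.exp_le_exp.mpr hle).trans ?_
  rw [Real.exp_add, mul_assoc]
  refine mul_le_mul_of_nonneg_left ?_ (Real.exp_pos _).le
  rw [Real.exp_neg, ← div_eq_mul_inv, le_div_iff₀ (by positivity), inv_mul_le_iff₀ (Real.exp_pos _)]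
  have hq := Real.quadratic_le_exp_of_nonneg hu0
  have hy : y ^ 2 = u ^ 2 * (1 / (2 * L * σ0) ^ 2) := by
    rw [hu, mul_pow, sq_abs]; field_simp
  rw [hy]
  set r := (2 * L * σ0) ^ 2 with hr
  have hr0 : 0 < r := by positivity
  have : 1 + u ^ 2 * (1 / r) ≤ (1 + u ^ 2 / 2) * (1 + 2 / r) := by
    have : (1 + u ^ 2 / 2) * (1 + 2 / r) = 1 + u ^ 2 * (1 / r) + u^2/2 + 2 / r := by field_simp; ring
    have : 0 ≤ u^2/2 + 2 / r := by positivity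
    linarith
  refine this.trans (mul_le_mul_of_nonneg_right (by linarith) (by positivity))

theorem pphi_integrable (ha : 0 < a) (hb : 0 < b) (hL : 0 < L) {s : ℂ} (hs : 0 < s.re) :
    Integrable (pphi a b L s) := by
  obtain ⟨C, hC, h⟩ := pphi_bound ha hb hL s.re s.re hs
  exact (integrable_inv_one_add_sq.const_mul C).mono' (pphi_cont ha hb s).aestronglyMeasurable
    (Eventually.of_forall fun y => h s le_rfl le_rfl y)

/-- `(p - q)/w` -/
noncomputable def pr (a b L y : ℝ) : ℝ :=
  (a * Real.exp (2 * L * y) - b * Real.exp (-(2 * L * y))) / pw a b L y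

theorem pr_abs (ha : 0 < a) (hb : 0 < b) (y : ℝ) : |pr a b L y| ≤ 1 := by
  unfold pr
  rw [abs_div, abs_of_pos (pw_pos ha hb y), div_le_one (pw_pos ha hb y)]
  unfold pw
  rw [abs_le]
  have e1 := mul_pos ha (Real.exp_pos (2 * L * y))
  have e2 := mul_pos hb (Real.exp_pos (-(2 * L * y)))
  constructor <;> linarith

theorem pr_cont (ha : 0 < a) (hb : 0 < b) : Continuous (pr a b L) := by
  unfold pr
  exact Continuous.div (by fun_prop) pw_cont fun y => (pw_pos ha hb y).ne'

theorem pr_hasDeriv (ha : 0 < a) (hb : 0 < b) (y : ℝ) :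
    HasDerivAt (pr a b L) (2 * L * (4 * a * b / (pw a b L y) ^ 2)) y := by
  have h1 : HasDerivAt (fun y : ℝ => 2 * L * y) (2 * L) y := by
    simpa using (hasDerivAt_id y).const_mul (2 * L)
  have hn := (h1.exp.const_mul a).sub (h1.neg.exp.const_mul b)
  have hp := pw_pos (L := L) ha hb y
  refine (hn.div (pw_hasDeriv y) hp.ne').congr_deriv ?_
  have hee : Real.exp (2 * L * y) * Real.exp (-(2 * L * y)) = 1 := by
    rw [← Real.exp_add]; simp
  simp only [Pi.neg_apply, Pi.sub_apply]
  rw [div_eq_iff (by positivity)]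
  have : 2 * L * (4 * a * b / pw a b L y ^ 2) * pw a b L y ^ 2 = 2 * L * (4 * a * b) := by
    field_simp
  rw [this]
  unfold pw
  linear_combination (2 * L * (4 * a * b)) * hee

theorem pphi_hasDeriv (ha : 0 < a) (hb : 0 < b) (s : ℂ) (y : ℝ) :
    HasDerivAt (pphi a b L s) (-(2 * L * s) * ((pr a b L y : ℝ) * pphi a b L s y)) y := by
  have hp := pw_pos (L := L) ha hb y
  have h1 := ((pw_hasDeriv (a := a) (b := b) (L := L) y).log hp.ne').ofReal_comp
  have h2 := (h1.const_mul (-s)).cexp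
  refine h2.congr_deriv ?_
  unfold pphi pr
  push_cast
  ring

theorem pphi_shift (ha : 0 < a) (hb : 0 < b) (s : ℂ) (y : ℝ) :
    pphi a b L (s + 2) y = pphi a b L s y * (1 / (pw a b L y) ^ 2 : ℝ) := by
  have hp := pw_pos (L := L) ha hb y
  unfold pphi
  have : ((1 / (pw a b L y) ^ 2 : ℝ) : ℂ) = cexp (-2 * (Real.log (pw a b L y) : ℝ)) := by
    rw [show (-2 : ℂ) * (Real.log (pw a b L y) : ℝ) = ((-(2 * Real.log (pw a b L y)) : ℝ) : ℂ) by push_cast; ring,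
      ← Complex.ofReal_exp, Real.exp_neg, two_mul, Real.exp_add, Real.exp_log hp]
    congr 1; field_simp
  rw [this, ← Complex.exp_add]
  congr 1; ring

theorem pphi_hasDeriv2 (ha : 0 < a) (hb : 0 < b) (s : ℂ) (y : ℝ) :
    HasDerivAt (fun y => -(2 * L * s) * ((pr a b L y : ℝ) * pphi a b L s y))
      (4 * L ^ 2 * (s ^ 2 * pphi a b L s y - 4 * a * b * s * (s + 1) * pphi a b L (s + 2) y)) y := by
  have hp := pw_pos (L := L) ha hb y
  refine (((pr_hasDeriv ha hb y).ofReal_comp.mul (pphi_hasDeriv ha hb s y)).const_mul _).congr_deriv ?_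
  rw [pphi_shift ha hb]
  have hr : (pr a b L y) ^ 2 = 1 - 4 * a * b / (pw a b L y) ^ 2 := by
    unfold pr
    have hee : Real.exp (2 * L * y) * Real.exp (-(2 * L * y)) = 1 := by
      rw [← Real.exp_add]; simp
    rw [div_pow, div_eq_iff (by positivity), sub_mul, div_mul_cancel₀ _ (by positivity)]
    unfold pw
    linear_combination (4 * a * b) * (-hee)
  have hr' : ((pr a b L y : ℝ) : ℂ) ^ 2 = 1 - 4 * a * b * ((1 / (pw a b L y) ^ 2 : ℝ) : ℂ) := by
    rw [← Complex.ofReal_pow, hr]; push_cast; ring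
  have e : ((2 * L * (4 * a * b / (pw a b L y) ^ 2) : ℝ) : ℂ) = 2 * L * (4 * a * b) * ((1 / (pw a b L y) ^ 2 : ℝ) : ℂ) := by
    push_cast; ring
  rw [e]
  linear_combination (4 * L^2 * s^2 * pphi a b L s y) * hr'

theorem pJ_rec (ha : 0 < a) (hb : 0 < b) (hL : 0 < L) {s : ℂ} (hs : 0 < s.re) (m : ℤ) :
    -(4 * Real.pi ^ 2 * m ^ 2) * pJ a b L s m =
      4 * L ^ 2 * (s ^ 2 * pJ a b L s m - 4 * a * b * s * (s + 1) * pJ a b L (s + 2) m) := by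
  have hs2 : 0 < (s + 2).re := by simp; linarith
  have i1 := pphi_integrable ha hb hL hs
  have i2 := pphi_integrable ha hb hL hs2
  have d1 : deriv (pphi a b L s) = fun y => -(2 * L * s) * ((pr a b L y : ℝ) * pphi a b L s y) :=
    funext fun y => (pphi_hasDeriv ha hb s y).deriv
  have d2 : deriv (fun y => -(2 * L * s) * ((pr a b L y : ℝ) * pphi a b L s y)) =
    fun y => (4 * L ^ 2 * (s ^ 2 * pphi a b L s y - 4 * a * b * s * (s + 1) * pphi a b L (s + 2) y)) :=
    funext fun y => (pphi_hasDeriv2 ha hb s y).deriv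
  have id1 : Integrable fun y => -(2 * L * s) * ((pr a b L y : ℝ) * pphi a b L s y) := by
    refine Integrable.const_mul ?_ _
    refine i1.mono ?_ (Eventually.of_forall fun y => ?_)
    · exact ((continuous_ofReal.comp (pr_cont ha hb)).mul (pphi_cont ha hb s)).aestronglyMeasurable
    · rw [norm_mul, Complex.norm_real, Real.norm_eq_abs]
      exact mul_le_of_le_one_left (norm_nonneg _) (pr_abs ha hb y)
  have id2 : Integrable fun y => (4 * L ^ 2 * (s ^ 2 * pphi a b L s y - 4 * a * b * s * (s + 1) * pphi a b L (s + 2) y)) :=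
    ((i1.const_mul _).sub (i2.const_mul _)).const_mul _
  have F1 := Real.fourier_deriv i1 (fun y => (pphi_hasDeriv ha hb s y).differentiableAt) (by rw [d1]; exact id1)
  have F2 := Real.fourier_deriv id1 (fun y => (pphi_hasDeriv2 ha hb s y).differentiableAt) (by rw [d2]; exact id2)
  rw [d1] at F1
  rw [d2, F1] at F2
  have F3 := congrFun F2 (m : ℝ)
  have F4 : (𝓕 (fun y : ℝ => (4 * (L:ℂ) ^ 2 * (s ^ 2 * pphi a b L s y - 4 * a * b * s * (s + 1) * pphi a b L (s + 2) y)) : ℝ → ℂ) : ℝ → ℂ) (m:ℝ)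
      = 4 * L ^ 2 * (s ^ 2 * pJ a b L s m - 4 * a * b * s * (s + 1) * pJ a b L (s + 2) m) := by
    unfold pJ
    simp only [Real.fourier_real_eq]
    rw [← integral_const_mul, ← integral_const_mul, ← integral_sub, ← integral_const_mul]
    · congr 1; ext y; simp only [Circle.smul_def, smul_eq_mul]; ring
    · exact Integrable.const_mul (by simpa [mul_comm] using (Real.fourierIntegral_convergent_iff (m:ℝ)).2 i1) _
    · exact Integrable.const_mul (by simpa [mul_comm] using (Real.fourierIntegral_convergent_iff (m:ℝ)).2 i2) _
  rw [F4] at F3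
  rw [F3]
  simp only [smul_eq_mul, pJ]
  push_cast
  linear_combination (-4 * (Real.pi:ℂ)^2 * m^2 * 𝓕 (pphi a b L s) (m:ℝ)) * I_sq

theorem pJ_norm_le (s : ℂ) (m : ℤ) : ‖pJ a b L s m‖ ≤ ∫ y, ‖pphi a b L s y‖ := by
  unfold pJ
  rw [Real.fourier_real_eq]
  refine (norm_integral_le_integral_norm _).trans (le_of_eq ?_)
  simp

theorem pJ_bound (ha : 0 < a) (hb : 0 < b) (hL : 0 < L) (j : ℕ) : ∀ (σ0 X : ℝ), 0 < σ0 →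
    ∃ C, 0 < C ∧ ∀ s : ℂ, σ0 ≤ s.re → s.re ≤ X → ∀ m : ℤ,
      ‖pJ a b L s m‖ * (1 + |(m:ℝ)|) ^ (2 * j) ≤ C * (1 + ‖s‖) ^ (2 * j) := by
  induction j with
  | zero =>
    intro σ0 X h0
    obtain ⟨C, hC, h⟩ := pphi_bound ha hb hL σ0 X h0
    refine ⟨C * Real.pi, by positivity, fun s h1 h2 m => ?_⟩
    simp only [mul_zero, pow_zero, mul_one]
    refine (pJ_norm_le s m).trans ?_
    rw [← integral_univ_inv_one_add_sq, ← integral_const_mul]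
    exact integral_mono (pphi_integrable ha hb hL (by linarith)).norm (integrable_inv_one_add_sq.const_mul C) (h s h1 h2)
  | succ j ih =>
    intro σ0 X h0
    obtain ⟨C1, hC1, h1⟩ := ih σ0 X h0
    obtain ⟨C2, hC2, h2⟩ := ih σ0 (X + 2) h0
    refine ⟨2 * (C1 + L ^ 2 * (C1 + 4 * a * b * (C2 * 9 ^ j))), by positivity, fun s hs1 hs2 m => ?_⟩
    have hr := pJ_rec ha hb hL (s := s) (by linarith) m
    have e1 := h1 s hs1 hs2 m
    have e2 := h2 (s + 2) (by simp; linarith) (by simp; linarith) m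
    set M := (1 + |(m:ℝ)|) ^ (2 * j) with hM
    set S := 1 + ‖s‖ with hS
    have hS1 : 1 ≤ S := by rw [hS]; linarith [norm_nonneg s]
    have hM1 : 0 < M := by positivity
    have e3 : ‖pJ a b L (s + 2) m‖ * M ≤ C2 * 9 ^ j * S ^ (2 * j) := by
      refine e2.trans ?_
      rw [mul_assoc]
      refine mul_le_mul_of_nonneg_left ?_ hC2.le
      have : 1 + ‖s + 2‖ ≤ 3 * S := by
        have := norm_add_le s 2
        simp at this
        rw [hS]; linarith [norm_nonneg s]
      calc (1 + ‖s + 2‖) ^ (2 * j) ≤ (3 * S) ^ (2 * j) := by gcongr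
        _ = 9 ^ j * S ^ (2 * j) := by rw [mul_pow, pow_mul 3 2 j]; norm_num
    have e4 : (m:ℝ) ^ 2 * ‖pJ a b L s m‖ ≤ L ^ 2 * (S ^ 2 * ‖pJ a b L s m‖ + 4 * a * b * S ^ 2 * ‖pJ a b L (s + 2) m‖) := by
      have hn := congrArg norm hr
      have hl : ‖-(4 * (Real.pi:ℂ) ^ 2 * m ^ 2) * pJ a b L s m‖ = 4 * Real.pi ^ 2 * (m:ℝ)^2 * ‖pJ a b L s m‖ := by
        rw [norm_mul, norm_neg]
        congr 1
        rw [show (4 * (Real.pi:ℂ) ^ 2 * m ^ 2) = ((4 * Real.pi ^ 2 * (m:ℝ) ^ 2 : ℝ) : ℂ) by push_cast; ring, Complex.norm_real,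
          Real.norm_of_nonneg (by positivity)]
      have hrr : ‖4 * (L:ℂ) ^ 2 * (s ^ 2 * pJ a b L s m - 4 * a * b * s * (s + 1) * pJ a b L (s + 2) m)‖ ≤
          4 * L ^ 2 * (S ^ 2 * ‖pJ a b L s m‖ + 4 * a * b * S ^ 2 * ‖pJ a b L (s + 2) m‖) := by
        rw [norm_mul]
        have : ‖4 * (L:ℂ) ^ 2‖ = 4 * L ^ 2 := by
          rw [show 4 * (L:ℂ) ^ 2 = ((4 * L ^ 2 : ℝ) : ℂ) by push_cast; ring, Complex.norm_real,
            Real.norm_of_nonneg (by positivity)]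
        rw [this]
        refine mul_le_mul_of_nonneg_left ((norm_sub_le _ _).trans ?_) (by positivity)
        have hs1' : ‖s + 1‖ ≤ S := by
          have := norm_add_le s 1
          simp at this
          rw [hS]; linarith
        have hs0' : ‖s‖ ≤ S := by rw [hS]; linarith
        have hab : ‖(4 * a * b : ℂ)‖ = 4 * a * b := by
          rw [show (4 * a * b : ℂ) = ((4 * a * b : ℝ) : ℂ) by push_cast; ring, Complex.norm_real,
            Real.norm_of_nonneg (by positivity)]
        simp only [norm_mul, norm_pow] at hab ⊢
        rw [hab]
        have : 4 * a * b * ‖s‖ * ‖s + 1‖ ≤ 4 * a * b * S ^ 2 := by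
          rw [mul_assoc, pow_two]; gcongr
        gcongr
      rw [hl] at hn
      have hpi : 1 ≤ Real.pi ^ 2 := by nlinarith [Real.pi_gt_three]
      have hx : 0 ≤ (m:ℝ)^2 * ‖pJ a b L s m‖ := by positivity
      nlinarith
    have e5 : (m:ℝ) ^ 2 * ‖pJ a b L s m‖ * M ≤ L ^ 2 * (C1 + 4 * a * b * (C2 * 9 ^ j)) * (S ^ 2 * S ^ (2 * j)) := by
      calc _ ≤ L ^ 2 * (S ^ 2 * ‖pJ a b L s m‖ + 4 * a * b * S ^ 2 * ‖pJ a b L (s + 2) m‖) * M := by gcongr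
        _ = L ^ 2 * S ^ 2 * ((‖pJ a b L s m‖ * M) + 4 * a * b * (‖pJ a b L (s + 2) m‖ * M)) := by ring
        _ ≤ L ^ 2 * S ^ 2 * (C1 * S ^ (2 * j) + 4 * a * b * (C2 * 9 ^ j * S ^ (2 * j))) := by gcongr
        _ = _ := by ring
    have e6 : ‖pJ a b L s m‖ * M ≤ C1 * (S ^ 2 * S ^ (2 * j)) := by
      refine e1.trans ?_
      have : 1 ≤ S ^ 2 := one_le_pow₀ hS1
      have h3 : 0 < S ^ (2 * j) := by positivity
      exact mul_le_mul_of_nonneg_left (by nlinarith) hC1.le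
    have e7 : (1 + |(m:ℝ)|) ^ 2 ≤ 2 * (1 + (m:ℝ) ^ 2) := by
      nlinarith [sq_abs (m:ℝ), sq_nonneg (1 - |(m:ℝ)|)]
    calc ‖pJ a b L s m‖ * (1 + |(m:ℝ)|) ^ (2 * (j + 1)) = ‖pJ a b L s m‖ * M * (1 + |(m:ℝ)|) ^ 2 := by
          rw [hM]; ring
      _ ≤ ‖pJ a b L s m‖ * M * (2 * (1 + (m:ℝ) ^ 2)) := by gcongr
      _ = 2 * (‖pJ a b L s m‖ * M + (m:ℝ) ^ 2 * ‖pJ a b L s m‖ * M) := by ring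
      _ ≤ 2 * (C1 * (S ^ 2 * S ^ (2 * j)) + L ^ 2 * (C1 + 4 * a * b * (C2 * 9 ^ j)) * (S ^ 2 * S ^ (2 * j))) := by gcongr
      _ = _ := by ring

end PB

section PC
open Complex MeasureTheory Set Filter Topology FourierTransform

/-- `Q^{-s}` -/
noncomputable def pe (Q : ℝ) (s : ℂ) : ℂ := cexp (-s * (Real.log Q : ℝ))

/-- `e(mθ)` -/
noncomputable def pch (m : ℤ) (θ : ℝ) : ℂ := cexp (2 * Real.pi * I * m * θ)

theorem pch_norm (m : ℤ) (θ : ℝ) : ‖pch m θ‖ = 1 := by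
  unfold pch
  rw [show (2 * Real.pi * I * m * θ : ℂ) = ((2 * Real.pi * m * θ : ℝ) : ℂ) * I by push_cast; ring]
  exact Complex.norm_exp_ofReal_mul_I _

theorem pe_norm (Q : ℝ) (s : ℂ) : ‖pe Q s‖ = Real.exp (-s.re * Real.log Q) := by
  unfold pe
  rw [Complex.norm_exp]; simp

theorem pe_mul {P Q : ℝ} (hP : 0 < P) (hQ : 0 < Q) (s : ℂ) : pe (P * Q) s = pe P s * pe Q s := by
  unfold pe
  rw [Real.log_mul hP.ne' hQ.ne', ← Complex.exp_add]
  congr 1; push_cast; ring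

theorem pe_cpow {P : ℝ} (hP : 0 < P) (s : ℂ) : (P : ℂ) ^ (-s) = pe P s := by
  unfold pe
  rw [Complex.cpow_def_of_ne_zero (by exact_mod_cast hP.ne'), ← Complex.ofReal_log hP.le]
  congr 1; ring

theorem pphi_eq_pe (a b L : ℝ) (s : ℂ) (y : ℝ) : pphi a b L s y = pe (pw a b L y) s := rfl

variable {a b L : ℝ}

/-- Fourier coefficient of `H(x, ·)` -/
noncomputable def ph (a b L x : ℝ) (m : ℤ) : ℂ :=
  2 * 𝓕 (fun y : ℝ => ((Real.exp (-(Real.pi * x * pw a b L y)) : ℝ) : ℂ)) (m : ℝ)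

noncomputable def pH (a b L x θ : ℝ) : ℝ :=
  2 * ∑' n : ℤ, Real.exp (-(Real.pi * x * pw a b L (θ + n)))

theorem pJ_line_meas (ha : 0 < a) (hb : 0 < b) (σ : ℝ) (m : ℤ) :
    AEStronglyMeasurable (fun t : ℝ => pJ a b L (σ + t * I) m) := by
  unfold pJ
  simp only [Real.fourier_real_eq_integral_exp_smul]
  have hc : Continuous fun p : ℝ × ℝ => cexp (((-2 * Real.pi * p.2 * (m:ℝ) : ℝ) : ℂ) * I) • pphi a b L (σ + p.1 * I) p.2 := by
    unfold pphi
    have : Continuous fun y => Real.log (pw a b L y) := pw_cont.log fun y => (pw_pos ha hb y).ne'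
    have h2 : Continuous fun p : ℝ × ℝ => Real.log (pw a b L p.2) := this.comp continuous_snd
    fun_prop
  exact (hc.stronglyMeasurable.integral_prod_right (ν := volume)).aestronglyMeasurable

theorem ph_eq (ha : 0 < a) (hb : 0 < b) (hL : 0 < L) {σ x : ℝ} (hσ : 0 < σ) (hx : 0 < x) (m : ℤ) :
    ph a b L x m = (1 / Real.pi : ℂ) * ∫ t : ℝ, Gamma (σ + t * I) * pe (Real.pi * x) (σ + t * I) * pJ a b L (σ + t * I) m := by
  have hpx : 0 < Real.pi * x := by positivity
  have key : ∀ y : ℝ, ((Real.exp (-(Real.pi * x * pw a b L y)) : ℝ) : ℂ) = (1 / (2 * Real.pi) : ℂ) *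
      ∫ t : ℝ, Gamma (σ + t * I) * pe (Real.pi * x) (σ + t * I) * pphi a b L (σ + t * I) y := by
    intro y
    rw [pa_inversion hσ (mul_pos hpx (pw_pos ha hb y))]
    congr 1
    congr 1
    ext t
    rw [pe_cpow (mul_pos hpx (pw_pos ha hb y)), pe_mul hpx (pw_pos ha hb y), pphi_eq_pe]
    ring
  unfold ph
  rw [Real.fourier_real_eq_integral_exp_smul]
  have hA : ∀ y : ℝ, cexp (((-2 * Real.pi * y * (m:ℝ) : ℝ) : ℂ) * I) • ((Real.exp (-(Real.pi * x * pw a b L y)) : ℝ) : ℂ)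
      = (1 / (2 * Real.pi) : ℂ) * ∫ t : ℝ, Gamma (σ + t * I) * pe (Real.pi * x) (σ + t * I) * (cexp (((-2 * Real.pi * y * (m:ℝ) : ℝ) : ℂ) * I) • pphi a b L (σ + t * I) y) := by
    intro y
    rw [key y, smul_eq_mul, mul_left_comm, ← integral_const_mul]
    congr 1
    congr 1
    ext t
    simp only [smul_eq_mul]; ring
  simp_rw [hA]
  rw [integral_const_mul]
  rw [integral_integral_swap]
  · rw [← mul_assoc]
    congr 1
    · field_simp
    · congr 1
      ext t
      rw [integral_const_mul]
      congr 1
      unfold pJ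
      rw [Real.fourier_real_eq_integral_exp_smul]
  · have hg := pa_Gamma_integrable hσ
    have hs0 : 0 < ((σ:ℂ)).re := by simpa using hσ
    have hp := pphi_integrable ha hb hL hs0
    have h1 := (hp.norm.mul_prod hg.norm).const_mul (Real.exp (-σ * Real.log (Real.pi * x)))
    refine h1.mono' ?_ (Eventually.of_forall fun p => ?_)
    · have hc : Continuous fun y => Real.log (pw a b L y) := pw_cont.log fun y => (pw_pos ha hb y).ne'
      have h2 : Continuous fun p : ℝ × ℝ => Real.log (pw a b L p.1) := hc.comp continuous_fst
      have h3 : Continuous fun p : ℝ × ℝ => Gamma (σ + p.2 * I) := (pa_continuous_Gamma_line hσ).comp continuous_snd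
      refine Continuous.aestronglyMeasurable ?_
      simp only [Function.uncurry_def]
      unfold pe pphi
      fun_prop
    · simp only [Function.uncurry_def, norm_mul, pe_norm, norm_smul, Complex.norm_exp_ofReal_mul_I, pphi_norm]
      simp
      apply le_of_eq; ring

/-- the kernel -/
noncomputable def pk (a b L N : ℝ) (m : ℤ) (s : ℂ) : ℂ :=
  (1 / Real.pi : ℂ) * (Gamma s * pe (Real.pi / N) s * pJ a b L s m)

theorem pk_meas (ha : 0 < a) (hb : 0 < b) {σ : ℝ} (hσ : 0 < σ) (N : ℝ) (m : ℤ) :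
    AEStronglyMeasurable (fun t : ℝ => pk a b L N m (σ + t * I)) := by
  unfold pk
  refine AEStronglyMeasurable.const_mul ?_ _
  refine AEStronglyMeasurable.mul ?_ (pJ_line_meas ha hb σ m)
  refine AEStronglyMeasurable.mul (pa_continuous_Gamma_line hσ).aestronglyMeasurable ?_
  refine Continuous.aestronglyMeasurable ?_
  unfold pe
  fun_prop

theorem pk_bound (ha : 0 < a) (hb : 0 < b) (hL : 0 < L) (B : ℕ) (σ0 X : ℝ) (h0 : 0 < σ0) :
    ∃ C, 0 < C ∧ ∀ σ : ℝ, σ0 ≤ σ → σ ≤ X → ∀ N : ℝ, ∀ (m : ℤ) (t : ℝ),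
      ‖pk a b L N m (σ + t * I)‖ * (1 + |t| + |(m:ℝ)|) ^ B ≤
        C * Real.exp (-σ * Real.log (Real.pi / N)) * ((1 + |(m:ℝ)|) ^ 2)⁻¹ * (1 + t ^ 2)⁻¹ := by
  obtain ⟨C1, hC1, h1⟩ := pJ_bound ha hb hL (B + 2) σ0 X h0
  obtain ⟨C2, hC2, h2⟩ := pa_Gamma_decay (2 * (B + 2) + B + 2) σ0 X h0
  refine ⟨C1 * C2, by positivity, fun σ hs1 hs2 N m t => ?_⟩
  have e1 := h1 (σ + t * I) (by simpa using hs1) (by simpa using hs2) m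
  have e2 := h2 (σ + t * I) (by simpa using hs1) (by simpa using hs2)
  unfold pk
  simp only [norm_mul, pe_norm]
  have hre : ((σ:ℂ) + t * I).re = σ := by simp
  rw [hre]
  have ht : |t| ≤ ‖(σ:ℂ) + t * I‖ := by
    have := Complex.abs_im_le_norm (σ + t * I)
    simpa using this
  set S := ‖(σ:ℂ) + t * I‖ with hS
  set Γ' := ‖Gamma (σ + t * I)‖
  set J' := ‖pJ a b L (σ + t * I) m‖
  set μ := |(m:ℝ)| with hμ
  have hμ0 : 0 ≤ μ := abs_nonneg _
  have hS0 : 0 ≤ S := norm_nonneg _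
  have hpi : ‖(1 / Real.pi : ℂ)‖ ≤ 1 := by
    rw [norm_div, norm_one, Complex.norm_real, Real.norm_of_nonneg Real.pi_pos.le, div_le_one Real.pi_pos]
    linarith [Real.pi_gt_three]
  have f1 : (1 + |t| + μ) ^ B ≤ (1 + S) ^ B * (1 + μ) ^ B := by
    rw [← mul_pow]
    gcongr
    nlinarith
  have f2 : (1 + μ) ^ B * (1 + μ) ^ 2 ≤ (1 + μ) ^ (2 * (B + 2)) := by
    rw [← pow_add]
    exact pow_le_pow_right₀ (by linarith) (by omega)
  have f3 : 1 + t ^ 2 ≤ (1 + S) ^ 2 := by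
    have : t ^ 2 = |t| ^ 2 := (sq_abs t).symm
    nlinarith [abs_nonneg t]
  rw [mul_assoc (_ * _), ← mul_inv, ← div_eq_mul_inv, le_div_iff₀ (by positivity)]
  set ex := Real.exp (-σ * Real.log (Real.pi / N))
  have hex : 0 < ex := Real.exp_pos _
  calc ‖(1 / Real.pi : ℂ)‖ * (Γ' * ex * J') * (1 + |t| + μ) ^ B * ((1 + μ) ^ 2 * (1 + t ^ 2))
      ≤ 1 * (Γ' * ex * J') * ((1 + S) ^ B * (1 + μ) ^ B) * ((1 + μ) ^ 2 * (1 + S) ^ 2) := by gcongr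
    _ = ex * Γ' * (1 + S) ^ B * (1 + S) ^ 2 * (J' * ((1 + μ) ^ B * (1 + μ) ^ 2)) := by ring
    _ ≤ ex * Γ' * (1 + S) ^ B * (1 + S) ^ 2 * (J' * (1 + μ) ^ (2 * (B + 2))) := by gcongr
    _ ≤ ex * Γ' * (1 + S) ^ B * (1 + S) ^ 2 * (C1 * (1 + S) ^ (2 * (B + 2))) := by gcongr
    _ = C1 * ex * (Γ' * (1 + S) ^ (2 * (B + 2) + B + 2)) := by ring
    _ ≤ C1 * ex * C2 := by gcongr
    _ = C1 * C2 * ex := by ring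

theorem pk_norm_bound (ha : 0 < a) (hb : 0 < b) (hL : 0 < L) (σ0 X : ℝ) (h0 : 0 < σ0) :
    ∃ C, 0 < C ∧ ∀ σ : ℝ, σ0 ≤ σ → σ ≤ X → ∀ N : ℝ, ∀ (m : ℤ) (t : ℝ),
      ‖pk a b L N m (σ + t * I)‖ ≤
        C * Real.exp (-σ * Real.log (Real.pi / N)) * ((1 + |(m:ℝ)|) ^ 2)⁻¹ * (1 + t ^ 2)⁻¹ := by
  obtain ⟨C, hC, h⟩ := pk_bound ha hb hL 0 σ0 X h0
  exact ⟨C, hC, fun σ h1 h2 N m t => by simpa using h σ h1 h2 N m t⟩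

theorem pk_integrable (ha : 0 < a) (hb : 0 < b) (hL : 0 < L) {σ : ℝ} (hσ : 0 < σ) (N : ℝ) (m : ℤ) :
    Integrable (fun t : ℝ => pk a b L N m (σ + t * I)) := by
  obtain ⟨C, hC, h⟩ := pk_norm_bound ha hb hL σ σ hσ
  exact (integrable_inv_one_add_sq.const_mul _).mono' (pk_meas ha hb hσ N m)
    (Eventually.of_forall fun t => h σ le_rfl le_rfl N m t)

theorem ph_eq_pk (ha : 0 < a) (hb : 0 < b) (hL : 0 < L) {σ Q N : ℝ} (hσ : 0 < σ) (hQ : 0 < Q) (hN : 0 < N) (m : ℤ) :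
    ph a b L (Q / N) m = ∫ t : ℝ, pk a b L N m (σ + t * I) * pe Q (σ + t * I) := by
  rw [ph_eq ha hb hL hσ (by positivity), ← integral_const_mul]
  congr 1
  ext t
  rw [show Real.pi * (Q / N) = Real.pi / N * Q by ring, pe_mul (by positivity) hQ]
  unfold pk
  ring

theorem ph_bound (ha : 0 < a) (hb : 0 < b) (hL : 0 < L) (σ0 X : ℝ) (h0 : 0 < σ0) :
    ∃ C, 0 < C ∧ ∀ σ : ℝ, σ0 ≤ σ → σ ≤ X → ∀ Q N : ℝ, 0 < Q → 0 < N → ∀ m : ℤ,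
      ‖ph a b L (Q / N) m‖ ≤ C * Real.exp (-σ * Real.log (Real.pi / N)) * Real.exp (-σ * Real.log Q) * ((1 + |(m:ℝ)|) ^ 2)⁻¹ := by
  obtain ⟨C, hC, h⟩ := pk_norm_bound ha hb hL σ0 X h0
  refine ⟨C * Real.pi, by positivity, fun σ h1 h2 Q N hQ hN m => ?_⟩
  rw [ph_eq_pk ha hb hL (by linarith : 0 < σ) hQ hN]
  refine (norm_integral_le_of_norm_le (g := fun t => C * Real.exp (-σ * Real.log (Real.pi / N)) * Real.exp (-σ * Real.log Q) * ((1 + |(m:ℝ)|) ^ 2)⁻¹ * (1 + t ^ 2)⁻¹) (integrable_inv_one_add_sq.const_mul _) (Eventually.of_forall fun t => ?_)).trans ?_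
  · rw [norm_mul, pe_norm]
    have := h σ h1 h2 N m t
    simp only [add_re, ofReal_re, mul_re, I_re, mul_zero, ofReal_im, I_im, mul_one, sub_self, add_zero]
    calc _ ≤ C * Real.exp (-σ * Real.log (Real.pi / N)) * ((1 + |(m:ℝ)|) ^ 2)⁻¹ * (1 + t ^ 2)⁻¹ * Real.exp (-σ * Real.log Q) := by gcongr
      _ = _ := by ring
  · rw [integral_const_mul, integral_univ_inv_one_add_sq]
    apply le_of_eq; ring

theorem pm_summable : Summable fun m : ℤ => ((1 + |(m:ℝ)|) ^ 2)⁻¹ := by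
  have h := Real.summable_abs_int_rpow (b := 2) (by norm_num)
  refine Summable.of_norm_bounded_eventually h ?_
  have : ∀ᶠ m : ℤ in cofinite, m ≠ 0 := by
    rw [Filter.eventually_cofinite]; simp
  filter_upwards [this] with m hm
  have hm' : 0 < |(m:ℝ)| := by positivity
  rw [Real.norm_of_nonneg (by positivity), Real.rpow_neg (abs_nonneg _), Real.rpow_two]
  gcongr
  linarith

theorem pexp_le {σ u : ℝ} (h0 : 0 ≤ σ) (h1 : σ ≤ 1) (hu : 0 < u) : Real.exp (-u) ≤ Real.exp (-σ * Real.log u) := by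
  apply Real.exp_le_exp.mpr
  have h := Real.log_le_sub_one_of_pos hu
  rcases le_total 0 (Real.log u) with h2 | h2 <;> nlinarith

theorem pexp_pw_le (ha : 0 < a) (hb : 0 < b) {σ x : ℝ} (h0 : 0 ≤ σ) (h1 : σ ≤ 1) (hx : 0 < x) (y : ℝ) :
    Real.exp (-(Real.pi * x * pw a b L y)) ≤ Real.exp (-σ * Real.log (Real.pi * x)) * ‖pphi a b L σ y‖ := by
  have hw := pw_pos (L := L) ha hb y
  refine (pexp_le h0 h1 (by positivity)).trans (le_of_eq ?_)
  rw [pphi_norm, ← Real.exp_add, Real.log_mul (by positivity) hw.ne']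
  congr 1
  simp; ring

theorem psh_bound {θ : ℝ} (h0 : 0 ≤ θ) (h1 : θ < 1) (n : ℤ) : (1 + (θ + n) ^ 2)⁻¹ ≤ 8 * ((1 + |(n:ℝ)|) ^ 2)⁻¹ := by
  rw [← div_eq_mul_inv, inv_le_comm₀ (by positivity) (by positivity), inv_div, div_le_iff₀ (by norm_num)]
  have h2 : |(n:ℝ)| ≤ 1 + |θ + n| := by
    have := abs_sub (θ + n) θ
    rw [abs_of_nonneg h0] at this
    simp at this
    linarith
  have := sq_abs (θ + n)
  nlinarith [abs_nonneg (n:ℝ), abs_nonneg (θ + n), sq_nonneg (|θ + n| - 2)]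

theorem pH_aux (ha : 0 < a) (hb : 0 < b) (hL : 0 < L) {σ : ℝ} (h0 : 0 < σ) (h1 : σ ≤ 1) :
    ∃ C, 0 < C ∧ ∀ x, 0 < x → ∀ θ : ℝ, (Summable fun n : ℤ => Real.exp (-(Real.pi * x * pw a b L (θ + n)))) ∧
      pH a b L x θ ≤ C * Real.exp (-σ * Real.log (Real.pi * x)) := by
  obtain ⟨C, hC, h⟩ := pphi_bound ha hb hL σ σ h0
  have hS : 0 ≤ ∑' m : ℤ, ((1 + |(m:ℝ)|) ^ 2)⁻¹ := tsum_nonneg fun m => by positivity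
  refine ⟨2 * (C * 8 * (1 + ∑' m : ℤ, ((1 + |(m:ℝ)|) ^ 2)⁻¹)), by positivity, fun x hx θ => ?_⟩
  have hb1 : ∀ n : ℤ, Real.exp (-(Real.pi * x * pw a b L (Int.fract θ + n))) ≤
      Real.exp (-σ * Real.log (Real.pi * x)) * (C * 8) * ((1 + |(n:ℝ)|) ^ 2)⁻¹ := by
    intro n
    refine (pexp_pw_le ha hb h0.le h1 hx _).trans ?_
    rw [mul_assoc, mul_assoc]
    refine mul_le_mul_of_nonneg_left ?_ (Real.exp_pos _).le
    refine (h σ (by simp) (by simp) _).trans ?_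
    exact mul_le_mul_of_nonneg_left (psh_bound (Int.fract_nonneg θ) (Int.fract_lt_one θ) n) hC.le
  have hsum : Summable fun n : ℤ => Real.exp (-(Real.pi * x * pw a b L (Int.fract θ + n))) :=
    Summable.of_nonneg_of_le (fun n => (Real.exp_pos _).le) hb1 (pm_summable.mul_left _)
  have hshift : (fun n : ℤ => Real.exp (-(Real.pi * x * pw a b L (θ + n)))) =
      (fun n : ℤ => Real.exp (-(Real.pi * x * pw a b L (Int.fract θ + n)))) ∘ (Equiv.addRight ⌊θ⌋) := by
    ext n
    simp only [Function.comp, Equiv.coe_addRight]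
    congr 4
    push_cast
    linarith [Int.fract_add_floor θ]
  constructor
  · rw [hshift]
    exact (Equiv.summable_iff _).2 hsum
  · unfold pH
    have : ∑' n : ℤ, Real.exp (-(Real.pi * x * pw a b L (θ + n))) = ∑' n : ℤ, Real.exp (-(Real.pi * x * pw a b L (Int.fract θ + n))) := by
      rw [hshift]
      exact Equiv.tsum_eq (Equiv.addRight ⌊θ⌋) (fun n : ℤ => Real.exp (-(Real.pi * x * pw a b L (Int.fract θ + n))))
    rw [this]
    have h3 := Summable.tsum_le_tsum hb1 hsum (pm_summable.mul_left _)
    rw [tsum_mul_left] at h3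
    have he := Real.exp_pos (-σ * Real.log (Real.pi * x))
    nlinarith [mul_pos he hC]

theorem pH_summable (ha : 0 < a) (hb : 0 < b) (hL : 0 < L) {x : ℝ} (hx : 0 < x) (θ : ℝ) :
    Summable fun n : ℤ => Real.exp (-(Real.pi * x * pw a b L (θ + n))) := by
  obtain ⟨C, hC, h⟩ := pH_aux ha hb hL one_pos le_rfl
  exact (h x hx θ).1

theorem pH_nonneg (x θ : ℝ) : 0 ≤ pH a b L x θ := by
  unfold pH
  exact mul_nonneg zero_le_two (tsum_nonneg fun n => (Real.exp_pos _).le)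

theorem pH_poisson (ha : 0 < a) (hb : 0 < b) (hL : 0 < L) {x : ℝ} (hx : 0 < x) (θ : ℝ) :
    HasSum (fun m : ℤ => ph a b L x m * pch m θ) (pH a b L x θ : ℂ) := by
  have hs : Summable fun m : ℤ => ph a b L x m := by
    obtain ⟨C, hC, h⟩ := ph_bound ha hb hL 1 1 one_pos
    refine Summable.of_norm_bounded (pm_summable.mul_left (C * Real.exp (-1 * Real.log (Real.pi / 1)) * Real.exp (-1 * Real.log x))) fun m => ?_
    have := h 1 le_rfl le_rfl x 1 hx one_pos m
    simpa using this
  have hs2 : Summable fun m : ℤ => ph a b L x m * pch m θ := by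
    refine Summable.of_norm ?_
    simp only [norm_mul, pch_norm, mul_one]
    exact hs.norm
  have hs3 : Summable fun m : ℤ => (𝓕 (fun y : ℝ => ((Real.exp (-(Real.pi * x * pw a b L y)) : ℝ) : ℂ)) : ℝ → ℂ) (m : ℝ) := by
    have := hs.mul_left (1/2)
    refine this.congr fun m => ?_
    unfold ph; ring
  have hP := Real.tsum_eq_tsum_fourier_of_rpow_decay_of_summable (f := fun y : ℝ => ((Real.exp (-(Real.pi * x * pw a b L y)) : ℝ) : ℂ))
    (by have := pw_cont (a := a) (b := b) (L := L); fun_prop) (b := 2) (by norm_num) ?_ hs3 θ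
  · convert hs2.hasSum using 1
    unfold pH
    push_cast
    push_cast at hP
    rw [hP, ← tsum_mul_left]
    refine tsum_congr fun m => ?_
    rw [fourier_coe_apply]
    unfold ph pch
    push_cast
    simp only [div_one]
    ring
  · obtain ⟨C, hC, h⟩ := pphi_bound ha hb hL 1 1 one_pos
    refine Asymptotics.IsBigO.of_bound (Real.exp (-1 * Real.log (Real.pi * x)) * C) ?_
    have : ∀ᶠ y : ℝ in cocompact ℝ, y ≠ 0 := by
      have := (isCompact_singleton (x := (0:ℝ))).compl_mem_cocompact
      exact this
    filter_upwards [this] with y hy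
    rw [Complex.norm_real, Real.norm_of_nonneg (Real.exp_pos _).le, mul_assoc (Real.exp _)]
    refine (pexp_pw_le ha hb zero_le_one le_rfl hx y).trans ?_
    refine mul_le_mul_of_nonneg_left ((h _ (by simp) (by simp) y).trans ?_) (Real.exp_pos _).le
    refine mul_le_mul_of_nonneg_left ?_ hC.le
    have hy' : 0 < |y| := by positivity
    rw [Real.norm_of_nonneg (by positivity), Real.rpow_neg (abs_nonneg _), Real.rpow_two, sq_abs]
    have : 0 < y ^ 2 := by positivity
    gcongr
    linarith

end PC

section PC2
open Complex MeasureTheory Set Filter Topology FourierTransform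
variable {a b L : ℝ}

theorem pc_fub (ha : 0 < a) (hb : 0 < b) (hL : 0 < L) {σ N : ℝ} (hσ : 0 < σ) (hN : 0 < N) (m : ℤ)
    {X : Type*} [MeasurableSpace X] (μ : Measure X) [SFinite μ] (c : X → ℂ) (Q : X → ℝ)
    (hQm : Measurable Q) (hQ : ∀ᵐ i ∂μ, 0 < Q i) (hc : AEStronglyMeasurable c μ)
    (hi : Integrable (fun i => c i * pe (Q i) σ) μ) :
    (Integrable fun t : ℝ => pk a b L N m (σ + t * I) * ∫ i, c i * pe (Q i) (σ + t * I) ∂μ) ∧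
    ∫ i, c i * ph a b L (Q i / N) m ∂μ = ∫ t : ℝ, pk a b L N m (σ + t * I) * ∫ i, c i * pe (Q i) (σ + t * I) ∂μ := by
  have h1 : ∫ i, c i * ph a b L (Q i / N) m ∂μ = ∫ i, (∫ t : ℝ, (c i * pe (Q i) (σ + t * I)) * pk a b L N m (σ + t * I)) ∂μ := by
    refine integral_congr_ae ?_
    filter_upwards [hQ] with i hi'
    rw [ph_eq_pk ha hb hL hσ hi' hN, ← integral_const_mul]
    congr 1; ext t; ring
  have hI : Integrable (Function.uncurry fun (i : X) (t : ℝ) => (c i * pe (Q i) (σ + t * I)) * pk a b L N m (σ + t * I)) (μ.prod volume) := by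
    have hk := pk_integrable ha hb hL hσ N m
    have h2 := hi.norm.mul_prod hk.norm
    refine h2.mono' ?_ (Eventually.of_forall fun p => ?_)
    · simp only [Function.uncurry_def]
      refine AEStronglyMeasurable.mul (AEStronglyMeasurable.mul (hc.comp_fst) ?_) (hk.aestronglyMeasurable.comp_snd)
      refine Measurable.aestronglyMeasurable ?_
      unfold pe
      have hl : Measurable fun p : X × ℝ => Real.log (Q p.1) := Real.measurable_log.comp (hQm.comp measurable_fst)
      fun_prop
    · simp only [Function.uncurry_def, norm_mul, pe_norm]
      simp
  have h3 : ∀ t : ℝ, pk a b L N m (σ + t * I) * ∫ i, c i * pe (Q i) (σ + t * I) ∂μ = ∫ i, (c i * pe (Q i) (σ + t * I)) * pk a b L N m (σ + t * I) ∂μ := by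
    intro t
    rw [integral_mul_const, mul_comm]
  simp_rw [h3]
  refine ⟨?_, ?_⟩
  · exact hI.integral_prod_right
  · rw [h1, integral_integral_swap hI]

theorem pc_fub_sum (ha : 0 < a) (hb : 0 < b) (hL : 0 < L) {σ N : ℝ} (hσ : 0 < σ) (hN : 0 < N) (m : ℤ)
    {ι : Type*} [Countable ι] (c : ι → ℂ) (Q : ι → ℝ) (hQ : ∀ i, 0 < Q i)
    (hi : Summable fun i => ‖c i‖ * Real.exp (-σ * Real.log (Q i))) :
    (Integrable fun t : ℝ => pk a b L N m (σ + t * I) * ∑' i, c i * pe (Q i) (σ + t * I)) ∧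
    ∑' i, c i * ph a b L (Q i / N) m = ∫ t : ℝ, pk a b L N m (σ + t * I) * ∑' i, c i * pe (Q i) (σ + t * I) := by
  let _ : MeasurableSpace ι := ⊤
  have _ : MeasurableSingletonClass ι := ⟨fun _ => trivial⟩
  have hs : ∀ t : ℝ, Summable fun i => ‖c i * pe (Q i) (σ + t * I)‖ := by
    intro t
    simp only [norm_mul, pe_norm]
    simpa using hi
  have hinteg : ∀ t : ℝ, Integrable (fun i => c i * pe (Q i) (σ + t * I)) Measure.count := fun t =>
    integrable_count_iff.2 (hs t)
  have hcount : ∀ f : ι → ℂ, Integrable f Measure.count → ∫ i, f i ∂Measure.count = ∑' i, f i := by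
    intro f hf
    rw [integral_countable hf]
    simp [Measure.real]
  have h := pc_fub ha hb hL hσ hN m (Measure.count : Measure ι) c Q (measurable_of_countable _) (Eventually.of_forall hQ)
    (measurable_of_countable c).aestronglyMeasurable (by simpa using hinteg 0)
  have e : ∀ t : ℝ, ∫ i, c i * pe (Q i) (σ + t * I) ∂Measure.count = ∑' i, c i * pe (Q i) (σ + t * I) := fun t => hcount _ (hinteg t)
  simp_rw [e] at h
  refine ⟨h.1, ?_⟩
  rw [← h.2, hcount]
  obtain ⟨C, hC, hb'⟩ := ph_bound ha hb hL σ σ hσ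
  refine integrable_count_iff.2 ?_
  refine Summable.of_norm_bounded (hi.mul_left (C * Real.exp (-σ * Real.log (Real.pi / N)) * ((1 + |(m:ℝ)|) ^ 2)⁻¹)) fun i => ?_
  rw [norm_norm, norm_mul]
  have := hb' σ le_rfl le_rfl (Q i) N (hQ i) hN m
  calc _ ≤ ‖c i‖ * _ := mul_le_mul_of_nonneg_left this (norm_nonneg _)
    _ = _ := by ring

theorem pc_main (ha : 0 < a) (hb : 0 < b) (hL : 0 < L) (B : ℕ) (σ0 X : ℝ) (h0 : 0 < σ0) :
    ∃ A, 0 < A ∧ ∀ (ι : Type) [Countable ι] (c Q θ : ι → ℝ) (_ : ∀ i, 0 < Q i) (_ : ∀ i, 0 ≤ c i)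
      (σ N K : ℝ) (_ : σ0 ≤ σ) (_ : σ ≤ X) (_ : 0 < N) (_ : 0 ≤ K) (E0 : ℝ → ℂ)
      (_ : Summable fun i => c i * Real.exp (-σ * Real.log (Q i)))
      (_ : Integrable fun t : ℝ => pk a b L N 0 (σ + t * I) * E0 t)
      (_ : ∀ (m : ℤ) (t : ℝ), ‖(∑' i, (c i * pch m (θ i)) * pe (Q i) (σ + t * I)) - (if m = 0 then E0 t else 0)‖ ≤ K * (1 + |t| + |(m:ℝ)|) ^ B),
      Summable (fun i => c i * pH a b L (Q i / N) (θ i)) ∧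
      ‖((∑' i, c i * pH a b L (Q i / N) (θ i) : ℝ) : ℂ) - ∫ t : ℝ, pk a b L N 0 (σ + t * I) * E0 t‖ ≤ A * K * Real.exp (-σ * Real.log (Real.pi / N)) := by
  obtain ⟨C, hC, hk⟩ := pk_bound ha hb hL B σ0 X h0
  obtain ⟨C', hC', hp⟩ := ph_bound ha hb hL σ0 X h0
  have hS : 0 ≤ ∑' m : ℤ, ((1 + |(m:ℝ)|) ^ 2)⁻¹ := tsum_nonneg fun m => by positivity
  refine ⟨C * Real.pi * (1 + ∑' m : ℤ, ((1 + |(m:ℝ)|) ^ 2)⁻¹), by positivity, ?_⟩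
  intro ι _ c Q θ hQ hc σ N K hσ0 hσX hN hK E0 hsum hE0 hbd
  have hσ : 0 < σ := by linarith
  set ex := Real.exp (-σ * Real.log (Real.pi / N)) with hex
  have hexp : 0 < ex := Real.exp_pos _
  let f : ι → ℤ → ℂ := fun i m => (c i * pch m (θ i)) * ph a b L (Q i / N) m
  have hf : Summable (Function.uncurry f) := by
    have hg := (hsum.mul_left (C' * ex)).mul_of_nonneg pm_summable (fun i => by have := hc i; positivity) (fun m => by positivity)
    refine Summable.of_norm_bounded hg fun p => ?_
    simp only [Function.uncurry_def, f, norm_mul, pch_norm, Complex.norm_real, mul_one]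
    rw [Real.norm_of_nonneg (hc _)]
    have := hp σ hσ0 hσX (Q p.1) N (hQ _) hN p.2
    calc _ ≤ c p.1 * _ := mul_le_mul_of_nonneg_left this (hc _)
      _ = _ := by ring
  have hrow : ∀ i, HasSum (f i) ((c i * pH a b L (Q i / N) (θ i) : ℝ) : ℂ) := by
    intro i
    have := (pH_poisson ha hb hL (div_pos (hQ i) hN) (θ i)).mul_left (c i : ℂ)
    push_cast
    refine HasSum.congr_fun this ?_
    intro m
    simp only [f]; ring
  have hcol : ∀ m, ∑' i, f i m = ∫ t : ℝ, pk a b L N m (σ + t * I) * ∑' i, (c i * pch m (θ i)) * pe (Q i) (σ + t * I) := fun m =>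
    (pc_fub_sum ha hb hL hσ hN m (fun i => c i * pch m (θ i)) Q hQ
      (by simpa [pch_norm, abs_of_nonneg (hc _)] using hsum)).2
  have hinteg : ∀ m, Integrable fun t : ℝ => pk a b L N m (σ + t * I) * ∑' i, (c i * pch m (θ i)) * pe (Q i) (σ + t * I) := fun m =>
    (pc_fub_sum ha hb hL hσ hN m (fun i => c i * pch m (θ i)) Q hQ
      (by simpa [pch_norm, abs_of_nonneg (hc _)] using hsum)).1
  have hrs : Summable fun i => ((c i * pH a b L (Q i / N) (θ i) : ℝ) : ℂ) := by
    have := hf.prod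
    refine this.congr fun i => ?_
    exact (hrow i).tsum_eq
  refine ⟨Complex.summable_ofReal.1 hrs, ?_⟩
  set M0 := ∫ t : ℝ, pk a b L N 0 (σ + t * I) * E0 t with hM0
  have htot : ((∑' i, c i * pH a b L (Q i / N) (θ i) : ℝ) : ℂ) = ∑' m : ℤ, ∑' i, f i m := by
    rw [Complex.ofReal_tsum]
    rw [hf.tsum_comm]
    exact tsum_congr fun i => (hrow i).tsum_eq.symm
  have hcs : Summable fun m : ℤ => ∑' i, f i m := hf.prod_symm.prod
  have hone : HasSum (fun m : ℤ => if m = 0 then M0 else 0) M0 := hasSum_ite_eq 0 M0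
  have hsub := hcs.hasSum.sub hone
  rw [htot, ← hsub.tsum_eq]
  have hterm : ∀ m : ℤ, ‖(∑' i, f i m) - (if m = 0 then M0 else 0)‖ ≤ C * K * ex * Real.pi * ((1 + |(m:ℝ)|) ^ 2)⁻¹ := by
    intro m
    have e1 : (∑' i, f i m) - (if m = 0 then M0 else 0) = ∫ t : ℝ, pk a b L N m (σ + t * I) *
        ((∑' i, (c i * pch m (θ i)) * pe (Q i) (σ + t * I)) - (if m = 0 then E0 t else 0)) := by
      by_cases hm : m = 0
      · subst hm
        simp only [if_true]
        rw [hcol, hM0, ← integral_sub (hinteg 0) hE0]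
        congr 1; ext t; ring
      · simp only [hm, if_false, sub_zero]
        exact hcol m
    rw [e1]
    refine (norm_integral_le_of_norm_le (g := fun t => C * K * ex * ((1 + |(m:ℝ)|) ^ 2)⁻¹ * (1 + t ^ 2)⁻¹) (integrable_inv_one_add_sq.const_mul _) (Eventually.of_forall fun t => ?_)).trans ?_
    · rw [norm_mul]
      calc _ ≤ ‖pk a b L N m (σ + t * I)‖ * (K * (1 + |t| + |(m:ℝ)|) ^ B) := mul_le_mul_of_nonneg_left (hbd m t) (norm_nonneg _)
        _ = K * (‖pk a b L N m (σ + t * I)‖ * (1 + |t| + |(m:ℝ)|) ^ B) := by ring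
        _ ≤ K * (C * ex * ((1 + |(m:ℝ)|) ^ 2)⁻¹ * (1 + t ^ 2)⁻¹) := mul_le_mul_of_nonneg_left (hk σ hσ0 hσX N m t) hK
        _ = _ := by ring
    · rw [integral_const_mul, integral_univ_inv_one_add_sq]
      apply le_of_eq; ring
  refine (tsum_of_norm_bounded (pm_summable.mul_left (C * K * ex * Real.pi)).hasSum hterm).trans ?_
  rw [tsum_mul_left]
  have : 0 ≤ C * K * ex * Real.pi := by positivity
  nlinarith

end PC2

section PC3
open Complex MeasureTheory Set Filter Topology FourierTransform
variable {a b L : ℝ}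

theorem pc_exp_sub {l : ℝ} (hl : 0 < l) : Integrable (fun v : ℝ => Real.exp v * Real.exp (-(l * Real.exp v))) ∧
    ∫ v : ℝ, Real.exp v * Real.exp (-(l * Real.exp v)) = l⁻¹ := by
  have hd : ∀ x ∈ (univ : Set ℝ), HasDerivWithinAt Real.exp (Real.exp x) univ x := fun x _ => (Real.hasDerivAt_exp x).hasDerivWithinAt
  have hi : InjOn Real.exp univ := Real.exp_injective.injOn
  have himg : Real.exp '' univ = Ioi 0 := by rw [image_univ, Real.range_exp]
  have h1 := integrableOn_image_iff_integrableOn_abs_deriv_smul MeasurableSet.univ hd hi (fun x => Real.exp (-(l * x)))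
  have h2 := integral_image_eq_integral_abs_deriv_smul MeasurableSet.univ hd hi (fun x => Real.exp (-(l * x)))
  rw [himg] at h1 h2
  simp only [abs_of_pos (Real.exp_pos _), smul_eq_mul, integrableOn_univ, Measure.restrict_univ] at h1 h2
  have h3 : IntegrableOn (fun x => Real.exp (-(l * x))) (Ioi 0) := by
    simpa using exp_neg_integrableOn_Ioi 0 hl
  refine ⟨h1.1 h3, ?_⟩
  rw [← h2]
  have := integral_exp_mul_Ioi (a := -l) (by linarith) 0
  simpa using this

theorem ph_zero (x : ℝ) : ph a b L x 0 = ((2 * ∫ y, Real.exp (-(Real.pi * x * pw a b L y)) : ℝ) : ℂ) := by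
  unfold ph
  rw [Real.fourier_real_eq_integral_exp_smul]
  push_cast
  congr 1
  rw [← integral_complex_ofReal]
  congr 1; ext y; simp

theorem pw_inv_integrable (ha : 0 < a) (hb : 0 < b) (hL : 0 < L) : Integrable fun y => (pw a b L y)⁻¹ := by
  have := (pphi_integrable ha hb hL (s := 1) (by simp)).norm
  refine this.congr (Eventually.of_forall fun y => ?_)
  simp only [pphi_norm, one_re, neg_mul, one_mul, Real.exp_neg, Real.exp_log (pw_pos ha hb y)]

theorem pc_g_integral (ha : 0 < a) (hb : 0 < b) (hL : 0 < L) :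
    Integrable (fun v : ℝ => (Real.exp v : ℂ) * ph a b L (Real.exp v) 0) ∧
    ∫ v : ℝ, (Real.exp v : ℂ) * ph a b L (Real.exp v) 0 = ((2 / Real.pi * ∫ y, (pw a b L y)⁻¹ : ℝ) : ℂ) := by
  have hcont : Continuous (Function.uncurry fun (v y : ℝ) => Real.exp v * Real.exp (-(Real.pi * pw a b L y * Real.exp v))) := by
    have := pw_cont (a := a) (b := b) (L := L)
    simp only [Function.uncurry_def]
    fun_prop
  have hpos : ∀ y, 0 < Real.pi * pw a b L y := fun y => mul_pos Real.pi_pos (pw_pos ha hb y)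
  have hI : Integrable (Function.uncurry fun (v y : ℝ) => Real.exp v * Real.exp (-(Real.pi * pw a b L y * Real.exp v))) (volume.prod volume) := by
    rw [integrable_prod_iff' hcont.aestronglyMeasurable]
    refine ⟨Eventually.of_forall fun y => (pc_exp_sub (hpos y)).1, ?_⟩
    have e : ∀ y : ℝ, ∫ v : ℝ, ‖Real.exp v * Real.exp (-(Real.pi * pw a b L y * Real.exp v))‖ = Real.pi⁻¹ * (pw a b L y)⁻¹ := by
      intro y
      rw [← mul_inv, ← (pc_exp_sub (hpos y)).2]
      congr 1; ext v
      rw [Real.norm_of_nonneg (by positivity)]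
    simp only [Function.uncurry_def]
    simp_rw [e]
    exact (pw_inv_integrable ha hb hL).const_mul _
  have hg : ∀ v : ℝ, (Real.exp v : ℂ) * ph a b L (Real.exp v) 0 = ((2 * ∫ y, Real.exp v * Real.exp (-(Real.pi * pw a b L y * Real.exp v)) : ℝ) : ℂ) := by
    intro v
    rw [ph_zero, integral_const_mul]
    push_cast
    have : (∫ y, Real.exp (-(Real.pi * Real.exp v * pw a b L y))) = ∫ y, Real.exp (-(Real.pi * pw a b L y * Real.exp v)) := by
      congr 1; ext y; congr 2; ring
    rw [this]; ring
  simp_rw [hg]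
  constructor
  · exact (hI.integral_prod_left.const_mul 2).ofReal
  · rw [integral_complex_ofReal, integral_const_mul, integral_integral_swap hI]
    congr 1
    have e : ∀ y : ℝ, ∫ v : ℝ, Real.exp v * Real.exp (-(Real.pi * pw a b L y * Real.exp v)) = Real.pi⁻¹ * (pw a b L y)⁻¹ := by
      intro y
      rw [← mul_inv, ← (pc_exp_sub (hpos y)).2]
    simp_rw [e]
    rw [integral_const_mul]
    field_simp

theorem pc_g_bound (ha : 0 < a) (hb : 0 < b) (hL : 0 < L) :
    ∃ C, 0 < C ∧ ∀ v : ℝ, |v| * ‖(Real.exp v : ℂ) * ph a b L (Real.exp v) 0‖ ≤ C * (1 + v ^ 2)⁻¹ := by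
  obtain ⟨C, hC, h⟩ := ph_bound ha hb hL (1/2) (3/2) (by norm_num)
  have hpi : ∀ σ : ℝ, 0 ≤ σ → Real.exp (-σ * Real.log (Real.pi / 1)) ≤ 1 := by
    intro σ h
    rw [div_one, Real.exp_le_one_iff]
    have := Real.log_nonneg (by linarith [Real.pi_gt_three] : 1 ≤ Real.pi)
    nlinarith
  have h1 : ∀ v : ℝ, ‖(Real.exp v : ℂ) * ph a b L (Real.exp v) 0‖ ≤ C * Real.exp (-(|v| / 2)) := by
    intro v
    rw [norm_mul, Complex.norm_real, Real.norm_of_nonneg (Real.exp_pos v).le]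
    have key : ∀ σ : ℝ, 1/2 ≤ σ → σ ≤ 3/2 → Real.exp v * ‖ph a b L (Real.exp v) 0‖ ≤ C * Real.exp (v - σ * v) := by
      intro σ h1 h2
      have h3 := h σ h1 h2 (Real.exp v) 1 (Real.exp_pos v) one_pos 0
      simp only [div_one, Int.cast_zero, abs_zero, add_zero, one_pow, inv_one, mul_one, Real.log_exp] at h3
      have h4 := hpi σ (by linarith)
      rw [div_one] at h4
      calc _ ≤ Real.exp v * (C * Real.exp (-σ * Real.log Real.pi) * Real.exp (-σ * v)) := by gcongr
        _ ≤ Real.exp v * (C * 1 * Real.exp (-σ * v)) := by gcongr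
        _ = C * (Real.exp v * Real.exp (-σ * v)) := by ring
        _ = _ := by rw [← Real.exp_add]; congr 2; ring
    rcases abs_cases v with ⟨hv, _⟩ | ⟨hv, _⟩ <;> rw [hv]
    · refine (key (3/2) (by norm_num) le_rfl).trans (le_of_eq ?_); congr 2; ring
    · refine (key (1/2) le_rfl (by norm_num)).trans (le_of_eq ?_); congr 2; ring
  refine ⟨C * 50, by positivity, fun v => ?_⟩
  have h2 : |v| * (1 + v ^ 2) * Real.exp (-(|v| / 2)) ≤ 50 := by
    have e1 := Real.pow_div_factorial_le_exp (|v|/2) (by positivity) 1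
    have e3 := Real.pow_div_factorial_le_exp (|v|/2) (by positivity) 3
    norm_num [Nat.factorial] at e1 e3
    rw [Real.exp_neg, ← div_eq_mul_inv, div_le_iff₀ (Real.exp_pos _)]
    rw [← sq_abs v]
    nlinarith
  calc |v| * ‖(Real.exp v : ℂ) * ph a b L (Real.exp v) 0‖ ≤ |v| * (C * Real.exp (-(|v| / 2))) := by
        gcongr; exact h1 v
    _ = C * (|v| * (1 + v ^ 2) * Real.exp (-(|v| / 2))) * (1 + v ^ 2)⁻¹ := by field_simp
    _ ≤ C * 50 * (1 + v ^ 2)⁻¹ := by gcongr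

theorem pc_lap {z : ℂ} (hz : 0 < z.re) : (IntegrableOn (fun u : ℝ => (u : ℂ) * cexp (-(z * u))) (Ioi 0)) ∧
    ∫ u in Ioi (0:ℝ), (u : ℂ) * cexp (-(z * u)) = 1 / z ^ 2 := by
  have hz0 : z ≠ 0 := by intro h; rw [h] at hz; simp at hz
  have h3 : IntegrableOn (fun u : ℝ => u * Real.exp (-(z.re * u))) (Ioi 0) := by
    have := integrableOn_rpow_mul_exp_neg_mul_rpow (p := 1) (s := 1) (b := z.re) (by norm_num) one_pos hz
    simpa using this
  have hinteg : IntegrableOn (fun u : ℝ => (u : ℂ) * cexp (-(z * u))) (Ioi 0) := by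
    refine h3.mono' (by fun_prop) ?_
    refine (ae_restrict_iff' measurableSet_Ioi).2 (Eventually.of_forall fun u hu => ?_)
    have hu : 0 < u := hu
    rw [norm_mul, Complex.norm_real, Real.norm_of_nonneg hu.le, Complex.norm_exp]
    simp
  refine ⟨hinteg, ?_⟩
  have hd : ∀ u ∈ Ici (0:ℝ), HasDerivAt (fun u : ℝ => -(((u:ℂ) / z + 1 / z ^ 2) * cexp (-(z * u)))) ((u : ℂ) * cexp (-(z * u))) u := by
    intro u _
    have h1 : HasDerivAt (fun u : ℝ => (u:ℂ)) 1 u := (hasDerivAt_id u).ofReal_comp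
    have h2 := ((h1.div_const z).add_const (1 / z ^ 2)).mul ((h1.const_mul z).neg.cexp)
    refine h2.neg.congr_deriv ?_
    simp only [Pi.neg_apply]
    field_simp
    ring
  have ht : Tendsto (fun u : ℝ => -(((u:ℂ) / z + 1 / z ^ 2) * cexp (-(z * u)))) atTop (𝓝 0) := by
    have t1 := tendsto_rpow_mul_exp_neg_mul_atTop_nhds_zero 1 z.re hz
    have t0 := tendsto_rpow_mul_exp_neg_mul_atTop_nhds_zero 0 z.re hz
    have t2 := (t1.mul_const (‖z‖⁻¹)).add (t0.mul_const ((‖z‖ ^ 2)⁻¹))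
    simp only [zero_mul, add_zero] at t2
    refine squeeze_zero_norm' ?_ t2
    filter_upwards [eventually_gt_atTop 0] with u hu
    rw [norm_neg, norm_mul, Complex.norm_exp]
    simp only [Real.rpow_one, Real.rpow_zero, one_mul]
    have e1 : (-(z * (u:ℂ))).re = -z.re * u := by simp
    rw [e1]
    have e2 : ‖(u:ℂ) / z + 1 / z ^ 2‖ ≤ u * ‖z‖⁻¹ + (‖z‖ ^ 2)⁻¹ := by
      refine (norm_add_le _ _).trans (le_of_eq ?_)
      simp [abs_of_pos hu, div_eq_mul_inv]
    calc _ ≤ (u * ‖z‖⁻¹ + (‖z‖ ^ 2)⁻¹) * Real.exp (-z.re * u) := by gcongr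
      _ = _ := by ring
  rw [integral_Ioi_of_hasDerivAt_of_tendsto' hd hinteg ht]
  simp

/-- main term evaluated -/
theorem pc_mainterm (ha : 0 < a) (hb : 0 < b) (hL : 0 < L) :
    ∃ A, 0 < A ∧ ∀ σ N : ℝ, 1 < σ → 1 ≤ N →
      (Integrable fun t : ℝ => pk a b L N 0 (σ + t * I) * (1 / ((σ + t * I) - 1) ^ 2)) ∧
      ‖(∫ t : ℝ, pk a b L N 0 (σ + t * I) * (1 / ((σ + t * I) - 1) ^ 2)) - ((N * Real.log N * (2 / Real.pi * ∫ y, (pw a b L y)⁻¹) : ℝ) : ℂ)‖ ≤ A * N := by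
  obtain ⟨C, hC, hg⟩ := pc_g_bound ha hb hL
  obtain ⟨hgi, hgv⟩ := pc_g_integral ha hb hL
  refine ⟨C * Real.pi, by positivity, fun σ N hσ hN => ?_⟩
  have hN0 : 0 < N := by linarith
  set g : ℝ → ℂ := fun v => (Real.exp v : ℂ) * ph a b L (Real.exp v) 0 with hgdef
  have hlap : ∀ s : ℂ, 1 < s.re → (IntegrableOn (fun u : ℝ => ((u * Real.exp u : ℝ) : ℂ) * pe (Real.exp u) s) (Ioi 0)) ∧
      ∫ u in Ioi (0:ℝ), ((u * Real.exp u : ℝ) : ℂ) * pe (Real.exp u) s = 1 / (s - 1) ^ 2 := by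
    intro s hs
    have h := pc_lap (z := s - 1) (by simp; linarith)
    have e : (fun u : ℝ => ((u * Real.exp u : ℝ) : ℂ) * pe (Real.exp u) s) = fun u : ℝ => (u : ℂ) * cexp (-((s - 1) * u)) := by
      ext u
      unfold pe
      rw [Real.log_exp]
      push_cast
      rw [mul_assoc, ← Complex.exp_add]
      congr 2; ring
    rw [e]; exact h
  have hF := pc_fub ha hb hL (by linarith : 0 < σ) hN0 0 (volume.restrict (Ioi (0:ℝ))) (fun u => ((u * Real.exp u : ℝ) : ℂ)) Real.exp
    Real.measurable_exp (Eventually.of_forall Real.exp_pos) (by fun_prop) (hlap σ (by simpa using hσ)).1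
  have e : ∀ t : ℝ, ∫ u in Ioi (0:ℝ), ((u * Real.exp u : ℝ) : ℂ) * pe (Real.exp u) (σ + t * I) = 1 / ((σ + t * I) - 1) ^ 2 :=
    fun t => (hlap _ (by simpa using hσ)).2
  simp_rw [e] at hF
  refine ⟨hF.1, ?_⟩
  rw [← hF.2]
  set ℓ := Real.log N with hℓ
  have hℓ0 : 0 ≤ ℓ := Real.log_nonneg hN
  have hNe : Real.exp ℓ = N := Real.exp_log hN0
  have h1 : ∫ u in Ioi (0:ℝ), ((u * Real.exp u : ℝ) : ℂ) * ph a b L (Real.exp u / N) 0 = N * ∫ v : ℝ, (if -ℓ < v then ((v + ℓ : ℝ) : ℂ) else 0) * g v := by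
    rw [← integral_indicator measurableSet_Ioi, ← integral_const_mul]
    rw [← integral_add_right_eq_self _ ℓ]
    congr 1; ext v
    by_cases hv : -ℓ < v
    · have : v + ℓ ∈ Ioi (0:ℝ) := by simp; linarith
      rw [indicator_of_mem this, if_pos hv, hgdef, Real.exp_add, hNe, mul_div_cancel_right₀ _ hN0.ne']
      push_cast; ring
    · have : v + ℓ ∉ Ioi (0:ℝ) := by simp; linarith
      rw [indicator_of_notMem this, if_neg hv]; simp
  have h2 : ((N * ℓ * (2 / Real.pi * ∫ y, (pw a b L y)⁻¹) : ℝ) : ℂ) = N * ∫ v : ℝ, (ℓ : ℂ) * g v := by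
    rw [integral_const_mul, hgv]; push_cast; ring
  have hbd : ∀ v : ℝ, ‖(if -ℓ < v then ((v + ℓ : ℝ) : ℂ) else 0) * g v - ℓ * g v‖ ≤ C * (1 + v ^ 2)⁻¹ := by
    intro v
    refine le_trans ?_ (hg v)
    rw [← sub_mul, norm_mul]
    refine mul_le_mul_of_nonneg_right ?_ (norm_nonneg _)
    split_ifs with hv
    · push_cast; simp
    · rw [zero_sub, norm_neg, Complex.norm_real, Real.norm_of_nonneg hℓ0]
      have := neg_abs_le v
      push Not at hv
      linarith [neg_le_abs v]
  have hmeas : AEStronglyMeasurable (fun v => (if -ℓ < v then ((v + ℓ : ℝ) : ℂ) else 0) * g v - ℓ * g v) volume := by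
    refine AEStronglyMeasurable.sub (AEStronglyMeasurable.mul ?_ hgi.aestronglyMeasurable) (hgi.aestronglyMeasurable.const_mul _)
    refine Measurable.aestronglyMeasurable ?_
    exact Measurable.ite measurableSet_Ioi (by fun_prop) measurable_const
  have hdi : Integrable (fun v => (if -ℓ < v then ((v + ℓ : ℝ) : ℂ) else 0) * g v - ℓ * g v) :=
    (integrable_inv_one_add_sq.const_mul C).mono' hmeas (Eventually.of_forall hbd)
  have hli : Integrable (fun v => (ℓ:ℂ) * g v) := hgi.const_mul _
  have hfi : Integrable (fun v => (if -ℓ < v then ((v + ℓ : ℝ) : ℂ) else 0) * g v) := by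
    refine (hdi.add hli).congr (Eventually.of_forall fun v => ?_)
    simp
  rw [h1, h2, ← mul_sub, ← integral_sub hfi hli, norm_mul, Complex.norm_real, Real.norm_of_nonneg hN0.le, mul_comm]
  refine mul_le_mul_of_nonneg_right ?_ hN0.le
  refine (norm_integral_le_of_norm_le (integrable_inv_one_add_sq.const_mul C) (Eventually.of_forall hbd)).trans ?_
  rw [integral_const_mul, integral_univ_inv_one_add_sq]

end PC3

section PC4
open Complex MeasureTheory Set Filter Topology FourierTransform
variable {a b L : ℝ}

theorem pc_N_pow {σ N : ℝ} (hσ : 0 ≤ σ) (hN : 1 < N) : Real.exp (-σ * Real.log (Real.pi / N)) ≤ Real.exp (σ * Real.log N) := by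
  apply Real.exp_le_exp.mpr
  rw [Real.log_div Real.pi_pos.ne' (by linarith)]
  have := Real.log_nonneg (by linarith [Real.pi_gt_three] : 1 ≤ Real.pi)
  nlinarith

theorem pc_final1 (ha : 0 < a) (hb : 0 < b) (hL : 0 < L) {ι : Type} [Countable ι] (c Q θ : ι → ℝ) (hQ : ∀ i, 0 < Q i) (hc : ∀ i, 0 ≤ c i)
    (hsum : ∀ σ : ℝ, 1 < σ → Summable fun i => c i * Real.exp (-σ * Real.log (Q i)))
    (r0 K : ℝ) (B : ℕ) (hr0 : 0 < r0) (hr1 : r0 ≤ 1) (hK : 0 < K)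
    (hbd : ∀ (m : ℤ) (s : ℂ), 1 < s.re → s.re ≤ 1 + r0 → ‖(∑' i, (c i * pch m (θ i)) * pe (Q i) s) - (if m = 0 then 1 / (s - 1) ^ 2 else 0)‖ ≤ K * (1 + |s.im| + |(m:ℝ)|) ^ B) :
    ∃ A N0 : ℝ, 0 < A ∧ 1 < N0 ∧ ∀ N, N0 ≤ N → Summable (fun i => c i * pH a b L (Q i / N) (θ i)) ∧
      |(∑' i, c i * pH a b L (Q i / N) (θ i)) - N * Real.log N * (2 / Real.pi * ∫ y, (pw a b L y)⁻¹)| ≤ A * N := by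
  obtain ⟨A1, hA1, h1⟩ := pc_main ha hb hL B 1 2 one_pos
  obtain ⟨A2, hA2, h2⟩ := pc_mainterm ha hb hL
  refine ⟨A1 * K * Real.exp 1 + A2, Real.exp (1 / r0), by positivity, by rw [Real.one_lt_exp_iff]; positivity, fun N hN => ?_⟩
  have hlog : 1 / r0 ≤ Real.log N := by
    rw [Real.le_log_iff_exp_le]; exact hN
    exact lt_of_lt_of_le (Real.exp_pos _) hN
  have hr0' : 0 < 1 / r0 := by positivity
  have hlogp : 0 < Real.log N := by linarith
  have hN1 : 1 < N := lt_of_lt_of_le (by rw [Real.one_lt_exp_iff]; positivity) hN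
  have hN0 : 0 < N := by linarith
  set σ := 1 + 1 / Real.log N with hσ
  have hd : 0 < 1 / Real.log N := by positivity
  have hd2 : 1 / Real.log N ≤ r0 := by
    rw [div_le_iff₀ hlogp]; rw [div_le_iff₀ hr0] at hlog; linarith
  have hσ1 : 1 < σ := by linarith
  have hσ2 : σ ≤ 1 + r0 := by linarith
  obtain ⟨m1, m2⟩ := h2 σ N hσ1 hN1.le
  have hh := h1 ι c Q θ hQ hc σ N K hσ1.le (by linarith) hN0 hK.le (fun t => 1 / ((σ + t * I) - 1) ^ 2) (hsum σ hσ1) m1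
    (fun m t => by simpa using hbd m (σ + t * I) (by simpa using hσ1) (by simpa using hσ2))
  refine ⟨hh.1, ?_⟩
  have e1 : Real.exp (-σ * Real.log (Real.pi / N)) ≤ Real.exp 1 * N := by
    refine (pc_N_pow (by linarith) hN1).trans (le_of_eq ?_)
    rw [hσ, add_mul, one_div, inv_mul_cancel₀ hlogp.ne', Real.exp_add, one_mul, Real.exp_log hN0]; ring
  have := hh.2
  rw [← Real.norm_eq_abs, ← Complex.norm_real]
  set M := ∫ t : ℝ, pk a b L N 0 (σ + t * I) * (1 / ((σ + t * I) - 1) ^ 2)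
  rw [Complex.ofReal_sub]
  refine (norm_sub_le_norm_sub_add_norm_sub _ M _).trans ?_
  have e2 : A1 * K * Real.exp (-σ * Real.log (Real.pi / N)) ≤ A1 * K * (Real.exp 1 * N) := by gcongr
  linarith

theorem pc_atan {δ : ℝ} (hδ : 0 < δ) : (Integrable fun t : ℝ => (δ ^ 2 + t ^ 2)⁻¹) ∧ ∫ t : ℝ, (δ ^ 2 + t ^ 2)⁻¹ = Real.pi / δ := by
  have e : (fun t : ℝ => (δ ^ 2 + t ^ 2)⁻¹) = fun t : ℝ => (δ ^ 2)⁻¹ * (1 + (t / δ) ^ 2)⁻¹ := by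
    ext t
    rw [← mul_inv]; congr 1; field_simp
  rw [e]
  constructor
  · exact (integrable_inv_one_add_sq.comp_div hδ.ne').const_mul _
  · rw [integral_const_mul, Measure.integral_comp_div (fun t : ℝ => (1 + t ^ 2)⁻¹), integral_univ_inv_one_add_sq, abs_of_pos hδ]
    simp only [smul_eq_mul]
    field_simp

theorem pc_final2 (ha : 0 < a) (hb : 0 < b) (hL : 0 < L) {ι : Type} [Countable ι] (c Q θ : ι → ℝ) (hQ : ∀ i, 0 < Q i) (hc : ∀ i, 0 ≤ c i)
    (hsum : ∀ σ : ℝ, 1 < σ → Summable fun i => c i * Real.exp (-σ * Real.log (Q i)))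
    (r0 K : ℝ) (B : ℕ) (hr0 : 0 < r0) (hr1 : r0 ≤ 1) (hK : 0 < K)
    (hbd : ∀ (m : ℤ) (s : ℂ), 1 < s.re → s.re ≤ 1 + r0 → ‖(∑' i, (c i * pch m (θ i)) * pe (Q i) s) - (if m = 0 then 1 / (s - 1) ^ 2 else 0)‖ ≤ K * (1 + |s.im| + |(m:ℝ)|) ^ B) :
    ∃ A N0 : ℝ, 0 < A ∧ 1 < N0 ∧ ∀ N, N0 ≤ N → Summable (fun i => c i * (Real.exp (-(1/2) * Real.log (Q i / N)) * pH a b L (Q i / N) (θ i))) ∧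
      (∑' i, c i * (Real.exp (-(1/2) * Real.log (Q i / N)) * pH a b L (Q i / N) (θ i))) ≤ A * N * Real.log N := by
  obtain ⟨A1, hA1, h1⟩ := pc_main ha hb hL B (1/2) 2 (by norm_num)
  obtain ⟨A2, hA2, h2⟩ := pk_norm_bound ha hb hL (1/2) 2 (by norm_num)
  refine ⟨A1 * K * Real.exp 1 + A2 * Real.exp 1 * Real.pi, Real.exp (1 / r0), by positivity, by rw [Real.one_lt_exp_iff]; positivity, fun N hN => ?_⟩
  have hlog : 1 / r0 ≤ Real.log N := by
    rw [Real.le_log_iff_exp_le]; exact hN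
    exact lt_of_lt_of_le (Real.exp_pos _) hN
  have hr0' : 1 ≤ 1 / r0 := by rw [le_div_iff₀ hr0]; linarith
  have hlogp : 1 ≤ Real.log N := by linarith
  have hN1 : 1 < N := lt_of_lt_of_le (by rw [Real.one_lt_exp_iff]; positivity) hN
  have hN0 : 0 < N := by linarith
  set δ := 1 / Real.log N with hδ
  set σ := 1/2 + δ with hσ
  have hd : 0 < δ := by positivity
  have hd2 : δ ≤ r0 := by
    rw [hδ, div_le_iff₀ (by linarith)]; rw [div_le_iff₀ hr0] at hlog; linarith
  have hpe : ∀ (q : ℝ) (s : ℂ), ((Real.exp (-(1/2) * Real.log q) : ℝ) : ℂ) * pe q s = pe q (s + 1/2) := by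
    intro q s
    unfold pe
    push_cast
    rw [← Complex.exp_add]; congr 1; ring
  have hn1 : ∀ t : ℝ, ‖((σ:ℂ) + t * I + 1 / 2 - 1) ^ 2‖ = δ ^ 2 + t ^ 2 := by
    intro t
    rw [norm_pow, ← Complex.normSq_eq_norm_sq, Complex.normSq_apply]
    simp [hσ]
    ring
  have hcontE : Continuous fun t : ℝ => 1 / ((σ:ℂ) + t * I + 1 / 2 - 1) ^ 2 := by
    refine Continuous.div continuous_const (by fun_prop) fun t h => ?_
    have := hn1 t
    rw [h, norm_zero] at this
    have : 0 < δ ^ 2 + t ^ 2 := by positivity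
    linarith
  have hbE : ∀ t : ℝ, ‖pk a b L N 0 (σ + t * I) * (1 / ((σ:ℂ) + t * I + 1 / 2 - 1) ^ 2)‖ ≤ A2 * Real.exp (-σ * Real.log (Real.pi / N)) * (δ ^ 2 + t ^ 2)⁻¹ := by
    intro t
    rw [norm_mul, norm_div, hn1 t, norm_one, one_div]
    refine mul_le_mul_of_nonneg_right ?_ (by positivity)
    have h3 := h2 σ (by linarith) (by linarith) N 0 t
    simp only [Int.cast_zero, abs_zero, add_zero, one_pow, inv_one, mul_one] at h3
    refine h3.trans (mul_le_of_le_one_right (by positivity) ?_)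
    exact inv_le_one_of_one_le₀ (by nlinarith)
  have hiE : Integrable fun t : ℝ => pk a b L N 0 (σ + t * I) * (1 / ((σ:ℂ) + t * I + 1 / 2 - 1) ^ 2) := by
    refine ((pc_atan hd).1.const_mul (A2 * Real.exp (-σ * Real.log (Real.pi / N)))).mono' ?_ (Eventually.of_forall hbE)
    exact (pk_meas ha hb (by linarith) N 0).mul hcontE.aestronglyMeasurable
  have hh := h1 ι (fun i => c i * Real.exp (-(1/2) * Real.log (Q i))) Q θ hQ (fun i => mul_nonneg (hc i) (Real.exp_pos _).le) σ N K (by linarith) (by linarith) hN0 hK.le (fun t => 1 / ((σ:ℂ) + t * I + 1 / 2 - 1) ^ 2)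
    ((hsum (1/2 + σ) (by linarith)).congr fun i => by rw [mul_assoc, ← Real.exp_add]; congr 2; ring) hiE
    (fun m t => by
      have := hbd m (σ + t * I + 1 / 2) (by simp; linarith) (by simp; linarith)
      have e : ∀ i, (((c i * Real.exp (-(1/2) * Real.log (Q i)) : ℝ) : ℂ) * pch m (θ i)) * pe (Q i) (σ + t * I) = (c i * pch m (θ i)) * pe (Q i) (σ + t * I + 1 / 2) := by
        intro i
        rw [← hpe]; push_cast; ring
      simp_rw [e]
      simpa using this)
  have hNe : Real.exp (-(1/2) * Real.log N) * Real.exp (1/2 * Real.log N) = 1 := by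
    rw [← Real.exp_add]; simp
  have hNN : Real.exp (1/2 * Real.log N) * Real.exp (1/2 * Real.log N) = N := by
    rw [← Real.exp_add, ← add_mul]; norm_num; exact Real.exp_log hN0
  set rN := Real.exp (1/2 * Real.log N) with hrN
  have hrp : 0 < rN := Real.exp_pos _
  have e : ∀ i, c i * (Real.exp (-(1/2) * Real.log (Q i / N)) * pH a b L (Q i / N) (θ i)) = rN * (c i * Real.exp (-(1/2) * Real.log (Q i)) * pH a b L (Q i / N) (θ i)) := by
    intro i
    rw [Real.log_div (hQ i).ne' hN0.ne', mul_sub, sub_eq_add_neg, Real.exp_add, hrN]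
    rw [show -(-(1/2) * Real.log N) = 1/2 * Real.log N by ring]
    ring
  simp_rw [e]
  refine ⟨hh.1.mul_left _, ?_⟩
  rw [tsum_mul_left]
  have e1 : Real.exp (-σ * Real.log (Real.pi / N)) ≤ Real.exp 1 * rN := by
    refine (pc_N_pow (by linarith) hN1).trans (le_of_eq ?_)
    rw [hσ, add_mul, hδ, one_div (Real.log N), inv_mul_cancel₀ (by linarith), Real.exp_add]; ring
  have h4 := hh.2
  set S := ∑' i, c i * Real.exp (-(1/2) * Real.log (Q i)) * pH a b L (Q i / N) (θ i)
  set M := ∫ t : ℝ, pk a b L N 0 (σ + t * I) * (1 / ((σ:ℂ) + t * I + 1 / 2 - 1) ^ 2)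
  have h5 : ‖M‖ ≤ A2 * (Real.exp 1 * rN) * (Real.pi * Real.log N) := by
    refine (norm_integral_le_of_norm_le ((pc_atan hd).1.const_mul (A2 * Real.exp (-σ * Real.log (Real.pi / N)))) (Eventually.of_forall hbE)).trans ?_
    rw [integral_const_mul, (pc_atan hd).2, hδ]
    rw [div_div_eq_mul_div, div_one]
    gcongr
  have h6 : S ≤ A1 * K * (Real.exp 1 * rN) + A2 * (Real.exp 1 * rN) * (Real.pi * Real.log N) := by
    have e3 : A1 * K * Real.exp (-σ * Real.log (Real.pi / N)) ≤ A1 * K * (Real.exp 1 * rN) := by gcongr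
    have : ‖(S:ℂ)‖ ≤ ‖(S:ℂ) - M‖ + ‖M‖ := by simpa using norm_add_le ((S:ℂ) - M) M
    rw [Complex.norm_real] at this
    have := Real.le_norm_self S
    linarith
  have h7 : A1 * K * (Real.exp 1 * rN) ≤ A1 * K * (Real.exp 1 * rN) * Real.log N := le_mul_of_one_le_right (by positivity) hlogp
  calc rN * S ≤ rN * (A1 * K * (Real.exp 1 * rN) * Real.log N + A2 * (Real.exp 1 * rN) * (Real.pi * Real.log N)) := by
        gcongr; linarith
    _ = (A1 * K * Real.exp 1 + A2 * Real.exp 1 * Real.pi) * (rN * rN) * Real.log N := by ring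
    _ = _ := by rw [hNN]

end PC4

section PE
open MeasureTheory Filter Topology Set Complex

noncomputable def tent (y : ℝ) : ℝ := max 0 (1 - |y|)

noncomputable def gth (L u v : ℝ) : ℝ := (Real.log u - Real.log v) / (2 * L)

noncomputable def gL (L : ℝ) (m : ℤ) (s : ℂ) (p : ℝ × ℝ) : ℂ :=
  if 1 ≤ |p.1 * p.2| then
    (tent (gth L p.1 p.2) : ℂ) * (pch m (gth L p.1 p.2) * pe |p.1 * p.2| s) else 0

lemma tent_nonneg (y : ℝ) : 0 ≤ tent y := le_max_left _ _
lemma tent_le_one (y : ℝ) : tent y ≤ 1 := by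
  unfold tent; apply max_le (by norm_num); linarith [abs_nonneg y]
lemma tent_lip (x y : ℝ) : |tent x - tent y| ≤ |x - y| := by
  unfold tent
  have h1 := abs_max_sub_max_le_abs (1 - |x|) (1 - |y|) 0
  rw [max_comm 0, max_comm 0]
  refine h1.trans ?_
  have : (1 - |x|) - (1 - |y|) = -(|x| - |y|) := by ring
  rw [this, abs_neg]
  exact abs_abs_sub_abs_le_abs_sub x y
lemma tent_pos {y : ℝ} (h : tent y ≠ 0) : |y| < 1 := by
  by_contra hh
  push Not at hh
  exact h (max_eq_left (by linarith))
lemma tent_cont : Continuous tent := by unfold tent; fun_prop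

lemma ce_lip (s : ℂ) (t0 t1 t2 : ℝ) (hs : 0 ≤ s.re) (h1 : t0 ≤ t1) (h2 : t0 ≤ t2) :
    ‖cexp (-s * (t1 : ℂ)) - cexp (-s * (t2 : ℂ))‖
      ≤ ‖s‖ * Real.exp (-s.re * t0) * |t1 - t2| := by
  have := Convex.norm_image_sub_le_of_norm_hasDerivWithin_le (𝕜 := ℝ)
    (f := fun t : ℝ => cexp (-s * (t : ℂ))) (f' := fun t : ℝ => cexp (-s * (t : ℂ)) * (-s))
    (s := Ici t0) (C := ‖s‖ * Real.exp (-s.re * t0)) (x := t2) (y := t1) ?_ ?_ (convex_Ici _) h2 h1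
  · simpa using this
  · intro x _
    apply HasDerivAt.hasDerivWithinAt
    have : HasDerivAt (fun t : ℝ => -s * (t : ℂ)) (-s) x := by
      simpa using (Complex.ofRealCLM.hasDerivAt (x := x)).const_mul (-s)
    exact this.cexp
  · intro x hx
    rw [norm_mul, norm_neg, mul_comm, Complex.norm_exp]
    have : (-s * (x : ℂ)).re = -s.re * x := by simp
    rw [this]
    have hx' : t0 ≤ x := hx
    apply mul_le_mul_of_nonneg_left _ (norm_nonneg _)
    apply Real.exp_le_exp.2
    nlinarith

lemma pch_lip (m : ℤ) (x y : ℝ) : ‖pch m x - pch m y‖ ≤ 2 * Real.pi * |(m:ℝ)| * |x - y| := by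
  have := ce_lip (-(2 * Real.pi * I * m)) (min x y) x y (by simp) (min_le_left _ _) (min_le_right _ _)
  unfold pch
  simp only [neg_neg] at this
  refine this.trans ?_
  simp [abs_of_pos Real.pi_pos]

lemma log_lip {u u' : ℝ} (hu : u ≠ 0) (h : |u' - u| ≤ |u| / 2) :
    |Real.log u' - Real.log u| ≤ 2 * |u' - u| / |u| := by
  have hu' : 0 < |u| := abs_pos.2 hu
  have h1 : |u' / u - 1| ≤ 1/2 := by
    rw [div_sub_one hu, abs_div, div_le_iff₀ hu']; linarith
  have h1b : 2 * |u' - u| / |u| = 2 * |u' / u - 1| := by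
    rw [div_sub_one hu, abs_div]; ring
  have h2 : 1/2 ≤ u' / u := by linarith [(abs_le.1 h1).1]
  have h3 : u' ≠ 0 := by
    rintro rfl
    norm_num at h2
  rw [← Real.log_div h3 hu, h1b]
  set x := u' / u
  have hx : 0 < x := by linarith
  rw [abs_le]
  constructor
  · have := Real.one_sub_inv_le_log_of_pos hx
    have h4 : 1 - x⁻¹ = (x - 1) / x := by field_simp
    have h5 : -(2 * |x - 1|) ≤ (x-1)/x := by
      rw [le_div_iff₀ hx]
      nlinarith [neg_abs_le (x-1), abs_nonneg (x-1)]
    linarith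
  · have := Real.log_le_sub_one_of_pos hx
    linarith [le_abs_self (x-1), abs_nonneg (x-1)]

/-- In the support, coordinates are comparable. -/
lemma supp_facts {L : ℝ} (hL : 0 < L) {p : ℝ × ℝ} (h1 : 1 ≤ |p.1 * p.2|)
    (h2 : |gth L p.1 p.2| < 1) :
    0 < ‖p‖ ∧ Real.exp (-(2*L)) * ‖p‖ ≤ |p.1| ∧ Real.exp (-(2*L)) * ‖p‖ ≤ |p.2| ∧
      2 * Real.log ‖p‖ - 2 * L ≤ Real.log |p.1 * p.2| := by
  obtain ⟨u, v⟩ := p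
  simp only at *
  have hu : u ≠ 0 := by rintro rfl; norm_num at h1
  have hv : v ≠ 0 := by rintro rfl; norm_num at h1
  have hu' := abs_pos.2 hu
  have hv' := abs_pos.2 hv
  have hn : ‖(u, v)‖ = max |u| |v| := by simp [Prod.norm_def]
  unfold gth at h2
  rw [abs_div, abs_of_pos (by linarith : 0 < 2 * L), div_lt_one (by linarith)] at h2
  obtain ⟨h3, h4⟩ := abs_lt.1 h2
  have e1 : |u| = Real.exp (Real.log u) := by rw [Real.exp_log_eq_abs hu]
  have e2 : |v| = Real.exp (Real.log v) := by rw [Real.exp_log_eq_abs hv]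
  have e3 : Real.log |u * v| = Real.log u + Real.log v := by
    rw [Real.log_abs, Real.log_mul hu hv]
  have he : Real.exp (-(2*L)) ≤ 1 := Real.exp_le_one_iff.2 (by linarith)
  have k1 : Real.exp (-(2*L)) * |v| ≤ |u| := by
    rw [e1, e2, ← Real.exp_add]; apply Real.exp_le_exp.2; linarith
  have k2 : Real.exp (-(2*L)) * |u| ≤ |v| := by
    rw [e1, e2, ← Real.exp_add]; apply Real.exp_le_exp.2; linarith
  rw [hn, e3]
  rcases max_cases |u| |v| with ⟨h, h'⟩ | ⟨h, h'⟩ <;> rw [h] <;> rw [Real.log_abs]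
  · refine ⟨hu', ?_, k2, by linarith⟩
    nlinarith
  · refine ⟨hv', k1, ?_, by linarith⟩
    nlinarith

lemma gL_ne {L : ℝ} {m : ℤ} {s : ℂ} {p : ℝ × ℝ} (h : gL L m s p ≠ 0) :
    1 ≤ |p.1 * p.2| ∧ |gth L p.1 p.2| < 1 := by
  unfold gL at h
  split_ifs at h with h1
  · refine ⟨h1, tent_pos ?_⟩
    intro h2; rw [h2] at h; simp at h
  · exact absurd rfl h

lemma gL_le_one (L : ℝ) (m : ℤ) {s : ℂ} (hs : 0 ≤ s.re) (p : ℝ × ℝ) : ‖gL L m s p‖ ≤ 1 := by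
  unfold gL
  split_ifs with h1
  · rw [norm_mul, norm_mul, pch_norm, pe_norm, one_mul, Complex.norm_real, Real.norm_eq_abs,
      abs_of_nonneg (tent_nonneg _)]
    apply mul_le_one₀ (tent_le_one _) (Real.exp_nonneg _)
    apply Real.exp_le_one_iff.2
    have := Real.log_nonneg h1
    nlinarith
  · simp

lemma gL_bound {L : ℝ} (hL : 0 < L) (m : ℤ) {s : ℂ} {σ0 : ℝ} (h0 : 0 ≤ σ0) (hs : σ0 ≤ s.re)
    (p : ℝ × ℝ) (hp : 0 < ‖p‖) :
    ‖gL L m s p‖ ≤ Real.exp (2 * L * σ0) * ‖p‖ ^ (-(2 * σ0)) := by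
  by_cases hg : gL L m s p = 0
  · rw [hg, norm_zero]; positivity
  obtain ⟨h1, h2⟩ := gL_ne hg
  obtain ⟨-, -, -, h3⟩ := supp_facts hL h1 h2
  unfold gL
  rw [if_pos h1, norm_mul, norm_mul, pch_norm, pe_norm, one_mul, Complex.norm_real,
    Real.norm_eq_abs, abs_of_nonneg (tent_nonneg _)]
  rw [Real.rpow_def_of_pos hp, ← Real.exp_add]
  calc _ ≤ 1 * Real.exp (-s.re * Real.log |p.1 * p.2|) :=
        mul_le_mul_of_nonneg_right (tent_le_one _) (Real.exp_nonneg _)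
    _ ≤ _ := by
      rw [one_mul]
      apply Real.exp_le_exp.2
      have := Real.log_nonneg h1
      nlinarith

lemma gL_lip_core {L : ℝ} (hL : 0 < L) {σ0 : ℝ} (h0 : 0 ≤ σ0) {C1 : ℝ} (hC1 : 0 ≤ C1) :
    ∃ C R1 : ℝ, 0 < C ∧ 0 < R1 ∧ ∀ (m : ℤ) (s : ℂ) (p p' : ℝ × ℝ), σ0 ≤ s.re → ‖p' - p‖ ≤ C1 →
      R1 ≤ ‖p‖ → gL L m s p ≠ 0 →
      ‖gL L m s p - gL L m s p'‖ ≤ C * (1 + ‖s‖ + |(m:ℝ)|) * ‖p‖ ^ (-(2 * σ0 + 1)) := by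
  refine ⟨(1 / L + 2 * Real.pi / L + 2) * (2 * C1 * Real.exp (2*L) + 1) * Real.exp (σ0 * (2 + 2*L)),
    max 1 (max (2 * C1 * Real.exp (2*L)) (Real.exp (L + 1))), ?_, ?_, ?_⟩
  · have := Real.pi_pos; positivity
  · positivity
  intro m s p p' hs hd hR hg
  obtain ⟨h1, h2⟩ := gL_ne hg
  obtain ⟨hp, k1, k2, k3⟩ := supp_facts hL h1 h2
  have hR1 := (le_max_left _ _).trans hR
  have hR2 := ((le_max_left _ _).trans (le_max_right _ _)).trans hR
  have hR3 := ((le_max_right _ _).trans (le_max_right _ _)).trans hR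
  obtain ⟨u, v⟩ := p
  obtain ⟨u', v'⟩ := p'
  set r := ‖(u, v)‖ with hr
  simp only at *
  have hu : u ≠ 0 := by rintro rfl; norm_num at h1
  have hv : v ≠ 0 := by rintro rfl; norm_num at h1
  have hdu : |u' - u| ≤ C1 := by
    exact (norm_fst_le ((u', v') - (u, v))).trans hd
  have hdv : |v' - v| ≤ C1 := by
    exact (norm_snd_le ((u', v') - (u, v))).trans hd
  set ρ := Real.exp (-(2*L)) * r with hρ
  have hρ0 : 0 < ρ := by positivity
  have hee : Real.exp (2*L) * Real.exp (-(2*L)) = 1 := by rw [← Real.exp_add]; simp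
  have hρ1 : 2 * C1 ≤ ρ := by
    have : Real.exp (-(2*L)) * (2 * C1 * Real.exp (2*L)) ≤ ρ :=
      mul_le_mul_of_nonneg_left hR2 (Real.exp_nonneg _)
    nlinarith
  set δ := 2 * C1 / ρ with hδ
  have hδ0 : 0 ≤ δ := by positivity
  have hδ1 : δ ≤ 1 := (div_le_one hρ0).2 hρ1
  have lu : |Real.log u' - Real.log u| ≤ δ := by
    refine (log_lip hu (by linarith)).trans ?_
    exact div_le_div₀ (by positivity) (by linarith) hρ0 k1
  have lv : |Real.log v' - Real.log v| ≤ δ := by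
    refine (log_lip hv (by linarith)).trans ?_
    exact div_le_div₀ (by positivity) (by linarith) hρ0 k2
  have hu' : u' ≠ 0 := by
    rintro rfl
    simp only [zero_sub, abs_neg] at hdu
    linarith [abs_pos.2 hu]
  have hv' : v' ≠ 0 := by
    rintro rfl
    simp only [zero_sub, abs_neg] at hdv
    linarith [abs_pos.2 hv]
  have e1 : Real.log |u * v| = Real.log u + Real.log v := by
    rw [Real.log_abs, Real.log_mul hu hv]
  have e2 : Real.log |u' * v'| = Real.log u' + Real.log v' := by
    rw [Real.log_abs, Real.log_mul hu' hv']
  have hlr : L + 1 ≤ Real.log r := by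
    rw [Real.le_log_iff_exp_le hp]; exact hR3
  set t0 := 2 * Real.log r - 2 * L - 2 with ht0
  have ht00 : 0 ≤ t0 := by rw [ht0]; linarith
  have q1 : t0 ≤ Real.log |u * v| := by linarith
  have q2 : t0 ≤ Real.log |u' * v'| := by
    rw [e2]
    rw [e1] at k3
    linarith [(abs_le.1 lu).1, (abs_le.1 lv).1]
  have h1' : 1 ≤ |u' * v'| := by
    by_contra hh
    push Not at hh
    have : Real.log |u' * v'| < 0 := Real.log_neg (abs_pos.2 (mul_ne_zero hu' hv')) hh
    linarith
  have dQ : |(Real.log |u * v|) - (Real.log (|u' * v'|) )| ≤ 2 * δ := by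
    rw [e1, e2, abs_le]
    constructor <;> linarith [(abs_le.1 lu).1, (abs_le.1 lv).1, (abs_le.1 lu).2, (abs_le.1 lv).2]
  have dθ : |gth L u v - gth L u' v'| ≤ δ / L := by
    unfold gth
    rw [← sub_div, abs_div, abs_of_pos (by linarith : 0 < 2 * L), div_le_div_iff₀ (by linarith) hL]
    have : |Real.log u - Real.log v - (Real.log u' - Real.log v')| ≤ 2 * δ := by
      rw [abs_le]
      constructor <;> linarith [(abs_le.1 lu).1, (abs_le.1 lv).1, (abs_le.1 lu).2, (abs_le.1 lv).2]
    nlinarith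
  have hs0 : 0 ≤ s.re := h0.trans hs
  have hpe := ce_lip s t0 _ _ hs0 q1 q2
  have hex : Real.exp (-s.re * t0) ≤ Real.exp (-σ0 * t0) := by
    apply Real.exp_le_exp.2; nlinarith
  have hpe' : ‖pe |u * v| s - pe |u' * v'| s‖ ≤ ‖s‖ * Real.exp (-σ0 * t0) * (2 * δ) := by
    unfold pe
    refine hpe.trans ?_
    gcongr
  have hpn : ‖pe |u * v| s‖ ≤ Real.exp (-σ0 * t0) := by
    rw [pe_norm]
    apply Real.exp_le_exp.2; nlinarith
  have hch := pch_lip m (gth L u v) (gth L u' v')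
  unfold gL
  simp only [if_pos h1, if_pos h1']
  set T := tent (gth L u v)
  set T' := tent (gth L u' v') with hT'
  set X := pch m (gth L u v)
  set X' := pch m (gth L u' v') with hX'
  set E := pe |u * v| s
  set E' := pe |u' * v'| s
  have hTT : |T - T'| ≤ δ / L := (tent_lip _ _).trans dθ
  have hTT2 : |T'| ≤ 1 := by rw [abs_of_nonneg (tent_nonneg _)]; exact tent_le_one _
  have split : (T:ℂ) * (X * E) - T' * (X' * E') =
      ((T - T' : ℝ) : ℂ) * (X * E) + T' * ((X - X') * E) + T' * (X' * (E - E')) := by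
    push_cast; ring
  rw [split]
  have b1 : ‖((T - T' : ℝ) : ℂ) * (X * E)‖ ≤ δ / L * Real.exp (-σ0 * t0) := by
    rw [norm_mul, norm_mul, pch_norm, one_mul, Complex.norm_real, Real.norm_eq_abs]
    gcongr
  have b2 : ‖(T':ℂ) * ((X - X') * E)‖ ≤
      1 * ((2 * Real.pi * |(m:ℝ)| * (δ / L)) * Real.exp (-σ0 * t0)) := by
    rw [norm_mul, norm_mul, Complex.norm_real, Real.norm_eq_abs]
    have : ‖X - X'‖ ≤ 2 * Real.pi * |(m:ℝ)| * (δ / L) :=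
      hch.trans (mul_le_mul_of_nonneg_left dθ (by have := Real.pi_pos; positivity))
    gcongr
  have b3 : ‖(T':ℂ) * (X' * (E - E'))‖ ≤ 1 * (1 * (‖s‖ * Real.exp (-σ0 * t0) * (2 * δ))) := by
    rw [norm_mul, norm_mul, Complex.norm_real, Real.norm_eq_abs, hX', pch_norm]
    gcongr
  have hexp : Real.exp (-σ0 * t0) = Real.exp (σ0 * (2 + 2*L)) * r ^ (-(2 * σ0)) := by
    rw [Real.rpow_def_of_pos hp, ← Real.exp_add]
    congr 1
    rw [ht0]; ring
  have hrp : r ^ (-(2 * σ0 + 1)) = r ^ (-(2 * σ0)) / r := by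
    rw [show -(2 * σ0 + 1) = -(2*σ0) - 1 by ring, Real.rpow_sub_one hp.ne']
  have hδr : δ = 2 * C1 * Real.exp (2*L) / r := by
    rw [hδ, hρ]
    rw [div_eq_div_iff (by positivity) hp.ne']
    linear_combination (-2 * C1 * r) * hee
  calc _ ≤ δ / L * Real.exp (-σ0 * t0) +
      1 * ((2 * Real.pi * |(m:ℝ)| * (δ / L)) * Real.exp (-σ0 * t0)) +
      1 * (1 * (‖s‖ * Real.exp (-σ0 * t0) * (2 * δ))) :=
        (norm_add_le _ _).trans (add_le_add ((norm_add_le _ _).trans (add_le_add b1 b2)) b3)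
    _ = (1 / L * 1 + 2 * Real.pi / L * |(m:ℝ)| + 2 * ‖s‖) * (δ * Real.exp (-σ0 * t0)) := by ring
    _ ≤ (1 / L * (1 + ‖s‖ + |(m:ℝ)|) + 2 * Real.pi / L * (1 + ‖s‖ + |(m:ℝ)|) +
        2 * (1 + ‖s‖ + |(m:ℝ)|)) * (δ * Real.exp (-σ0 * t0)) := by
      have := Real.pi_pos
      have n1 := norm_nonneg s
      have n2 := abs_nonneg (m:ℝ)
      gcongr <;> linarith
    _ = (1 / L + 2 * Real.pi / L + 2) * (1 + ‖s‖ + |(m:ℝ)|) *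
        (2 * C1 * Real.exp (2*L) * (Real.exp (σ0 * (2 + 2*L)) * (r ^ (-(2 * σ0)) / r))) := by
      rw [hexp, hδr]; ring
    _ ≤ (1 / L + 2 * Real.pi / L + 2) * (1 + ‖s‖ + |(m:ℝ)|) *
        ((2 * C1 * Real.exp (2*L) + 1) * (Real.exp (σ0 * (2 + 2*L)) * (r ^ (-(2 * σ0)) / r))) := by
      have := Real.pi_pos
      gcongr
      linarith
    _ = _ := by rw [hrp]; ring

end PE

section PE2
open MeasureTheory Filter Topology Set Complex

def kc (k : ℤ × ℤ) : ℝ × ℝ := ((k.1 : ℝ), (k.2 : ℝ))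
def cell (k : ℤ × ℤ) : Set (ℝ × ℝ) := {p | ⌊p.1⌋ = k.1 ∧ ⌊p.2⌋ = k.2}
noncomputable def nk (k : ℤ × ℤ) : ℝ := 1 + ‖kc k‖

lemma nk_pos (k) : 1 ≤ nk k := by unfold nk; linarith [norm_nonneg (kc k)]

lemma cell_eq (k : ℤ × ℤ) : cell k = Ico (k.1:ℝ) (k.1+1) ×ˢ Ico (k.2:ℝ) (k.2+1) := by
  ext p
  simp only [cell, mem_ofPred_eq, mem_prod, mem_Ico, Int.floor_eq_iff]

lemma cell_meas (k) : MeasurableSet (cell k) := by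
  rw [cell_eq]; exact measurableSet_Ico.prod measurableSet_Ico

lemma cell_vol (k) : volume (cell k) = 1 := by
  rw [cell_eq, Measure.volume_eq_prod, Measure.prod_prod]; simp

lemma cell_norm {k p} (h : p ∈ cell k) : ‖p - kc k‖ ≤ 1 := by
  rw [cell_eq] at h
  obtain ⟨⟨a, b⟩, ⟨c, d⟩⟩ := h
  rw [Prod.norm_def]
  simp only [kc, Prod.fst_sub, Prod.snd_sub, Real.norm_eq_abs]
  apply max_le <;> rw [abs_le] <;> constructor <;> linarith

lemma cell_union : (⋃ k, cell k) = univ := by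
  ext p; simp only [mem_iUnion, mem_univ, iff_true]
  exact ⟨(⌊p.1⌋, ⌊p.2⌋), rfl, rfl⟩

lemma cell_disj : Pairwise (Function.onFun Disjoint cell) := by
  intro a b hab
  rw [Function.onFun, Set.disjoint_left]
  rintro p ⟨h1, h2⟩ ⟨h3, h4⟩
  exact hab (Prod.ext (h1.symm.trans h3) (h2.symm.trans h4))

lemma nk_summable {τ : ℝ} (h : 2 < τ) : Summable fun k : ℤ × ℤ => nk k ^ (-τ) := by
  have h1 := EisensteinSeries.summable_one_div_norm_rpow h
  rw [← (finTwoArrowEquiv ℤ).symm.summable_iff] at h1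
  refine (summable_of_hasFiniteSupport (f := fun k : ℤ × ℤ => if k = 0 then (1:ℝ) else 0) ?_ |>.add h1).of_nonneg_of_le ?_ ?_
  · exact (finite_singleton (0: ℤ × ℤ)).subset (by intro k; simp)
  · intro k; have := nk_pos k; positivity
  · intro k
    have hk := nk_pos k
    by_cases h0 : k = 0
    · simp only [h0, if_true, Function.comp]
      have : nk 0 = 1 := by simp [nk, kc]
      rw [this, Real.one_rpow]
      have : 0 ≤ ‖(finTwoArrowEquiv ℤ).symm 0‖ ^ (-τ) := by positivity
      linarith
    · simp only [h0, if_false, zero_add, Function.comp]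
      have e : ‖(finTwoArrowEquiv ℤ).symm k‖ = ‖kc k‖ := by
        apply le_antisymm
        · rw [pi_norm_le_iff_of_nonneg (norm_nonneg _)]
          intro i
          fin_cases i
          · exact norm_fst_le (kc k)
          · exact norm_snd_le (kc k)
        · rw [Prod.norm_def]
          apply max_le
          · exact norm_le_pi_norm ((finTwoArrowEquiv ℤ).symm k) 0
          · exact norm_le_pi_norm ((finTwoArrowEquiv ℤ).symm k) 1
      rw [e]
      have hk0 : 0 < ‖kc k‖ := by
        rw [norm_pos_iff]
        intro h; apply h0
        have h1 := congrArg Prod.fst h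
        have h2 := congrArg Prod.snd h
        simp [kc] at h1 h2
        exact Prod.ext h1 h2
      apply Real.rpow_le_rpow_of_nonpos hk0 _ (by linarith)
      unfold nk; linarith

lemma T_lower (T : (ℝ × ℝ) ≃L[ℝ] (ℝ × ℝ)) : ∃ c0 : ℝ, 0 < c0 ∧ ∀ p, c0 * ‖p‖ ≤ ‖T p‖ := by
  refine ⟨(‖(T.symm : (ℝ × ℝ) →L[ℝ] (ℝ × ℝ))‖ + 1)⁻¹, by positivity, fun p => ?_⟩
  rw [inv_mul_le_iff₀ (by positivity)]
  have := (T.symm : (ℝ × ℝ) →L[ℝ] (ℝ × ℝ)).le_opNorm (T p)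
  simp at this
  nlinarith [norm_nonneg (T p)]

lemma gT_bound {L : ℝ} (hL : 0 < L) (T : (ℝ × ℝ) ≃L[ℝ] (ℝ × ℝ)) {σ0 : ℝ} (h0 : 0 ≤ σ0) :
    ∃ C : ℝ, 0 < C ∧ ∀ (m : ℤ) (s : ℂ) (k : ℤ × ℤ) (p : ℝ × ℝ), σ0 ≤ s.re → ‖p - kc k‖ ≤ 1 →
      ‖gL L m s (T p)‖ ≤ C * nk k ^ (-(2 * σ0)) := by
  obtain ⟨c0, hc0, hT⟩ := T_lower T
  refine ⟨max (Real.exp (2 * L * σ0) * (c0/2) ^ (-(2*σ0))) ((4:ℝ) ^ (2*σ0)), by positivity, ?_⟩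
  intro m s k p hs hp
  have hk := nk_pos k
  by_cases hb : nk k ≤ 4
  · refine (gL_le_one L m (h0.trans hs) _).trans ?_
    calc (1:ℝ) = 4 ^ (2*σ0) * 4 ^ (-(2*σ0)) := by
          rw [← Real.rpow_add (by norm_num)]; simp
      _ ≤ _ := by
          apply mul_le_mul (le_max_right _ _) _ (by positivity) (by positivity)
          exact Real.rpow_le_rpow_of_nonpos (by linarith) hb (by linarith)
  · push Not at hb
    have h1 : nk k / 2 ≤ ‖p‖ := by
      have := norm_sub_norm_le (kc k) p
      rw [norm_sub_rev] at this
      unfold nk at hb ⊢; linarith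
    have h2 : c0 / 2 * nk k ≤ ‖T p‖ := by
      refine le_trans ?_ (hT p); nlinarith
    have h3 : 0 < c0 / 2 * nk k := by positivity
    refine (gL_bound hL m h0 hs _ (h3.trans_le h2)).trans ?_
    calc _ ≤ Real.exp (2 * L * σ0) * (c0 / 2 * nk k) ^ (-(2*σ0)) := by
          exact mul_le_mul_of_nonneg_left
            (Real.rpow_le_rpow_of_nonpos h3 h2 (by linarith)) (by positivity)
      _ = Real.exp (2 * L * σ0) * (c0 / 2)^(-(2*σ0)) * nk k ^ (-(2*σ0)) := by
          rw [Real.mul_rpow (by positivity) (by positivity)]; ring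
      _ ≤ _ := by gcongr; exact le_max_left _ _

lemma gT_lip {L : ℝ} (hL : 0 < L) (T : (ℝ × ℝ) ≃L[ℝ] (ℝ × ℝ)) {σ0 : ℝ} (h0 : 0 ≤ σ0) :
    ∃ C : ℝ, 0 < C ∧ ∀ (m : ℤ) (s : ℂ) (k : ℤ × ℤ) (p : ℝ × ℝ), σ0 ≤ s.re → ‖p - kc k‖ ≤ 1 →
      ‖gL L m s (T (kc k)) - gL L m s (T p)‖ ≤
        C * (1 + ‖s‖ + |(m:ℝ)|) * nk k ^ (-(2 * σ0 + 1)) := by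
  obtain ⟨c0, hc0, hT⟩ := T_lower T
  obtain ⟨C, R1, hC, hR1, H⟩ := gL_lip_core hL h0
    (C1 := ‖(T : (ℝ × ℝ) →L[ℝ] (ℝ × ℝ))‖) (norm_nonneg _)
  set n0 := max 4 (R1 * 2 / c0) with hn0
  refine ⟨max (C * (c0/2) ^ (-(2*σ0+1))) (2 * n0 ^ (2*σ0+1)), by positivity, ?_⟩
  intro m s k p hs hp
  have hk := nk_pos k
  have hS : 1 ≤ 1 + ‖s‖ + |(m:ℝ)| := by linarith [norm_nonneg s, abs_nonneg (m:ℝ)]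
  have hn0' : 0 < n0 := by positivity
  by_cases hb : nk k ≤ n0
  · have h2 : ‖gL L m s (T (kc k)) - gL L m s (T p)‖ ≤ 2 := by
      refine (norm_sub_le _ _).trans ?_
      linarith [gL_le_one L m (h0.trans hs) (T (kc k)), gL_le_one L m (h0.trans hs) (T p)]
    refine h2.trans ?_
    calc (2:ℝ) = (2 * n0 ^ (2*σ0+1)) * 1 * n0 ^ (-(2*σ0+1)) := by
          rw [mul_one, mul_assoc, ← Real.rpow_add hn0']; simp
      _ ≤ _ := by
          apply mul_le_mul _ _ (by positivity) (by positivity)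
          · exact mul_le_mul (le_max_right _ _) hS (by positivity) (by positivity)
          · exact Real.rpow_le_rpow_of_nonpos (by linarith) hb (by linarith)
  · push Not at hb
    have hb4 : 4 < nk k := (le_max_left _ _).trans_lt hb
    have hbR : R1 ≤ c0 / 2 * nk k := by
      have := ((le_max_right 4 _).trans_lt hb).le
      rw [div_le_iff₀ hc0] at this
      linarith
    have h3 : 0 < c0 / 2 * nk k := by positivity
    have key : ∀ q q' : ℝ × ℝ, ‖q - kc k‖ ≤ 1 → ‖q' - q‖ ≤ 1 → gL L m s (T q) ≠ 0 →
        ‖gL L m s (T q) - gL L m s (T q')‖ ≤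
        max (C * (c0/2) ^ (-(2*σ0+1))) (2 * n0 ^ (2*σ0+1)) * (1 + ‖s‖ + |(m:ℝ)|) * nk k ^ (-(2 * σ0 + 1)) := by
      intro q q' hq hqq hne
      have h1 : nk k / 2 ≤ ‖q‖ := by
        have := norm_sub_norm_le (kc k) q
        rw [norm_sub_rev] at this
        unfold nk at hb4 ⊢; linarith
      have h2 : c0 / 2 * nk k ≤ ‖T q‖ := by
        refine le_trans ?_ (hT q); nlinarith
      have h4 : ‖T q' - T q‖ ≤ ‖(T : (ℝ × ℝ) →L[ℝ] (ℝ × ℝ))‖ := by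
        rw [← map_sub]
        have := (T : (ℝ × ℝ) →L[ℝ] (ℝ × ℝ)).le_opNorm (q' - q)
        refine this.trans ?_
        exact mul_le_of_le_one_right (norm_nonneg _) hqq
      refine (H m s _ _ hs h4 (hbR.trans h2) hne).trans ?_
      calc _ ≤ C * (1 + ‖s‖ + |(m:ℝ)|) * (c0 / 2 * nk k) ^ (-(2*σ0+1)) := by
            exact mul_le_mul_of_nonneg_left
              (Real.rpow_le_rpow_of_nonpos h3 h2 (by linarith)) (by positivity)
        _ = (C * (c0 / 2)^(-(2*σ0+1))) * (1 + ‖s‖ + |(m:ℝ)|) * nk k ^ (-(2*σ0+1)) := by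
            rw [Real.mul_rpow (by positivity) (by positivity)]; ring
        _ ≤ _ := by gcongr; exact le_max_left _ _
    by_cases hA : gL L m s (T (kc k)) = 0
    · by_cases hB : gL L m s (T p) = 0
      · rw [hA, hB, sub_zero, norm_zero]; positivity
      · rw [norm_sub_rev]
        exact key p (kc k) hp (by rwa [norm_sub_rev]) hB
    · exact key (kc k) p (by simp) hp hA

lemma pch_meas (m : ℤ) : Measurable (pch m) := by
  unfold pch; fun_prop

lemma gL_meas (L : ℝ) (m : ℤ) (s : ℂ) : Measurable (gL L m s) := by
  unfold gL
  apply Measurable.ite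
  · exact measurableSet_le (by fun_prop) (by fun_prop)
  · have h1 : Measurable fun p : ℝ × ℝ => gth L p.1 p.2 := by unfold gth; fun_prop
    have h2 : Measurable fun p : ℝ × ℝ => pe |p.1 * p.2| s := by
      unfold pe
      have : Measurable fun p : ℝ × ℝ => Real.log |p.1 * p.2| := by
        simp only [Real.log_abs]; fun_prop
      fun_prop
    exact ((Complex.measurable_ofReal.comp (tent_cont.measurable.comp h1))).mul
      (((pch_meas m).comp h1).mul h2)
  · exact measurable_const

lemma gT_meas (L : ℝ) (m : ℤ) (s : ℂ) (T : (ℝ × ℝ) ≃L[ℝ] (ℝ × ℝ)) :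
    Measurable fun p => gL L m s (T p) := (gL_meas L m s).comp T.continuous.measurable

instance cell_fin (k) : IsFiniteMeasure (volume.restrict (cell k)) :=
  ⟨by rw [Measure.restrict_apply_univ, cell_vol]; simp⟩

lemma gT_int (L : ℝ) (m : ℤ) {s : ℂ} (hs : 0 ≤ s.re) (T : (ℝ × ℝ) ≃L[ℝ] (ℝ × ℝ)) (k) :
    IntegrableOn (fun p => gL L m s (T p)) (cell k) := by
  apply Integrable.of_bound (gT_meas L m s T).aestronglyMeasurable 1
  exact Eventually.of_forall fun p => gL_le_one L m hs _

noncomputable def Gk (L : ℝ) (T : (ℝ × ℝ) ≃L[ℝ] (ℝ × ℝ)) (m : ℤ) (k : ℤ × ℤ) (s : ℂ) : ℂ :=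
  gL L m s (T (kc k)) - ∫ p in cell k, gL L m s (T p)

lemma Gk_bound {L : ℝ} (hL : 0 < L) (T : (ℝ × ℝ) ≃L[ℝ] (ℝ × ℝ)) {σ0 : ℝ} (h0 : 0 ≤ σ0) :
    ∃ C : ℝ, 0 < C ∧ ∀ (m : ℤ) (s : ℂ) (k : ℤ × ℤ), σ0 ≤ s.re →
      ‖Gk L T m k s‖ ≤ C * (1 + ‖s‖ + |(m:ℝ)|) * nk k ^ (-(2 * σ0 + 1)) := by
  obtain ⟨C, hC, H⟩ := gT_lip hL T h0
  refine ⟨C, hC, fun m s k hs => ?_⟩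
  have e : Gk L T m k s = ∫ p in cell k, (gL L m s (T (kc k)) - gL L m s (T p)) := by
    rw [integral_sub (integrable_const _) (gT_int L m (h0.trans hs) T k)]
    simp [Gk, Measure.real, cell_vol]
  rw [e]
  have := norm_setIntegral_le_of_norm_le_const (μ := volume) (s := cell k)
    (f := fun p => gL L m s (T (kc k)) - gL L m s (T p))
    (C := C * (1 + ‖s‖ + |(m:ℝ)|) * nk k ^ (-(2 * σ0 + 1))) (by rw [cell_vol]; simp)
    (fun p hp => H m s k p hs (cell_norm hp))
  simpa [Measure.real, cell_vol] using this

lemma gL_hasDeriv (L : ℝ) (m : ℤ) (s : ℂ) (p : ℝ × ℝ) :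
    HasDerivAt (fun s => gL L m s p) (-(Real.log |p.1 * p.2| : ℂ) * gL L m s p) s := by
  unfold gL
  split_ifs with h
  · have h1 : HasDerivAt (fun s => pe |p.1*p.2| s)
        (pe |p.1 * p.2| s * (-(Real.log |p.1 * p.2| : ℂ))) s := by
      unfold pe
      have : HasDerivAt (fun s : ℂ => -s * (Real.log |p.1 * p.2| : ℂ))
          (-(Real.log |p.1 * p.2| : ℂ)) s := by
        simpa using ((hasDerivAt_id s).neg.mul_const (Real.log |p.1 * p.2| : ℂ))
      exact this.cexp
    refine ((h1.const_mul _).const_mul _).congr_deriv ?_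
    ring
  · simpa using hasDerivAt_const s (0:ℂ)

lemma gL_deriv_bound (L : ℝ) (m : ℤ) {s : ℂ} {σ : ℝ} (hσ : 0 < σ) (hs : σ ≤ s.re) (p : ℝ × ℝ) :
    ‖-(Real.log |p.1 * p.2| : ℂ) * gL L m s p‖ ≤ 1 / σ := by
  unfold gL
  split_ifs with h1
  · rw [norm_mul, norm_mul, norm_mul, pch_norm, pe_norm, one_mul, Complex.norm_real,
      Real.norm_eq_abs, abs_of_nonneg (tent_nonneg _), norm_neg, Complex.norm_real, Real.norm_eq_abs]
    have hl := Real.log_nonneg h1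
    set l := Real.log |p.1 * p.2|
    rw [abs_of_nonneg hl]
    have h2 : Real.exp (-s.re * l) ≤ Real.exp (-(σ * l)) := Real.exp_le_exp.2 (by nlinarith)
    have h3 : σ * l * Real.exp (-(σ * l)) ≤ 1 := by
      have := Real.add_one_le_exp (σ * l)
      rw [Real.exp_neg, ← div_eq_mul_inv, div_le_one (Real.exp_pos _)]
      linarith
    rw [le_div_iff₀ hσ]
    calc _ ≤ l * (1 * Real.exp (-(σ * l))) * σ := by
          gcongr; exact tent_le_one _
      _ ≤ 1 := by linarith
  · simp; positivity

lemma Gk_diff (L : ℝ) (T : (ℝ × ℝ) ≃L[ℝ] (ℝ × ℝ)) (m : ℤ) (k : ℤ × ℤ) {s : ℂ} (hs : 0 < s.re) :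
    DifferentiableAt ℂ (Gk L T m k) s := by
  apply DifferentiableAt.sub
  · exact (gL_hasDeriv L m s _).differentiableAt
  · have hopen : {z : ℂ | s.re / 2 < z.re} ∈ 𝓝 s :=
      (isOpen_lt continuous_const Complex.continuous_re).mem_nhds (by simp; linarith)
    have := hasDerivAt_integral_of_dominated_loc_of_deriv_le
      (μ := volume.restrict (cell k)) (F := fun s p => gL L m s (T p))
      (F' := fun s p => -(Real.log |(T p).1 * (T p).2| : ℂ) * gL L m s (T p))
      (bound := fun _ => 1 / (s.re/2)) (x₀ := s) hopen
      (Eventually.of_forall fun z => (gT_meas L m z T).aestronglyMeasurable)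
      (gT_int L m hs.le T k) ?_ ?_ (integrable_const _) ?_
    · exact this.2.differentiableAt
    · apply Measurable.aestronglyMeasurable
      apply Measurable.mul _ (gT_meas L m s T)
      have : Measurable fun p : ℝ × ℝ => Real.log |(T p).1 * (T p).2| := by
        simp only [Real.log_abs]
        have := T.continuous.measurable
        fun_prop
      fun_prop
    · refine Eventually.of_forall fun p z hz => gL_deriv_bound L m (by linarith) (le_of_lt hz) _
    · exact Eventually.of_forall fun p z hz => gL_hasDeriv L m z _

noncomputable def RT (L : ℝ) (T : (ℝ × ℝ) ≃L[ℝ] (ℝ × ℝ)) (m : ℤ) (s : ℂ) : ℂ :=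
  ∑' k, Gk L T m k s

lemma Gk_summable {L : ℝ} (hL : 0 < L) (T : (ℝ × ℝ) ≃L[ℝ] (ℝ × ℝ)) (m) {s : ℂ}
    (hs : 1/2 < s.re) : Summable fun k => Gk L T m k s := by
  obtain ⟨C, hC, H⟩ := Gk_bound hL T (σ0 := s.re) (by linarith)
  exact Summable.of_norm_bounded ((nk_summable (by linarith : 2 < 2 * s.re + 1)).mul_left _)
    (fun k => H m s k le_rfl)

lemma RT_diff {L : ℝ} (hL : 0 < L) (T : (ℝ × ℝ) ≃L[ℝ] (ℝ × ℝ)) (m : ℤ) :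
    DifferentiableOn ℂ (RT L T m) {s | 1/2 < s.re} := by
  intro s hs
  have hs' : 1/2 < s.re := hs
  set σ0 := (s.re + 1/2)/2 with hσ0
  obtain ⟨C, hC, H⟩ := Gk_bound hL T (σ0 := σ0) (by linarith)
  have ho : IsOpen ({z : ℂ | σ0 < z.re} ∩ Metric.ball 0 (‖s‖ + 1)) :=
    (isOpen_lt continuous_const Complex.continuous_re).inter Metric.isOpen_ball
  have hmem : s ∈ ({z : ℂ | σ0 < z.re} ∩ Metric.ball 0 (‖s‖ + 1)) := by
    refine ⟨?_, by simp⟩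
    show σ0 < s.re
    linarith
  have := differentiableOn_tsum_of_summable_norm
    (u := fun k => C * (1 + (‖s‖+1) + |(m:ℝ)|) * nk k ^ (-(2 * σ0 + 1)))
    (F := fun k => Gk L T m k)
    ((nk_summable (by linarith : 2 < 2 * σ0 + 1)).mul_left _)
    (fun k z hz => (Gk_diff L T m k (by have : σ0 < z.re := hz.1; linarith)).differentiableWithinAt)
    ho ?_
  · exact ((this s hmem).differentiableAt (ho.mem_nhds hmem)).differentiableWithinAt
  · intro k z hz
    have h1 : σ0 < z.re := hz.1
    have h2 : ‖z‖ < ‖s‖ + 1 := by simpa using hz.2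
    refine (H m z k h1.le).trans ?_
    have := nk_pos k
    gcongr

lemma RT_bound {L : ℝ} (hL : 0 < L) (T : (ℝ × ℝ) ≃L[ℝ] (ℝ × ℝ)) : ∃ C : ℝ, 0 < C ∧
    ∀ (m : ℤ) (s : ℂ), 3/4 ≤ s.re → s.re ≤ 3 → ‖RT L T m s‖ ≤ C * (1 + |s.im| + |(m:ℝ)|) := by
  obtain ⟨C, hC, H⟩ := Gk_bound hL T (σ0 := 3/4) (by norm_num)
  have hsum := nk_summable (by norm_num : (2:ℝ) < 2 * (3/4) + 1)
  set S := ∑' k, nk k ^ (-(2 * (3/4 : ℝ) + 1)) with hS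
  have hS0 : 0 ≤ S := tsum_nonneg fun k => by have := nk_pos k; positivity
  refine ⟨4 * C * (S + 1), by positivity, fun m s h1 h2 => ?_⟩
  have := tsum_of_norm_bounded ((hsum.hasSum).mul_left (C * (1 + ‖s‖ + |(m:ℝ)|))) (fun k => H m s k h1)
  refine this.trans ?_
  have h3 : ‖s‖ ≤ 3 + |s.im| := by
    refine (Complex.norm_le_abs_re_add_abs_im s).trans ?_
    rw [abs_of_nonneg (by linarith)]; linarith
  have h4 : 1 + ‖s‖ + |(m:ℝ)| ≤ 4 * (1 + |s.im| + |(m:ℝ)|) := by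
    linarith [abs_nonneg s.im, abs_nonneg (m:ℝ)]
  calc _ ≤ C * (4 * (1 + |s.im| + |(m:ℝ)|)) * (S + 1) := by
        rw [← hS]
        gcongr
        linarith
    _ = _ := by ring

lemma gT_integrable {L : ℝ} (hL : 0 < L) (T : (ℝ × ℝ) ≃L[ℝ] (ℝ × ℝ)) (m : ℤ) {s : ℂ}
    (hs : 1 < s.re) : Integrable fun p => gL L m s (T p) := by
  obtain ⟨C, hC, H⟩ := gT_bound hL T (σ0 := s.re) (by linarith)
  rw [← integrableOn_univ, ← cell_union]
  refine integrableOn_iUnion_of_summable_integral_norm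
    (fun k => gT_int L m (by linarith) T k) ?_
  refine ((nk_summable (by linarith : 2 < 2 * s.re)).mul_left C).of_nonneg_of_le
    (fun k => by positivity) (fun k => ?_)
  have := norm_setIntegral_le_of_norm_le_const (μ := volume) (s := cell k)
    (f := fun p => ‖gL L m s (T p)‖) (C := C * nk k ^ (-(2 * s.re))) (by rw [cell_vol]; simp)
    (fun p hp => by simpa using H m s k p le_rfl (cell_norm hp))
  refine (le_abs_self _).trans ?_
  simpa [Measure.real, cell_vol] using this

lemma gT_sum {L : ℝ} (hL : 0 < L) (T : (ℝ × ℝ) ≃L[ℝ] (ℝ × ℝ)) (m : ℤ) {s : ℂ}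
    (hs : 1 < s.re) : HasSum (fun k => gL L m s (T (kc k))) ((∫ p, gL L m s (T p)) + RT L T m s) := by
  have h1 := hasSum_integral_iUnion (μ := volume) (f := fun p => gL L m s (T p)) cell_meas cell_disj
    (by rw [cell_union]; exact (gT_integrable hL T m hs).integrableOn)
  rw [cell_union, setIntegral_univ] at h1
  have h2 := (Gk_summable hL T m (by linarith : 1/2 < s.re)).hasSum
  have := h1.add h2
  refine this.congr_fun (fun k => ?_)
  simp [Gk]

end PE2

section PE3
open MeasureTheory Filter Topology Set Complex

lemma cabs_int {f : ℝ → ℂ} : ∫ x, f |x| = 2 * ∫ x in Ioi (0 : ℝ), f x := by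
  have eq : ∫ (x : ℝ) in Ioi 0, f |x| = ∫ (x : ℝ) in Ioi 0, f x := by
    refine setIntegral_congr_fun measurableSet_Ioi (fun _ hx => ?_)
    rw [abs_eq_self.mpr (le_of_lt (by exact hx))]
  by_cases hf : IntegrableOn (fun x => f |x|) (Ioi 0)
  · have int_Iic : IntegrableOn (fun x ↦ f |x|) (Iic 0) := by
      rw [← Measure.map_neg_eq_self (volume : Measure ℝ)]
      let m : MeasurableEmbedding fun x : ℝ => -x := (Homeomorph.neg ℝ).measurableEmbedding
      rw [m.integrableOn_map_iff]
      simp_rw [Function.comp_def, abs_neg, neg_preimage, neg_Iic, neg_zero]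
      exact Iff.mpr integrableOn_Ici_iff_integrableOn_Ioi hf
    calc
      _ = (∫ x in Iic 0, f |x|) + ∫ x in Ioi 0, f |x| := by
        rw [← setIntegral_union (Iic_disjoint_Ioi le_rfl) measurableSet_Ioi int_Iic hf,
          Iic_union_Ioi, Measure.restrict_univ]
      _ = 2 * ∫ x in Ioi 0, f x := by
        rw [two_mul, eq]
        congr! 1
        rw [← neg_zero, ← integral_comp_neg_Iic, neg_zero]
        refine setIntegral_congr_fun measurableSet_Iic (fun _ hx => ?_)
        rw [abs_eq_neg_self.mpr (by exact hx)]
  · have : ¬ Integrable (fun x => f |x|) := by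
      contrapose hf
      exact hf.integrableOn
    rw [← eq, integral_undef hf, integral_undef this, mul_zero]

lemma exp_int (g : ℝ → ℂ) : ∫ y in Ioi (0:ℝ), g y = ∫ x : ℝ, Real.exp x • g (Real.exp x) := by
  have := integral_image_eq_integral_abs_deriv_smul (s := univ) MeasurableSet.univ
    (fun x _ => (Real.hasDerivAt_exp x).hasDerivWithinAt) (Real.exp_injective.injOn) g
  rw [image_univ, Real.range_exp, setIntegral_univ] at this
  rw [this]
  congr 1; ext x; rw [abs_of_pos (Real.exp_pos _)]

lemma even_int {f : ℝ → ℂ} (h : ∀ x, f |x| = f x) :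
    ∫ x, f x = 2 * ∫ x : ℝ, Real.exp x • f (Real.exp x) := by
  rw [← exp_int, ← cabs_int]
  simp_rw [h]

lemma gL_abs1 (L m s) (u v : ℝ) : gL L m s (|u|, v) = gL L m s (u, v) := by
  unfold gL gth; simp [abs_mul]
lemma gL_abs2 (L m s) (u v : ℝ) : gL L m s (u, |v|) = gL L m s (u, v) := by
  unfold gL gth; simp [abs_mul]

/-- the step function `1[P ≥ 0] e^{-(s-1)P}` -/
noncomputable def stE (s : ℂ) (P : ℝ) : ℂ := (Ici (0:ℝ)).indicator (fun P => cexp ((1 - s) * P)) P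

noncomputable def wD (L : ℝ) (m : ℤ) (D : ℝ) : ℂ := (tent (D / (2*L)) : ℂ) * pch m (D / (2*L))

lemma gL_exp (L : ℝ) (m s) (X Y : ℝ) :
    Real.exp X • (Real.exp Y • gL L m s (Real.exp X, Real.exp Y)) =
      wD L m (X - Y) * stE s (X + Y) := by
  unfold gL stE wD gth pe
  simp only [Real.log_exp]
  rw [← Real.exp_add, abs_of_pos (Real.exp_pos _), Real.log_exp]
  by_cases h : 0 ≤ X + Y
  · rw [if_pos (Real.one_le_exp h), indicator_of_mem (by exact h)]
    have : cexp ((1 - s) * ((X + Y : ℝ):ℂ)) =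
      (Real.exp X : ℂ) * (Real.exp Y : ℂ) * cexp (-s * ((X + Y : ℝ):ℂ)) := by
      rw [Complex.ofReal_exp, Complex.ofReal_exp, ← Complex.exp_add, ← Complex.exp_add]
      congr 1; push_cast; ring
    rw [this]
    simp only [Complex.real_smul]
    ring
  · rw [if_neg (by rw [Real.one_le_exp_iff]; exact h), indicator_of_notMem (by exact h)]
    simp

lemma stE_int {s : ℂ} (hs : 1 < s.re) : Integrable (stE s) ∧ ∫ P, stE s P = 1 / (s - 1) := by
  unfold stE
  have hne : s - 1 ≠ 0 := by
    intro h; have := congrArg Complex.re h; simp at this; linarith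
  have hre : (1 - s).re < 0 := by simp; linarith
  constructor
  · rw [integrable_indicator_iff measurableSet_Ici, integrableOn_Ici_iff_integrableOn_Ioi]
    exact integrableOn_exp_mul_complex_Ioi hre 0
  · rw [integral_indicator measurableSet_Ici, integral_Ici_eq_integral_Ioi,
      integral_exp_mul_complex_Ioi hre 0]
    have : (1 - s) ≠ 0 := by intro h; apply hne; linear_combination -h
    simp
    field_simp
    ring

lemma stE_meas (s) : Measurable (stE s) := by
  unfold stE
  exact Measurable.indicator (by fun_prop) measurableSet_Ici

lemma wD_cont (L m) : Continuous (wD L m) := by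
  unfold wD pch
  have := tent_cont
  fun_prop

lemma tent_supp {y : ℝ} (h : y ∉ Ioc (-1:ℝ) 1) : tent y = 0 := by
  unfold tent
  apply max_eq_left
  by_contra hh
  apply h
  have : |y| < 1 := by linarith
  rw [abs_lt] at this
  exact ⟨this.1, this.2.le⟩

lemma wD_int {L : ℝ} (hL : 0 < L) (m) : Integrable (wD L m) := by
  apply (wD_cont L m).integrable_of_hasCompactSupport
  apply HasCompactSupport.intro (K := Icc (-(2*L)) (2*L)) isCompact_Icc
  intro x hx
  unfold wD
  rw [tent_supp, Complex.ofReal_zero, zero_mul]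
  rintro ⟨h1, h2⟩
  apply hx
  rw [lt_div_iff₀ (by linarith)] at h1
  rw [div_le_iff₀ (by linarith)] at h2
  exact ⟨by linarith, by linarith⟩

lemma pch_int (m : ℤ) : ∫ y in (0:ℝ)..1, pch m y = if m = 0 then 1 else 0 := by
  unfold pch
  split_ifs with h
  · simp [h]
  · rw [integral_exp_mul_complex]
    · simp only [Complex.ofReal_one, mul_one, Complex.ofReal_zero, mul_zero, Complex.exp_zero]
      rw [show (2 * (Real.pi:ℂ) * I * m) = m * (2 * Real.pi * I) by ring,
        Complex.exp_int_mul_two_pi_mul_I]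
      simp
    · simp [h, Real.pi_ne_zero]

lemma pch_sub_one (m : ℤ) (y : ℝ) : pch m (y - 1) = pch m y := by
  unfold pch
  rw [show (2 * (Real.pi:ℂ) * I * m * ((y - 1 : ℝ) : ℂ)) =
    2 * Real.pi * I * m * y - m * (2 * Real.pi * I) by push_cast; ring]
  exact Complex.exp_periodic.sub_int_mul_eq m

lemma tent_int (m : ℤ) : ∫ y, (tent y : ℂ) * pch m y = if m = 0 then 1 else 0 := by
  have hc : Continuous fun y : ℝ => (tent y : ℂ) * pch m y := by
    unfold pch; have := tent_cont; fun_prop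
  have hc2 : Continuous fun y : ℝ => pch m y := by unfold pch; fun_prop
  have h1 : ∫ y, (tent y : ℂ) * pch m y = ∫ y in (-1:ℝ)..1, (tent y : ℂ) * pch m y := by
    rw [intervalIntegral.integral_of_le (by norm_num)]
    symm
    apply setIntegral_eq_integral_of_forall_compl_eq_zero
    intro y hy
    rw [tent_supp hy]; simp
  rw [h1, ← intervalIntegral.integral_add_adjacent_intervals (b := 0)
    (hc.intervalIntegrable _ _) (hc.intervalIntegrable _ _)]
  have h2 : ∫ y in (-1:ℝ)..0, (tent y : ℂ) * pch m y = ∫ y in (0:ℝ)..1, (y:ℂ) * pch m y := by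
    have := intervalIntegral.integral_comp_sub_right (a := 0) (b := 1)
      (fun y : ℝ => (tent y : ℂ) * pch m y) 1
    rw [show (0:ℝ) - 1 = -1 by norm_num, show (1:ℝ) - 1 = 0 by norm_num] at this
    rw [← this]
    apply intervalIntegral.integral_congr
    intro y hy
    rw [uIcc_of_le (by norm_num)] at hy
    simp only [pch_sub_one]
    congr 2
    unfold tent
    rw [abs_of_nonpos (by linarith [hy.2]), max_eq_right (by linarith [hy.1])]
    ring
  have h3 : ∫ y in (0:ℝ)..1, (tent y : ℂ) * pch m y = ∫ y in (0:ℝ)..1, (1 - (y:ℂ)) * pch m y := by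
    apply intervalIntegral.integral_congr
    intro y hy
    rw [uIcc_of_le (by norm_num)] at hy
    simp only
    congr 1
    unfold tent
    rw [abs_of_nonneg (by linarith [hy.1]), max_eq_right (by linarith [hy.2])]
    push_cast; ring
  rw [h2, h3, ← intervalIntegral.integral_add, ← pch_int m]
  · congr 1; ext y; ring
  · exact Continuous.intervalIntegrable (by fun_prop) _ _
  · exact Continuous.intervalIntegrable (by fun_prop) _ _

lemma wD_integral {L : ℝ} (hL : 0 < L) (m) : ∫ D, wD L m D = if m = 0 then 2 * (L:ℂ) else 0 := by
  unfold wD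
  have := Measure.integral_comp_div (fun y : ℝ => (tent y : ℂ) * pch m y) (2*L)
  rw [this, tent_int, abs_of_pos (by linarith)]
  split_ifs <;> simp

lemma shear_int {s : ℂ} (hs : 1 < s.re) (D : ℝ) :
    Integrable (fun X : ℝ => stE s (2 * X - D)) ∧ ∫ X : ℝ, stE s (2 * X - D) = 1 / (2 * (s - 1)) := by
  obtain ⟨h1, h2⟩ := stE_int hs
  have h3 := h1.comp_sub_right D
  refine ⟨h3.comp_mul_left' (by norm_num), ?_⟩
  have := Measure.integral_comp_mul_left (fun X => stE s (X - D)) 2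
  rw [this, integral_sub_right_eq_self, h2]
  have hne : s - 1 ≠ 0 := by
    intro h; have := congrArg Complex.re h; simp at this; linarith
  simp
  field_simp

lemma gL_integral {L : ℝ} (hL : 0 < L) (m : ℤ) {s : ℂ} (hs : 1 < s.re) :
    ∫ p, gL L m s p = if m = 0 then 4 * (L:ℂ) / (s - 1) else 0 := by
  have hinteg := gT_integrable hL (ContinuousLinearEquiv.refl ℝ (ℝ × ℝ)) m hs
  simp only [ContinuousLinearEquiv.coe_refl', id] at hinteg
  have step1 : ∫ p, gL L m s p = ∫ u : ℝ, ∫ v : ℝ, gL L m s (u, v) := integral_prod _ hinteg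
  rw [step1, even_int (f := fun u => ∫ v : ℝ, gL L m s (u, v)) (fun u => by simp_rw [gL_abs1])]
  have step2 : ∀ X : ℝ, Real.exp X • ∫ v : ℝ, gL L m s (Real.exp X, v) =
      2 * ∫ D : ℝ, wD L m D * stE s (2 * X - D) := by
    intro X
    rw [even_int (f := fun v => gL L m s (Real.exp X, v)) (fun v => gL_abs2 _ _ _ _ _)]
    rw [← integral_sub_left_eq_self (fun D => wD L m D * stE s (2 * X - D)) volume X]
    rw [← mul_smul_comm, ← integral_smul]
    congr 2; ext Y
    rw [gL_exp]
    congr 2; ring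
  simp_rw [step2]
  rw [integral_const_mul]
  have hprod : Integrable (Function.uncurry fun X D : ℝ => wD L m D * stE s (2 * X - D))
      (volume.prod volume) := by
    rw [integrable_prod_iff']
    · constructor
      · refine Eventually.of_forall fun D => ?_
        simp only [Function.uncurry]
        exact (shear_int hs D).1.const_mul _
      · simp only [Function.uncurry, norm_mul]
        simp_rw [integral_const_mul]
        have : ∀ D : ℝ, ∫ X : ℝ, ‖stE s (2 * X - D)‖ = ∫ X : ℝ, ‖stE s (2 * X)‖ := by
          intro D
          rw [← integral_sub_right_eq_self (fun X : ℝ => ‖stE s (2 * X)‖) (D/2)]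
          congr 1; ext X; congr 2; ring
        simp_rw [this]
        exact (wD_int hL m).norm.mul_const _
    · apply Measurable.aestronglyMeasurable
      have h1 := stE_meas s
      have h2 := (wD_cont L m).measurable
      simp only [Function.uncurry_def]
      fun_prop
  rw [integral_integral_swap hprod]
  simp_rw [integral_const_mul, (shear_int hs _).2]
  rw [integral_mul_const, wD_integral hL]
  have hne : s - 1 ≠ 0 := by
    intro h; have := congrArg Complex.re h; simp at this; linarith
  split_ifs
  · field_simp
    ring
  · simp

lemma T_integral (T : (ℝ × ℝ) ≃L[ℝ] (ℝ × ℝ)) : ∃ c : ℝ, 0 < c ∧ ∀ f : ℝ × ℝ → ℂ,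
    ∫ p, f (T p) = (c:ℂ) * ∫ p, f p := by
  have hdet : LinearMap.det (T.toLinearEquiv : (ℝ × ℝ) →ₗ[ℝ] (ℝ × ℝ)) ≠ 0 :=
    (LinearEquiv.isUnit_det' T.toLinearEquiv).ne_zero
  refine ⟨|(LinearMap.det (T.toLinearEquiv : (ℝ × ℝ) →ₗ[ℝ] (ℝ × ℝ)))⁻¹|, by positivity, fun f => ?_⟩
  have h := Measure.map_linearMap_addHaar_eq_smul_addHaar (volume : Measure (ℝ × ℝ)) hdet
  have h2 := integral_map_equiv (μ := (volume : Measure (ℝ × ℝ))) T.toHomeomorph.toMeasurableEquiv f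
  have h3 : Measure.map (T.toHomeomorph.toMeasurableEquiv) (volume : Measure (ℝ × ℝ)) =
    Measure.map (T.toLinearEquiv : (ℝ × ℝ) →ₗ[ℝ] (ℝ × ℝ)) volume := rfl
  rw [h3, h, integral_smul_measure] at h2
  rw [ENNReal.toReal_ofReal (abs_nonneg _)] at h2
  rw [← Complex.real_smul, h2]
  rfl

theorem lat_main {L : ℝ} (hL : 0 < L) (T : (ℝ × ℝ) ≃L[ℝ] (ℝ × ℝ)) :
    ∃ (κ K0 : ℝ) (R : ℤ → ℂ → ℂ), 0 < κ ∧ 0 < K0 ∧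
      (∀ m, DifferentiableOn ℂ (R m) {s | 1/2 < s.re}) ∧
      (∀ (m : ℤ) (s : ℂ), 3/4 ≤ s.re → s.re ≤ 3 → ‖R m s‖ ≤ K0 * (1 + |s.im| + |(m:ℝ)|)) ∧
      ∀ (m : ℤ) (s : ℂ), 1 < s.re → HasSum (fun k => gL L m s (T (kc k)))
        (2 * ((if m = 0 then (κ:ℂ) / (s - 1) else 0) + R m s)) := by
  obtain ⟨c, hc, hT⟩ := T_integral T
  obtain ⟨C, hC, hb⟩ := RT_bound hL T
  refine ⟨2 * c * L, C, fun m s => 1/2 * RT L T m s, by positivity, hC, ?_, ?_, ?_⟩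
  · intro m
    exact (RT_diff hL T m).const_mul _
  · intro m s h1 h2
    rw [norm_mul]
    have := hb m s h1 h2
    have h3 : ‖(1/2 : ℂ)‖ = 1/2 := by norm_num
    rw [h3]
    nlinarith [norm_nonneg (RT L T m s)]
  · intro m s hs
    have := gT_sum hL T m hs
    rw [hT, gL_integral hL m hs] at this
    convert this using 1
    split_ifs
    · push_cast; ring
    · ring

end PE3

section PF1
set_option linter.unusedSectionVars false
open Filter Topology Set Complex UniqueFactorizationMonoid

/-! Generic Dirichlet series -/

lemma dir_log {ι : Type} (a : ι → ℝ) (Q : ι → ℝ) (hQ : ∀ i, 0 ≤ Real.log (Q i)) (ha : ∀ i, 0 ≤ a i)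
    (h : ∀ σ : ℝ, 1 < σ → Summable fun i => a i * Real.exp (-σ * Real.log (Q i))) :
    ∀ σ : ℝ, 1 < σ → Summable fun i => a i * Real.log (Q i) * Real.exp (-σ * Real.log (Q i)) := by
  intro σ hσ
  set η := (σ - 1)/2 with hη
  have hη0 : 0 < η := by rw [hη]; linarith
  refine ((h (σ - η) (by rw [hη]; linarith)).mul_left (1/η)).of_nonneg_of_le ?_ ?_
  · intro i
    have := hQ i
    have := ha i
    positivity
  · intro i
    have hl := hQ i
    set l := Real.log (Q i)
    have h1 : l * η ≤ Real.exp (η * l) := by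
      have := Real.add_one_le_exp (η * l); linarith
    have h2 : Real.exp (-(σ - η) * l) = Real.exp (η * l) * Real.exp (-σ * l) := by
      rw [← Real.exp_add]; congr 1; ring
    rw [h2, div_mul_eq_mul_div, one_mul, le_div_iff₀ hη0]
    have := ha i
    have h3 := mul_le_mul_of_nonneg_left h1 (mul_nonneg this (Real.exp_nonneg (-σ * l)))
    linarith

lemma pe_hasDeriv (Q : ℝ) (s : ℂ) :
    HasDerivAt (pe Q) (-(Real.log Q : ℂ) * pe Q s) s := by
  unfold pe
  have : HasDerivAt (fun s : ℂ => -s * (Real.log Q : ℂ)) (-(Real.log Q : ℂ)) s := by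
    simpa using ((hasDerivAt_id s).neg.mul_const (Real.log Q : ℂ))
  exact this.cexp.congr_deriv (by ring)

lemma dir_deriv {ι : Type} (a : ι → ℂ) (Q : ι → ℝ) (hQ : ∀ i, 0 ≤ Real.log (Q i))
    (h : ∀ σ : ℝ, 1 < σ → Summable fun i => ‖a i‖ * Real.exp (-σ * Real.log (Q i)))
    {s : ℂ} (hs : 1 < s.re) :
    HasDerivAt (fun s => ∑' i, a i * pe (Q i) s)
      (-∑' i, (a i * (Real.log (Q i) : ℂ)) * pe (Q i) s) s := by
  set σ0 := (1 + s.re)/2 with hσ0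
  have ho : IsOpen {z : ℂ | σ0 < z.re} := isOpen_lt continuous_const Complex.continuous_re
  have hmem : s ∈ {z : ℂ | σ0 < z.re} := by show σ0 < s.re; rw [hσ0]; linarith
  have hd : ∀ i, DifferentiableOn ℂ (fun s => a i * pe (Q i) s) {z : ℂ | σ0 < z.re} := fun i z _ =>
    ((pe_hasDeriv (Q i) z).const_mul (a i)).differentiableAt.differentiableWithinAt
  have hb : ∀ i, ∀ w ∈ {z : ℂ | σ0 < z.re}, ‖a i * pe (Q i) w‖ ≤
      ‖a i‖ * Real.exp (-σ0 * Real.log (Q i)) := by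
    intro i w hw
    rw [norm_mul, pe_norm]
    have hw' : σ0 < w.re := hw
    have := hQ i
    gcongr
  have h1 : 1 < σ0 := by rw [hσ0]; linarith
  have h2 := Complex.hasSum_deriv_of_summable_norm (h σ0 h1) hd ho hb hmem
  have h3 := (Complex.differentiableOn_tsum_of_summable_norm (h σ0 h1) hd ho hb).differentiableAt
    (ho.mem_nhds hmem)
  have h4 := h3.hasDerivAt
  rw [← h2.tsum_eq] at h4
  refine h4.congr_deriv ?_
  rw [← tsum_neg]
  congr 1; ext i
  rw [((pe_hasDeriv (Q i) s).const_mul (a i)).deriv]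
  ring

variable {R : Type} [CommRing R] [IsDedekindDomain R] [Module.Free ℤ R] [Module.Finite ℤ R]

noncomputable def qn (n : Ideal R) : ℝ := (Ideal.absNorm n : ℝ)

lemma qn_pos {n : Ideal R} (h : n ≠ ⊥) : 1 ≤ qn n := by
  unfold qn
  have : Ideal.absNorm n ≠ 0 := fun h' => h (Ideal.absNorm_eq_zero_iff.1 h')
  exact_mod_cast Nat.one_le_iff_ne_zero.2 this

lemma qn_mul (a b : Ideal R) : qn (a * b) = qn a * qn b := by unfold qn; simp
lemma qn_pow (a : Ideal R) (n : ℕ) : qn (a ^ n) = qn a ^ n := by unfold qn; simp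
lemma qn_two {n : Ideal R} (h : n ≠ ⊥) (h' : n ≠ ⊤) : 2 ≤ qn n := by
  unfold qn
  have h1 : Ideal.absNorm n ≠ 0 := fun h'' => h (Ideal.absNorm_eq_zero_iff.1 h'')
  have h2 : Ideal.absNorm n ≠ 1 := fun h'' => h' (Ideal.absNorm_eq_one_iff.1 h'')
  exact_mod_cast (by omega : 2 ≤ Ideal.absNorm n)

abbrev PP (R : Type) [CommRing R] := {p : Ideal R // p ≠ ⊥ ∧ p.IsPrime}

lemma PP_prime (p : PP R) : Prime p.1 := Ideal.prime_of_isPrime p.2.1 p.2.2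
lemma PP_two (p : PP R) : 2 ≤ qn p.1 := qn_two p.2.1 p.2.2.ne_top
lemma PP_pow_ne (p : PP R) (j : ℕ) : p.1 ^ j ≠ ⊥ := pow_ne_zero _ (PP_prime p).ne_zero

lemma PP_inj : Function.Injective (fun i : PP R × ℕ => i.1.1 ^ (i.2 + 1)) := by
  rintro ⟨p, j⟩ ⟨p', j'⟩ h
  simp only at h
  have h1 : p = p' := Subtype.ext (eq_of_prime_pow_eq (PP_prime p) (PP_prime p') (Nat.succ_pos _) h)
  subst h1
  have h2 := congrArg qn h
  rw [qn_pow, qn_pow] at h2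
  have h3 := PP_two p
  have := (pow_right_injective₀ (by linarith : 0 < qn p.1) (by linarith)) h2
  simp at this
  rw [this]

lemma log_id {n : Ideal R} (hn : n ≠ ⊥) :
    HasSum (fun i : PP R × ℕ => if i.1.1 ^ (i.2 + 1) ∣ n then Real.log (qn i.1.1) else 0)
      (Real.log (qn n)) := by
  set f := fun i : PP R × ℕ => if i.1.1 ^ (i.2 + 1) ∣ n then Real.log (qn i.1.1) else 0 with hf
  have hf0 : 0 ≤ f := by
    intro i
    simp only [hf, Pi.zero_apply]
    split_ifs
    · exact Real.log_nonneg (by linarith [PP_two i.1])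
    · exact le_rfl
  have hdvd : ∀ (p : PP R) (j : ℕ), p.1 ^ (j + 1) ∣ n ↔ j < Multiset.count p.1 (normalizedFactors n) := by
    intro p j
    rw [pow_dvd_iff_le_emultiplicity,
      le_emultiplicity_iff_replicate_le_normalizedFactors (PP_prime p).irreducible hn,
      ← Multiset.le_count_iff_replicate_le, normalize_eq]
    rfl
  have h1 : ∀ p : PP R, HasSum (fun j => f (p, j))
      (Multiset.count p.1 (normalizedFactors n) • Real.log (qn p.1)) := by
    intro p
    have : ∀ j ∉ Finset.range (Multiset.count p.1 (normalizedFactors n)), f (p, j) = 0 := by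
      intro j hj
      simp only [hf, hdvd]
      rw [if_neg (by simpa using hj)]
    have h2 : HasSum (fun j => f (p, j)) (∑ j ∈ Finset.range (Multiset.count p.1 (normalizedFactors n)), f (p, j)) :=
      hasSum_sum_of_ne_finset_zero this
    convert h2 using 1
    rw [Finset.sum_congr rfl (g := fun _ => Real.log (qn p.1))]
    · simp
    · intro j hj
      simp only [hf, hdvd]
      rw [if_pos (by simpa using hj)]
  have h2 : HasSum (fun p : PP R => Multiset.count p.1 (normalizedFactors n) • Real.log (qn p.1))
      (Real.log (qn n)) := by
    have hs : Function.support (fun p : Ideal R =>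
        Multiset.count p (normalizedFactors n) • Real.log (qn p)) ⊆ {p | p ≠ ⊥ ∧ p.IsPrime} := by
      intro p hp
      have : p ∈ normalizedFactors n := by
        by_contra hh
        rw [Function.mem_support, Multiset.count_eq_zero_of_notMem hh] at hp
        simp at hp
      have hp' := prime_of_normalized_factor p this
      exact ⟨hp'.ne_zero, Ideal.isPrime_of_prime hp'⟩
    refine (hasSum_subtype_iff_of_support_subset hs).2 ?_
    have h3 : ∀ p ∉ (normalizedFactors n).toFinset,
        Multiset.count p (normalizedFactors n) • Real.log (qn p) = 0 := by
      intro p hp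
      rw [Multiset.count_eq_zero_of_notMem (by rwa [Multiset.mem_toFinset] at hp)]; simp
    have h5 : HasSum (fun p : Ideal R => Multiset.count p (normalizedFactors n) • Real.log (qn p))
        (∑ p ∈ (normalizedFactors n).toFinset, Multiset.count p (normalizedFactors n) • Real.log (qn p)) :=
      hasSum_sum_of_ne_finset_zero h3
    convert h5 using 1
    rw [← Finset.sum_multiset_map_count]
    conv_lhs => rw [← Ideal.prod_normalizedFactors_eq_self hn]
    unfold qn
    rw [map_multiset_prod, Nat.cast_multiset_prod, Real.log_multiset_prod, Multiset.map_map,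
      Multiset.map_map]
    · rfl
    · intro x hx
      simp only [Multiset.map_map, Multiset.mem_map] at hx
      obtain ⟨p, hp, rfl⟩ := hx
      have hp' := prime_of_normalized_factor p hp
      simp only [Function.comp]
      have := qn_pos (n := p) hp'.ne_zero
      unfold qn at this
      linarith
  have hsf : Summable f := by
    rw [summable_prod_of_nonneg hf0]
    refine ⟨fun p => (h1 p).summable, ?_⟩
    simp_rw [fun p => (h1 p).tsum_eq]
    exact h2.summable
  have h4 := hsf.hasSum
  rw [hsf.tsum_prod] at h4
  simp_rw [fun p => (h1 p).tsum_eq, h2.tsum_eq] at h4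
  exact h4

end PF1

section PF2
set_option linter.unusedSectionVars false
open Filter Topology Set Complex UniqueFactorizationMonoid

variable {R : Type} [CommRing R] [IsDedekindDomain R] [Module.Free ℤ R] [Module.Finite ℤ R]

noncomputable def zc (θ : Ideal R → ℝ) (m : ℤ) (n : Ideal R) : ℂ := if n = ⊥ then 0 else pch m (θ n)
noncomputable def zf (θ : Ideal R → ℝ) (m : ℤ) (s : ℂ) (n : Ideal R) : ℂ := zc θ m n * pe (qn n) s
noncomputable def Zf (θ : Ideal R → ℝ) (m : ℤ) (s : ℂ) : ℂ := ∑' n, zc θ m n * pe (qn n) s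

noncomputable def pw1 (i : PP R × ℕ) : Ideal R := i.1.1 ^ (i.2 + 1)
noncomputable def lgp (i : PP R × ℕ) : ℝ := Real.log (qn i.1.1)

noncomputable def Df (θ : Ideal R → ℝ) (m : ℤ) (s : ℂ) : ℂ :=
  ∑' i : PP R × ℕ, ((lgp i : ℂ) * pch m (θ (pw1 i))) * pe (qn (pw1 i)) s

lemma pw1_ne (i : PP R × ℕ) : pw1 i ≠ ⊥ := PP_pow_ne _ _
lemma lgp_pos (i : PP R × ℕ) : 0 < lgp i := Real.log_pos (by linarith [PP_two i.1])
lemma lqn (n : Ideal R) : 0 ≤ Real.log (qn n) := Real.log_natCast_nonneg _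
lemma qn_pw1 (i : PP R × ℕ) : Real.log (qn (pw1 i)) = (i.2 + 1) * lgp i := by
  unfold pw1 lgp; rw [qn_pow, Real.log_pow]; push_cast; ring
lemma lgp_le (i : PP R × ℕ) : lgp i ≤ Real.log (qn (pw1 i)) := by
  rw [qn_pw1]; nlinarith [lgp_pos i, (Nat.cast_nonneg i.2 : (0:ℝ) ≤ i.2)]

lemma zc_norm (θ : Ideal R → ℝ) (m n) : ‖zc θ m n‖ = if n = ⊥ then 0 else 1 := by
  unfold zc; split_ifs <;> simp [pch_norm]

lemma zf_norm (θ : Ideal R → ℝ) (m s n) :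
    ‖zf θ m s n‖ = (if n = ⊥ then 0 else 1) * Real.exp (-s.re * Real.log (qn n)) := by
  rw [zf, norm_mul, zc_norm, pe_norm]

lemma zf_mul {θ : Ideal R → ℝ} (hθ : ∀ (m:ℤ) (a b : Ideal R), a ≠ ⊥ → b ≠ ⊥ →
    pch m (θ (a*b)) = pch m (θ a) * pch m (θ b)) (m s) (a b : Ideal R) :
    zf θ m s (a * b) = zf θ m s a * zf θ m s b := by
  unfold zf zc
  by_cases ha : a = ⊥
  · simp [ha]
  by_cases hb : b = ⊥
  · simp [hb]
  have hab : a * b ≠ ⊥ := by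
    rw [← Ideal.zero_eq_bot] at ha hb ⊢
    exact mul_ne_zero ha hb
  rw [if_neg hab, if_neg ha, if_neg hb, hθ m a b ha hb]
  have h1 := qn_pos ha
  have h2 := qn_pos hb
  have : pe (qn (a * b)) s = pe (qn a) s * pe (qn b) s := by
    unfold pe
    rw [qn_mul, Real.log_mul (by linarith) (by linarith), ← Complex.exp_add]
    congr 1; push_cast; ring
  rw [this]; ring


lemma zf_summable (hsum : ∀ σ : ℝ, 1 < σ →
      Summable fun n : Ideal R => (if n = ⊥ then (0:ℝ) else 1) * Real.exp (-σ * Real.log (qn n)))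
    (θ : Ideal R → ℝ) (m) {s : ℂ} (hs : 1 < s.re) :
    Summable fun n => ‖zf θ m s n‖ := by
  simp_rw [zf_norm]; exact hsum _ hs

lemma d_summable (hsum : ∀ σ : ℝ, 1 < σ →
      Summable fun n : Ideal R => (if n = ⊥ then (0:ℝ) else 1) * Real.exp (-σ * Real.log (qn n)))
    {σ : ℝ} (hσ : 1 < σ) :
    Summable fun i : PP R × ℕ => lgp i * Real.exp (-σ * Real.log (qn (pw1 i))) := by
  have h1 := dir_log _ (fun n : Ideal R => qn n) lqn
    (fun n => by split_ifs <;> norm_num) hsum σ hσ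
  have h2 := h1.comp_injective (i := pw1) PP_inj
  refine h2.of_nonneg_of_le (fun i => by have := lgp_pos i; positivity) (fun i => ?_)
  simp only [Function.comp]
  rw [if_neg (pw1_ne i), one_mul]
  exact mul_le_mul_of_nonneg_right (lgp_le i) (Real.exp_nonneg _)

lemma zd_identity (hsum : ∀ σ : ℝ, 1 < σ →
      Summable fun n : Ideal R => (if n = ⊥ then (0:ℝ) else 1) * Real.exp (-σ * Real.log (qn n)))
    {θ : Ideal R → ℝ} (hθ : ∀ (m:ℤ) (a b : Ideal R), a ≠ ⊥ → b ≠ ⊥ →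
    pch m (θ (a*b)) = pch m (θ a) * pch m (θ b)) (m : ℤ) {s : ℂ} (hs : 1 < s.re) :
    ∑' n, (zc θ m n * (Real.log (qn n) : ℂ)) * pe (qn n) s = Df θ m s * Zf θ m s := by
  have hz := zf_summable hsum θ m hs
  set F : PP R × ℕ → Ideal R → ℂ := fun i n => if pw1 i ∣ n then (lgp i : ℂ) * zf θ m s n else 0
    with hF
  have hinj : ∀ i : PP R × ℕ, Function.Injective (fun n : Ideal R => pw1 i * n) := fun i =>
    mul_right_injective₀ (pw1_ne i)
  have hval : ∀ i n, F i (pw1 i * n) = ((lgp i : ℂ) * zf θ m s (pw1 i)) * zf θ m s n := by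
    intro i n
    simp only [hF, dvd_mul_right, if_true, zf_mul hθ]
    ring
  have hsupp : ∀ i, Function.support (F i) ⊆ range (fun n : Ideal R => pw1 i * n) := by
    intro i n hn
    by_contra hh
    apply hn
    simp only [hF]
    rw [if_neg]
    rintro ⟨c, rfl⟩
    exact hh ⟨c, rfl⟩
  have h1 : ∀ i, ∑' n, F i n = ((lgp i : ℂ) * zf θ m s (pw1 i)) * Zf θ m s := by
    intro i
    rw [← (hinj i).tsum_eq (hsupp i)]
    simp_rw [hval]
    rw [tsum_mul_left]; rfl
  have h2 : ∀ i, ∑' n, ‖F i n‖ = ‖(lgp i : ℂ) * zf θ m s (pw1 i)‖ * ∑' n, ‖zf θ m s n‖ := by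
    intro i
    rw [← (hinj i).tsum_eq (f := fun n => ‖F i n‖)]
    · simp_rw [hval, norm_mul]
      rw [tsum_mul_left]
    · refine Subset.trans ?_ (hsupp i)
      intro n hn
      simpa using hn
  have hg : Summable fun i : PP R × ℕ => ‖(lgp i : ℂ) * zf θ m s (pw1 i)‖ := by
    refine (d_summable hsum hs).congr (fun i => ?_)
    rw [norm_mul, zf_norm, if_neg (pw1_ne i), one_mul, Complex.norm_real, Real.norm_eq_abs,
      abs_of_pos (lgp_pos i)]
  have hS : Summable (Function.uncurry F) := by
    apply Summable.of_norm
    rw [summable_prod_of_nonneg (fun _ => norm_nonneg _)]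
    constructor
    · intro i
      refine (hz.mul_left (lgp i)).of_nonneg_of_le (fun _ => norm_nonneg _) (fun n => ?_)
      simp only [Function.uncurry, hF]
      split_ifs
      · rw [norm_mul, Complex.norm_real, Real.norm_eq_abs, abs_of_pos (lgp_pos i)]
      · rw [norm_zero]; have := lgp_pos i; positivity
    · simp only [Function.uncurry]
      simp_rw [h2]
      exact hg.mul_right _
  have h3 := hS.tsum_comm
  have h4 : ∀ n, ∑' i, F i n = (zc θ m n * (Real.log (qn n) : ℂ)) * pe (qn n) s := by
    intro n
    by_cases hn : n = ⊥
    · simp [hF, zf, zc, hn]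
    · have h5 := (((Complex.ofRealCLM.hasSum (log_id hn)).mul_right (zf θ m s n))).tsum_eq
      have h6 : (zc θ m n * (Real.log (qn n) : ℂ)) * pe (qn n) s =
        Complex.ofRealCLM (Real.log (qn n)) * zf θ m s n := by
        simp only [zf, Complex.ofRealCLM_apply]; ring
      rw [h6, ← h5]
      congr 1; ext i
      simp only [hF]
      by_cases h : i.1.1 ^ (i.2 + 1) ∣ n
      · have h' : pw1 i ∣ n := h
        rw [if_pos h, if_pos h', Complex.ofRealCLM_apply]; rfl
      · have h' : ¬ pw1 i ∣ n := h
        rw [if_neg h, if_neg h', map_zero, zero_mul]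
  simp_rw [h4, h1] at h3
  rw [h3, tsum_mul_right]
  congr 1
  unfold Df
  congr 1; ext i
  rw [zf, zc, if_neg (pw1_ne i)]; ring

lemma Zf_deriv (hsum : ∀ σ : ℝ, 1 < σ →
      Summable fun n : Ideal R => (if n = ⊥ then (0:ℝ) else 1) * Real.exp (-σ * Real.log (qn n)))
    {θ : Ideal R → ℝ} (hθ : ∀ (m:ℤ) (a b : Ideal R), a ≠ ⊥ → b ≠ ⊥ →
    pch m (θ (a*b)) = pch m (θ a) * pch m (θ b)) (m : ℤ) {s : ℂ} (hs : 1 < s.re) :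
    HasDerivAt (Zf θ m) (-(Df θ m s * Zf θ m s)) s := by
  rw [← zd_identity hsum hθ m hs]
  apply dir_deriv _ _ lqn _ hs
  intro σ hσ
  simp_rw [zc_norm]
  exact hsum σ hσ

lemma Df_deriv (hsum : ∀ σ : ℝ, 1 < σ →
      Summable fun n : Ideal R => (if n = ⊥ then (0:ℝ) else 1) * Real.exp (-σ * Real.log (qn n)))
    (θ : Ideal R → ℝ) (m : ℤ) {s : ℂ} (hs : 1 < s.re) :
    HasDerivAt (Df θ m) (-∑' i : PP R × ℕ,
      (((lgp i * Real.log (qn (pw1 i)) : ℝ) : ℂ) * pch m (θ (pw1 i))) * pe (qn (pw1 i)) s) s := by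
  have := dir_deriv (fun i : PP R × ℕ => (lgp i : ℂ) * pch m (θ (pw1 i))) (fun i => qn (pw1 i))
    (fun i => lqn _) ?_ hs
  · refine this.congr_deriv ?_
    congr 2; ext i; push_cast; ring
  · intro σ hσ
    refine (d_summable hsum hσ).congr (fun i => ?_)
    rw [norm_mul, pch_norm, mul_one, Complex.norm_real, Real.norm_eq_abs, abs_of_pos (lgp_pos i)]

lemma D_341 (hsum : ∀ σ : ℝ, 1 < σ →
      Summable fun n : Ideal R => (if n = ⊥ then (0:ℝ) else 1) * Real.exp (-σ * Real.log (qn n)))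
    (θ : Ideal R → ℝ) (m : ℤ) (σ t : ℝ) (hσ : 1 < σ) :
    0 ≤ (3 * Df θ 0 σ + 4 * Df θ m (σ + t * I) + Df θ (2 * m) (σ + 2 * t * I)).re := by
  have hs : ∀ (m : ℤ) (s : ℂ), s.re = σ → Summable fun i : PP R × ℕ =>
      ((lgp i : ℂ) * pch m (θ (pw1 i))) * pe (qn (pw1 i)) s := by
    intro m s hs
    apply Summable.of_norm
    refine (d_summable hsum hσ).congr (fun i => ?_)
    rw [norm_mul, norm_mul, pch_norm, mul_one, Complex.norm_real, Real.norm_eq_abs,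
      abs_of_pos (lgp_pos i), pe_norm, hs]
  have h1 := (hs 0 σ (by simp)).mul_left 3
  have h2 := (hs m (σ + t * I) (by simp)).mul_left 4
  have h3 := (hs (2 * m) (σ + 2 * t * I) (by simp))
  unfold Df
  rw [← tsum_mul_left, ← tsum_mul_left, ← h1.tsum_add h2, ← (h1.add h2).tsum_add h3, Complex.re_tsum ((h1.add h2).add h3)]
  apply tsum_nonneg
  intro i
  set Q := qn (pw1 i)
  set w : ℂ := cexp (((2 * Real.pi * m * θ (pw1 i) - t * Real.log Q : ℝ) : ℂ) * I) with hw
  have e0 : pe Q σ = (Real.exp (-σ * Real.log Q) : ℂ) := by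
    unfold pe; push_cast; rfl
  have e1 : pch m (θ (pw1 i)) * pe Q (σ + t * I) = (Real.exp (-σ * Real.log Q) : ℂ) * w := by
    unfold pch pe; rw [hw]; push_cast; rw [← Complex.exp_add, ← Complex.exp_add]; congr 1; ring
  have e2 : pch (2*m) (θ (pw1 i)) * pe Q (σ + 2 * t * I) = (Real.exp (-σ * Real.log Q) : ℂ) * w ^ 2 := by
    unfold pch pe; rw [hw, ← Complex.exp_nat_mul]; push_cast
    rw [← Complex.exp_add, ← Complex.exp_add]; congr 1; ring
  have e3 : pch 0 (θ (pw1 i)) = 1 := by unfold pch; simp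
  have e4 : 3 * ((lgp i : ℂ) * pch 0 (θ (pw1 i)) * pe Q σ) +
      4 * ((lgp i : ℂ) * pch m (θ (pw1 i)) * pe Q (σ + t * I)) +
      (lgp i : ℂ) * pch (2 * m) (θ (pw1 i)) * pe Q (σ + 2 * t * I) =
      ((lgp i * Real.exp (-σ * Real.log Q) : ℝ) : ℂ) * (3 + 4 * w + w ^ 2) := by
    rw [e3, e0]
    push_cast at e1 e2 ⊢
    linear_combination (4 * (lgp i : ℂ)) * e1 + (lgp i : ℂ) * e2
  rw [e4, Complex.re_ofReal_mul]
  apply mul_nonneg (mul_nonneg (lgp_pos i).le (Real.exp_nonneg _))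
  have hn : w.re ^ 2 + w.im ^ 2 = 1 := by
    have h : ‖w‖ = 1 := by rw [hw]; exact Complex.norm_exp_ofReal_mul_I _
    have := Complex.sq_norm w
    rw [h, Complex.normSq_apply] at this
    linarith
  have : (3 + 4 * w + w ^ 2).re = 3 + 4 * w.re + (w.re ^ 2 - w.im ^ 2) := by
    simp [pow_two, Complex.mul_re]
  rw [this]
  nlinarith [sq_nonneg (w.re + 1)]

lemma Zf_lim (hsum : ∀ σ : ℝ, 1 < σ →
      Summable fun n : Ideal R => (if n = ⊥ then (0:ℝ) else 1) * Real.exp (-σ * Real.log (qn n)))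
    {θ : Ideal R → ℝ} (hθ : ∀ (m:ℤ) (a b : Ideal R), a ≠ ⊥ → b ≠ ⊥ →
    pch m (θ (a*b)) = pch m (θ a) * pch m (θ b)) (m : ℤ) (t : ℝ) :
    Tendsto (fun σ : ℝ => Zf θ m (σ + t * I)) atTop (𝓝 1) := by
  have key := tendsto_tsum_of_dominated_convergence (𝓕 := atTop)
    (f := fun (σ : ℝ) (n : Ideal R) => zf θ m (σ + t * I) n)
    (g := fun n : Ideal R => if n = ⊤ then (1:ℂ) else 0)
    (hsum 2 (by norm_num)) ?_ ?_
  · rw [tsum_ite_eq] at key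
    exact key
  · intro n
    by_cases hn : n = ⊤
    · rw [if_pos hn, hn]
      have h1 : (⊤ : Ideal R) ≠ ⊥ := top_ne_bot
      have h2 : pch m (θ (⊤ : Ideal R)) = 1 := by
        have := hθ m ⊤ ⊤ h1 h1
        rw [Ideal.mul_top] at this
        have hne : pch m (θ (⊤ : Ideal R)) ≠ 0 := by
          rw [← norm_ne_zero_iff, pch_norm]; norm_num
        exact (mul_left_cancel₀ hne (by rw [mul_one]; exact this)).symm
      have h3 : ∀ σ : ℝ, zf θ m (σ + t * I) (⊤ : Ideal R) = 1 := by
        intro σ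
        rw [zf, zc, if_neg h1, h2, one_mul]
        unfold pe qn
        simp
      simp_rw [h3]
      exact tendsto_const_nhds
    · rw [if_neg hn, tendsto_zero_iff_norm_tendsto_zero]
      simp_rw [zf_norm]
      by_cases hb : n = ⊥
      · simp [hb]
      · have hl : 0 < Real.log (qn n) := Real.log_pos (by linarith [qn_two hb hn])
        simp only [hb, if_false, one_mul]
        apply Real.tendsto_exp_atBot.comp
        simp only [Complex.add_re, Complex.ofReal_re, Complex.mul_re, Complex.I_re, Complex.I_im,
          Complex.ofReal_im, mul_zero, zero_mul, sub_zero, add_zero]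
        exact (tendsto_neg_atTop_atBot).atBot_mul_const hl
  · filter_upwards [eventually_ge_atTop 2] with σ hσ n
    rw [zf_norm]
    have := lqn n
    have : Real.exp (-(σ + t * I : ℂ).re * Real.log (qn n)) ≤ Real.exp (-2 * Real.log (qn n)) := by
      apply Real.exp_le_exp.2
      simp
      nlinarith
    split_ifs <;> simpa using this

end PF2

section PF3
set_option linter.unusedSectionVars false
open Filter Topology Set Complex

lemma tent_sum (y : ℝ) : HasSum (fun j : ℤ => tent (y + j)) 1 := by
  have h := hasSum_sum_of_ne_finset_zero (f := fun j : ℤ => tent (y + j))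
    (s := {-⌊y⌋, -⌊y⌋ - 1}) (L := SummationFilter.unconditional ℤ) ?_
  · rw [Finset.sum_pair (by omega)] at h
    convert h using 1
    have h1 := Int.floor_le y
    have h2 := Int.lt_floor_add_one y
    unfold tent
    push_cast
    rw [abs_of_nonneg (by linarith : 0 ≤ y + -(⌊y⌋:ℝ)),
      abs_of_nonpos (by linarith : y + (-(⌊y⌋:ℝ) - 1) ≤ 0), max_eq_right (by linarith),
      max_eq_right (by linarith)]
    ring
  · intro j hj
    simp only [Finset.mem_insert, Finset.mem_singleton, not_or] at hj
    by_contra hne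
    have h3 := tent_pos hne
    rw [abs_lt] at h3
    have h4 : (-⌊y⌋ - 1 : ℤ) ≤ j := by
      by_contra hlt
      have : j + 1 ≤ -⌊y⌋ - 1 := by omega
      have : (j:ℝ) + 1 ≤ -⌊y⌋ - 1 := by exact_mod_cast this
      have h1 := Int.floor_le y
      have h2 := Int.lt_floor_add_one y
      linarith
    have h5 : j ≤ -⌊y⌋ := by
      by_contra hlt
      have : -⌊y⌋ + 1 ≤ j := by omega
      have : -(⌊y⌋:ℝ) + 1 ≤ j := by exact_mod_cast this
      have h1 := Int.floor_le y
      linarith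
    omega

lemma pch_add_int (m : ℤ) (y : ℝ) (j : ℤ) : pch m (y + j) = pch m y := by
  unfold pch
  have : (2 * Real.pi * I * m * ((y + j : ℝ) : ℂ)) = 2 * Real.pi * I * m * y + ((m * j : ℤ) : ℂ) * (2 * Real.pi * I) := by
    push_cast; ring
  rw [this, Complex.exp_add, Complex.exp_int_mul_two_pi_mul_I, mul_one]

lemma pch_add (m : ℤ) (x y : ℝ) : pch m (x + y) = pch m x * pch m y := by
  unfold pch
  rw [← Complex.exp_add]; congr 1; push_cast; ring

structure QF (R : Type) [CommRing R] [IsDedekindDomain R] [Module.Free ℤ R] [Module.Finite ℤ R] where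
  s1 : R →+* ℝ
  s2 : R →+* ℝ
  i1 : Function.Injective s1
  i2 : Function.Injective s2
  hn : ∀ k, |s1 k * s2 k| = qn (Ideal.span {k})
  pid : IsPrincipalIdealRing R
  u : Rˣ
  hu : 1 < s1 u
  hg : ∀ v : Rˣ, ∃ n : ℤ, v = u ^ n ∨ v = -u ^ n
  T : (ℝ × ℝ) ≃L[ℝ] (ℝ × ℝ)
  e : ℤ × ℤ ≃ R
  he : ∀ k, (s1 (e k), s2 (e k)) = T (kc k)

variable {R : Type} [CommRing R] [IsDedekindDomain R] [Module.Free ℤ R] [Module.Finite ℤ R]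

namespace QF

noncomputable def L (q : QF R) : ℝ := Real.log (q.s1 q.u)
lemma L_pos (q : QF R) : 0 < q.L := Real.log_pos q.hu

lemma gen_ex (q : QF R) (n : Ideal R) : ∃ g : R, Ideal.span {g} = n := by
  have := q.pid
  exact ⟨_, Ideal.span_singleton_generator n⟩

noncomputable def gn (q : QF R) (n : Ideal R) : R := (q.gen_ex n).choose
lemma gn_spec (q : QF R) (n : Ideal R) : Ideal.span {q.gn n} = n := (q.gen_ex n).choose_spec
lemma gn_ne (q : QF R) {n : Ideal R} (h : n ≠ ⊥) : q.gn n ≠ 0 := by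
  intro h0; apply h; rw [← q.gn_spec n, h0]; simp

noncomputable def gt (q : QF R) (k : R) : ℝ := gth q.L (q.s1 k) (q.s2 k)
noncomputable def th (q : QF R) (n : Ideal R) : ℝ := q.gt (q.gn n)

lemma s1_ne (q : QF R) {k : R} (h : k ≠ 0) : q.s1 k ≠ 0 := (map_ne_zero_iff _ q.i1).2 h
lemma s2_ne (q : QF R) {k : R} (h : k ≠ 0) : q.s2 k ≠ 0 := (map_ne_zero_iff _ q.i2).2 h

lemma gt_mul (q : QF R) {a b : R} (ha : a ≠ 0) (hb : b ≠ 0) : q.gt (a * b) = q.gt a + q.gt b := by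
  unfold gt gth
  rw [map_mul, map_mul, Real.log_mul (q.s1_ne ha) (q.s1_ne hb), Real.log_mul (q.s2_ne ha) (q.s2_ne hb)]
  ring

lemma gt_neg (q : QF R) (a : R) : q.gt (-a) = q.gt a := by
  unfold gt gth
  rw [map_neg, map_neg, Real.log_neg_eq_log, Real.log_neg_eq_log]

lemma u_ne (q : QF R) (j : ℤ) : ((q.u ^ j : Rˣ) : R) ≠ 0 := Units.ne_zero _

lemma s1_zpow (q : QF R) (j : ℤ) : q.s1 ((q.u ^ j : Rˣ) : R) = (q.s1 q.u) ^ j := by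
  have := congrArg Units.val (map_zpow (Units.map (q.s1 : R →* ℝ)) q.u j)
  rw [Units.val_zpow_eq_zpow_val] at this
  exact this
lemma s2_zpow (q : QF R) (j : ℤ) : q.s2 ((q.u ^ j : Rˣ) : R) = (q.s2 q.u) ^ j := by
  have := congrArg Units.val (map_zpow (Units.map (q.s2 : R →* ℝ)) q.u j)
  rw [Units.val_zpow_eq_zpow_val] at this
  exact this

lemma log_s2 (q : QF R) : Real.log (q.s2 q.u) = - q.L := by
  have h := q.hn q.u
  have h1 : Ideal.span {(q.u : R)} = ⊤ := Ideal.span_singleton_eq_top.2 q.u.isUnit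
  rw [h1] at h
  have h2 : qn (⊤ : Ideal R) = 1 := by unfold qn; simp
  rw [h2] at h
  have h3 := congrArg Real.log h
  rw [Real.log_abs, Real.log_mul (q.s1_ne q.u.ne_zero) (q.s2_ne q.u.ne_zero), Real.log_one] at h3
  unfold L; linarith

lemma gt_zpow (q : QF R) (j : ℤ) : q.gt ((q.u ^ j : Rˣ) : R) = j := by
  unfold gt gth
  rw [s1_zpow, s2_zpow, Real.log_zpow, Real.log_zpow, log_s2]
  have := q.L_pos
  change ((j:ℝ) * q.L - _) / _ = _
  field_simp; ring

lemma gt_unit (q : QF R) (v : Rˣ) : ∃ j : ℤ, q.gt (v : R) = j := by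
  obtain ⟨j, h | h⟩ := q.hg v
  · exact ⟨j, by rw [h, gt_zpow]⟩
  · exact ⟨j, by rw [h, Units.val_neg, gt_neg, gt_zpow]⟩

lemma th_mul (q : QF R) (m : ℤ) (a b : Ideal R) (ha : a ≠ ⊥) (hb : b ≠ ⊥) :
    pch m (q.th (a * b)) = pch m (q.th a) * pch m (q.th b) := by
  have h : Ideal.span {q.gn a * q.gn b} = Ideal.span {q.gn (a * b)} := by
    rw [q.gn_spec, ← Ideal.span_singleton_mul_span_singleton, q.gn_spec, q.gn_spec]
  rw [Ideal.span_singleton_eq_span_singleton] at h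
  obtain ⟨v, hv⟩ := h
  obtain ⟨j, hj⟩ := q.gt_unit v
  unfold th
  rw [← hv, q.gt_mul (mul_ne_zero (q.gn_ne ha) (q.gn_ne hb)) v.ne_zero, hj, pch_add_int,
    q.gt_mul (q.gn_ne ha) (q.gn_ne hb), pch_add]

noncomputable def gm (q : QF R) (n : Ideal R) (x : Bool × ℤ) : R :=
  (if x.1 then 1 else -1) * ((q.u ^ x.2 : Rˣ) : R) * q.gn n

lemma gm_span (q : QF R) (n : Ideal R) (x : Bool × ℤ) : Ideal.span {q.gm n x} = n := by
  rw [gm]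
  conv_rhs => rw [← q.gn_spec n]
  rw [Ideal.span_singleton_eq_span_singleton, mul_comm]
  rcases x with ⟨b, j⟩
  cases b
  · refine (Associated.symm ⟨-(q.u ^ j), ?_⟩)
    simp
  · refine (Associated.symm ⟨(q.u ^ j), ?_⟩)
    simp

lemma gm_gt (q : QF R) {n : Ideal R} (h : n ≠ ⊥) (x : Bool × ℤ) : q.gt (q.gm n x) = q.th n + x.2 := by
  have h1 : q.gt (((q.u ^ x.2 : Rˣ) : R) * q.gn n) = q.th n + x.2 := by
    rw [q.gt_mul (q.u_ne _) (q.gn_ne h), gt_zpow, th]; ring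
  rcases x with ⟨b, j⟩
  cases b
  · simp only [gm, Bool.false_eq_true, if_false, neg_mul, one_mul] at h1 ⊢
    rw [gt_neg, h1]
  · simp only [gm, if_true, one_mul] at h1 ⊢
    rw [h1]

lemma gm_inj (q : QF R) {n : Ideal R} (h : n ≠ ⊥) : Function.Injective (q.gm n) := by
  rintro ⟨b, j⟩ ⟨b', j'⟩ hh
  have h1 := congrArg q.gt hh
  rw [q.gm_gt h, q.gm_gt h] at h1
  have h2 : j = j' := by simpa using h1
  subst h2
  simp only [gm] at hh
  have h3 := mul_right_cancel₀ (q.u_ne j) (mul_right_cancel₀ (q.gn_ne h) hh)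
  have h4 := congrArg q.s1 h3
  cases b <;> cases b' <;> simp at h4 ⊢ <;> norm_num at h4

lemma gm_surj (q : QF R) {n : Ideal R} {k : R} (h : Ideal.span {k} = n) : ∃ x, q.gm n x = k := by
  rw [← q.gn_spec n, Ideal.span_singleton_eq_span_singleton] at h
  obtain ⟨v, hv⟩ := h.symm
  obtain ⟨j, hj | hj⟩ := q.hg v
  · refine ⟨(true, j), ?_⟩
    rw [← hv, hj, gm]; simp [mul_comm]
  · refine ⟨(false, j), ?_⟩
    rw [← hv, hj, gm]; simp [mul_comm]

noncomputable def fib (q : QF R) {n : Ideal R} (h : n ≠ ⊥) : Bool × ℤ ≃ {k : R // Ideal.span {k} = n} :=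
  Equiv.ofBijective (fun x => ⟨q.gm n x, q.gm_span n x⟩)
    ⟨fun _ _ hh => q.gm_inj h (congrArg Subtype.val hh), fun k => by
      obtain ⟨x, hx⟩ := q.gm_surj k.2
      exact ⟨x, Subtype.ext hx⟩⟩

lemma fib_sum (q : QF R) (m : ℤ) (s : ℂ) (n : Ideal R) :
    HasSum (fun k : {k : R // Ideal.span {k} = n} => gL q.L m s (q.s1 k, q.s2 k)) (2 * zf q.th m s n) := by
  by_cases h : n = ⊥
  · have : (fun k : {k : R // Ideal.span {k} = n} => gL q.L m s (q.s1 k, q.s2 k)) = fun _ => 0 := by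
      ext ⟨k, hk⟩
      rw [h, Ideal.span_singleton_eq_bot] at hk
      subst hk
      simp [gL]
    rw [this, zf, zc, if_pos h]
    simpa using hasSum_zero
  · rw [← (q.fib h).hasSum_iff]
    have hq := qn_pos h
    have e1 : ((fun k : {k : R // Ideal.span {k} = n} => gL q.L m s (q.s1 k, q.s2 k)) ∘ q.fib h) =
        fun x : Bool × ℤ => (tent (q.th n + x.2) : ℂ) * zf q.th m s n := by
      ext x
      show gL q.L m s (q.s1 (q.gm n x), q.s2 (q.gm n x)) = _
      have h1 := q.gm_gt h x
      unfold gt at h1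
      simp only [gL]
      rw [h1, q.hn, gm_span, if_pos hq, zf, zc, if_neg h, pch_add_int]
    rw [e1]
    have h3 := ((Complex.ofRealCLM.hasSum (tent_sum (q.th n))).mul_right (zf q.th m s n))
    have h4 : HasSum (fun x : Bool × ℤ => (tent (q.th n + x.2) : ℂ) * zf q.th m s n) 
        (∑ b : Bool, zf q.th m s n) := by
      have h5 : HasSum (fun x : (_ : Bool) × ℤ => (tent (q.th n + x.2) : ℂ) * zf q.th m s n) 
        (∑ b : Bool, zf q.th m s n) := by
        refine HasSum.of_sigma (g := fun b : Bool => zf q.th m s n) (fun b => ?_) (hasSum_fintype _) ?_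
        · simpa using h3
        · have : Summable (fun x : (_ : Bool) × ℤ => (tent (q.th n + x.2) : ℂ) * zf q.th m s n) := by
            apply Summable.of_norm
            rw [summable_sigma_of_nonneg (fun _ => norm_nonneg _)]
            refine ⟨fun b => ?_, ?_⟩
            · exact h3.summable.norm
            · exact (hasSum_fintype _).summable
          exact this.hasSum.cauchySeq
      exact (Equiv.sigmaEquivProd Bool ℤ).symm.hasSum_iff.2 h5
    convert h4 using 1
    simp

lemma lat (q : QF R) : ∃ (κ K0 : ℝ) (S : ℤ → ℂ → ℂ), 0 < κ ∧ 0 < K0 ∧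
    (∀ m, DifferentiableOn ℂ (S m) {s | 1/2 < s.re}) ∧
    (∀ m s, 3/4 ≤ s.re → s.re ≤ 3 → ‖S m s‖ ≤ K0 * (1 + |s.im| + |(m:ℝ)|)) ∧
    ∀ m s, 1 < s.re → HasSum (fun n => zf q.th m s n) ((if m = 0 then (κ:ℂ)/(s-1) else 0) + S m s) := by
  obtain ⟨κ, K0, S, h1, h2, h3, h4, h5⟩ := lat_main q.L_pos q.T
  refine ⟨κ, K0, S, h1, h2, h3, h4, fun m s hs => ?_⟩
  have h6 := h5 m s hs
  simp_rw [← q.he] at h6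
  have h7 : HasSum (fun k : R => gL q.L m s (q.s1 k, q.s2 k)) _ := q.e.hasSum_iff.1 h6
  have h8 := (Equiv.sigmaFiberEquiv (fun k : R => Ideal.span {k})).hasSum_iff.2 h7
  have h9 := h8.sigma (fun n => q.fib_sum m s n)
  have := h9.mul_left (1/2)
  simpa using this

lemma hsum (q : QF R) : ∀ σ : ℝ, 1 < σ →
    Summable fun n : Ideal R => (if n = ⊥ then (0:ℝ) else 1) * Real.exp (-σ * Real.log (qn n)) := by
  intro σ hσ
  obtain ⟨κ, K0, S, h1, h2, h3, h4, h5⟩ := q.lat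
  have := (h5 0 σ (by simpa using hσ)).summable.norm
  simp_rw [zf_norm] at this
  simpa using this

end QF
end PF3

section PF4
set_option linter.unusedSectionVars false
open Filter Topology Set Complex
variable {R : Type} [CommRing R] [IsDedekindDomain R] [Module.Free ℤ R] [Module.Finite ℤ R]

namespace QF

lemma ctbl (q : QF R) : Countable (Ideal R) := by
  have : Countable R := q.e.symm.injective.countable
  exact Function.Surjective.countable (f := fun k : R => Ideal.span {k}) (fun n => q.gen_ex n)

lemma pdm (q : QF R) : ∃ (r0 K : ℝ) (B : ℕ), 0 < r0 ∧ r0 ≤ 1 ∧ 0 < K ∧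
    ∀ (m : ℤ) (s : ℂ), 1 < s.re → s.re ≤ 1 + r0 →
      ‖(∑' i : PP R × ℕ, (((lgp i * Real.log (qn (pw1 i)) : ℝ) : ℂ) * pch m (q.th (pw1 i))) *
        pe (qn (pw1 i)) s) - (if m = 0 then 1/(s-1)^2 else 0)‖ ≤ K * (1 + |s.im| + |(m:ℝ)|)^B := by
  obtain ⟨κ, K0, S, h1, h2, h3, h4, h5⟩ := q.lat
  obtain ⟨r0, K, B, hr0, hr1, hK, hb⟩ := pd_main (Zf q.th) (Df q.th) S κ K0 1 h1
    (fun m s hs => Zf_deriv q.hsum q.th_mul m hs)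
    (fun m s hs => (h5 m s hs).tsum_eq) h3 (fun m s ha hb => by rw [pow_one]; exact h4 m s ha hb)
    (fun m σ t hσ => D_341 q.hsum q.th m σ t hσ)
    (fun m t => Zf_lim q.hsum q.th_mul m t)
  refine ⟨r0, K, B, hr0, hr1, hK, fun m s hs1 hs2 => ?_⟩
  have := (hb m s hs1 hs2).2
  rw [(Df_deriv q.hsum q.th m hs1).deriv, ← norm_neg, neg_add, neg_neg, ← sub_eq_add_neg] at this
  exact this

noncomputable def cc (i : PP R × ℕ) : ℝ := lgp i * Real.log (qn (pw1 i))

lemma cc_nonneg (i : PP R × ℕ) : 0 ≤ cc i := mul_nonneg (lgp_pos i).le (lqn _)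

lemma Q_pos (i : PP R × ℕ) : 0 < qn (pw1 i) := by linarith [qn_pos (pw1_ne i)]

lemma cc_sum (q : QF R) : ∀ σ : ℝ, 1 < σ →
    Summable fun i : PP R × ℕ => cc i * Real.exp (-σ * Real.log (qn (pw1 i))) :=
  dir_log (fun i : PP R × ℕ => lgp i) _ (fun _ => lqn _) (fun i => (lgp_pos i).le)
    (fun _ h => d_summable q.hsum h)

lemma fin1 (q : QF R) {a b : ℝ} (ha : 0 < a) (hb : 0 < b) : ∃ A N0 : ℝ, 0 < A ∧ 1 < N0 ∧ ∀ N : ℝ, N0 ≤ N →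
    Summable (fun i : PP R × ℕ => cc i * pH a b q.L (qn (pw1 i) / N) (q.th (pw1 i))) ∧
    |(∑' i : PP R × ℕ, cc i * pH a b q.L (qn (pw1 i) / N) (q.th (pw1 i))) -
      N * Real.log N * (2 / Real.pi * ∫ y, (pw a b q.L y)⁻¹)| ≤ A * N := by
  obtain ⟨r0, K, B, hr0, hr1, hK, h⟩ := q.pdm
  have := q.ctbl
  exact pc_final1 ha hb q.L_pos (fun i : PP R × ℕ => cc i) (fun i => qn (pw1 i))
    (fun i => q.th (pw1 i)) Q_pos cc_nonneg q.cc_sum r0 K B hr0 hr1 hK h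

lemma fin2 (q : QF R) {a b : ℝ} (ha : 0 < a) (hb : 0 < b) : ∃ A N0 : ℝ, 0 < A ∧ 1 < N0 ∧ ∀ N : ℝ, N0 ≤ N →
    Summable (fun i : PP R × ℕ => cc i * (Real.exp (-(1/2) * Real.log (qn (pw1 i) / N)) *
      pH a b q.L (qn (pw1 i) / N) (q.th (pw1 i)))) ∧
    (∑' i : PP R × ℕ, cc i * (Real.exp (-(1/2) * Real.log (qn (pw1 i) / N)) *
      pH a b q.L (qn (pw1 i) / N) (q.th (pw1 i)))) ≤ A * N * Real.log N := by
  obtain ⟨r0, K, B, hr0, hr1, hK, h⟩ := q.pdm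
  have := q.ctbl
  exact pc_final2 ha hb q.L_pos (fun i : PP R × ℕ => cc i) (fun i => qn (pw1 i))
    (fun i => q.th (pw1 i)) Q_pos cc_nonneg q.cc_sum r0 K B hr0 hr1 hK h

end QF
end PF4

section PG1
set_option linter.unusedSectionVars false
open Filter Topology Set

lemma pexp_log_core {x w μ : ℝ} (hx : 0 < x) (hμ : 0 < μ) (hw : μ ≤ w) :
    |Real.log x| * Real.exp (-(Real.pi * x * w)) ≤ (2 + 4 / (Real.pi * μ)) *
      (Real.exp (-(1/2) * Real.log x) * (Real.exp (-(Real.pi * x * w)) + Real.exp (-(Real.pi * x * (w / 2))))) := by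
  have hpi := Real.pi_pos
  set y := Real.exp ((1/2) * Real.log x) with hy
  have hy0 : 0 < y := Real.exp_pos _
  have hyx : y * y = x := by
    rw [hy, ← Real.exp_add, ← Real.exp_log hx, Real.log_exp]; congr 1; ring
  have hyi : Real.exp (-(1/2) * Real.log x) = y⁻¹ := by rw [hy, ← Real.exp_neg]; congr 1; ring
  have hly : Real.log x = 2 * Real.log y := by rw [hy, Real.log_exp]; ring
  rw [hyi]
  set E := Real.exp (-(Real.pi * x * (w/2))) with hE
  have hE0 : 0 < E := Real.exp_pos _
  have hEE : Real.exp (-(Real.pi * x * w)) = E * E := by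
    rw [hE, ← Real.exp_add]; congr 1; ring
  rw [hEE]
  have hc : 0 < 4 / (Real.pi * μ) := by positivity
  rcases le_total x 1 with h | h
  · have h1 : |Real.log x| ≤ 2 * y⁻¹ := by
      rw [abs_of_nonpos (Real.log_nonpos hx.le h), hly]
      have := Real.log_le_sub_one_of_pos (inv_pos.2 hy0)
      rw [Real.log_inv] at this
      linarith
    have h2 : 0 < y⁻¹ := inv_pos.2 hy0
    calc |Real.log x| * (E * E) ≤ 2 * y⁻¹ * (E * E) := by gcongr
      _ = 2 * (y⁻¹ * (E * E + 0)) := by ring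
      _ ≤ (2 + 4 / (Real.pi * μ)) * (y⁻¹ * (E * E + E)) := by
        apply mul_le_mul (by linarith) _ (by positivity) (by positivity)
        gcongr
  · have h1 : |Real.log x| ≤ 2 * y := by
      rw [abs_of_nonneg (Real.log_nonneg h), hly]
      have := Real.log_le_sub_one_of_pos hy0
      linarith
    have h2 : E ≤ 2 / (Real.pi * μ) * x⁻¹ := by
      have h3 : Real.pi * x * (w/2) + 1 ≤ Real.exp (Real.pi * x * (w/2)) := Real.add_one_le_exp _
      have h4 : Real.pi * x * (μ/2) ≤ Real.pi * x * (w/2) := by gcongr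
      rw [hE, Real.exp_neg]
      have h5 : (Real.exp (Real.pi * x * (w/2)))⁻¹ ≤ (Real.pi * x * (μ/2))⁻¹ := by
        apply inv_anti₀ (by positivity); linarith
      refine h5.trans (le_of_eq ?_)
      field_simp
    have h6 : 0 < y⁻¹ := inv_pos.2 hy0
    calc |Real.log x| * (E * E) ≤ 2 * y * ((2 / (Real.pi * μ) * x⁻¹) * E) := by gcongr
      _ = (4 / (Real.pi * μ)) * (y⁻¹ * (0 + E)) := by
        rw [← hyx]; field_simp; ring
      _ ≤ (2 + 4 / (Real.pi * μ)) * (y⁻¹ * (E * E + E)) := by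
        gcongr
        · linarith
        · positivity

lemma pw_half (a b L y : ℝ) : pw (a/2) (b/2) L y = pw a b L y / 2 := by unfold pw; ring

lemma pH_log {a b L : ℝ} (ha : 0 < a) (hb : 0 < b) (hL : 0 < L) : ∃ C, 0 < C ∧ ∀ x, 0 < x → ∀ θ,
    |Real.log x| * pH a b L x θ ≤ C * (Real.exp (-(1/2) * Real.log x) * pH a b L x θ +
      Real.exp (-(1/2) * Real.log x) * pH (a/2) (b/2) L x θ) := by
  have hpi := Real.pi_pos
  have hμ : 0 < min a b := lt_min ha hb
  refine ⟨2 + 4 / (Real.pi * min a b), by positivity, fun x hx θ => ?_⟩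
  have hw : ∀ y, min a b ≤ pw a b L y := fun y => by
    refine le_trans ?_ (pw_ge ha hb hL y)
    have : 1 ≤ Real.exp (2 * L * |y|) := Real.one_le_exp (by positivity)
    nlinarith
  have s1 := pH_summable ha hb hL hx θ
  have s2 := pH_summable (half_pos ha) (half_pos hb) hL hx θ
  unfold pH
  set K := 2 + 4 / (Real.pi * min a b)
  set e := Real.exp (-(1/2) * Real.log x)
  have h1 : |Real.log x| * ∑' n : ℤ, Real.exp (-(Real.pi * x * pw a b L (θ + n))) ≤
      K * e * (∑' n : ℤ, Real.exp (-(Real.pi * x * pw a b L (θ + n))) +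
      ∑' n : ℤ, Real.exp (-(Real.pi * x * pw (a/2) (b/2) L (θ + n)))) := by
    rw [← s1.tsum_add s2, ← tsum_mul_left, ← tsum_mul_left]
    refine Summable.tsum_le_tsum (fun n => ?_) (s1.mul_left _) ((s1.add s2).mul_left _)
    have := pexp_log_core hx hμ (hw (θ + n))
    rw [pw_half]
    rw [mul_assoc K e]
    exact this
  linarith

variable {R : Type} [CommRing R] [IsDedekindDomain R] [Module.Free ℤ R] [Module.Finite ℤ R]

namespace QF

noncomputable def lp (p : PP R) : ℝ := Real.log (qn p.1)
noncomputable def Hp (q : QF R) (a b N : ℝ) (p : PP R) : ℝ := pH a b q.L (qn p.1 / N) (q.th p.1)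

lemma lp_two (p : PP R) : Real.log 2 ≤ lp p := Real.log_le_log (by norm_num) (PP_two p)
lemma lp_pos (p : PP R) : 0 < lp p := (Real.log_pos (by norm_num)).trans_le (lp_two p)
lemma pp_pos (p : PP R) : 0 < qn p.1 := by linarith [PP_two p]

lemma pw1_zero (p : PP R) : pw1 (p, 0) = p.1 := by simp [pw1]
lemma cc_zero (p : PP R) : cc (p, 0) = lp p ^ 2 := by
  unfold cc lgp lp; rw [pw1_zero]; ring

lemma inj0 : Function.Injective (fun p : PP R => (p, 0) : PP R → PP R × ℕ) := fun _ _ h => (Prod.ext_iff.1 h).1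

lemma tsum_split {f : PP R × ℕ → ℝ} (hf : Summable f) :
    ∑' i, f i = ∑' p : PP R, f (p, 0) + ∑' i : PP R × ℕ, (if i.2 = 0 then 0 else f i) := by
  have h1 : Summable fun i : PP R × ℕ => if i.2 = 0 then f i else 0 := by
    have := hf.indicator {i : PP R × ℕ | i.2 = 0}
    refine this.congr (fun i => ?_)
    by_cases h : i.2 = 0
    · rw [indicator_of_mem (by exact h), if_pos h]
    · rw [indicator_of_notMem (by exact h), if_neg h]
  have h2 : Summable fun i : PP R × ℕ => if i.2 = 0 then 0 else f i := by
    refine (hf.sub h1).congr (fun i => ?_)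
    split_ifs <;> simp
  have h3 : ∑' p : PP R, f (p, 0) = ∑' i : PP R × ℕ, if i.2 = 0 then f i else 0 := by
    rw [← (inj0 (R := R)).tsum_eq]
    · simp
    · rintro ⟨p, j⟩ hi
      by_cases hj : j = 0
      · exact ⟨p, by rw [hj]⟩
      · exfalso; apply hi; simp [hj]
  rw [h3, ← h1.tsum_add h2]
  congr 1; ext i; split_ifs <;> simp

lemma sum_p (q : QF R) {σ : ℝ} (h : 1 < σ) : Summable fun p : PP R => Real.exp (-σ * lp p) := by
  have := (q.hsum σ h).comp_injective (i := fun p : PP R => p.1) Subtype.val_injective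
  refine this.congr (fun p => ?_)
  simp only [Function.comp]
  rw [if_neg p.2.1, one_mul]; rfl

lemma sum_p2 (q : QF R) {σ : ℝ} (h : 1 < σ) : Summable fun p : PP R => lp p ^ 2 * Real.exp (-σ * lp p) := by
  have := (q.cc_sum σ h).comp_injective (inj0 (R := R))
  refine this.congr (fun p => ?_)
  simp only [Function.comp]
  rw [cc_zero, pw1_zero]; rfl

lemma tail_sum (q : QF R) : Summable fun i : PP R × ℕ =>
    if i.2 = 0 then 0 else cc i * Real.exp (-(3/4) * Real.log (qn (pw1 i))) := by
  set r := Real.exp (-(3/4) * Real.log 2) with hr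
  have hr0 : 0 < r := Real.exp_pos _
  have hr1 : r < 1 := by
    rw [hr, Real.exp_lt_one_iff]
    have := Real.log_pos (by norm_num : (1:ℝ) < 2); linarith
  have h1 : Summable fun n : ℕ => ((n:ℝ) + 1) * r ^ n / r := by
    have e1 := summable_pow_mul_geometric_of_norm_lt_one 1 (r := r) (by rwa [Real.norm_eq_abs, abs_of_pos hr0])
    have e2 := summable_geometric_of_lt_one hr0.le hr1
    refine ((e1.add e2).div_const r).congr (fun n => ?_)
    simp; ring
  have h2 := (q.sum_p2 (by norm_num : (1:ℝ) < 3/2)).mul_of_nonneg h1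
    (fun p => by positivity) (fun n => by positivity)
  refine h2.of_nonneg_of_le (fun i => ?_) (fun i => ?_)
  · split_ifs
    · exact le_rfl
    · exact mul_nonneg (cc_nonneg i) (Real.exp_nonneg _)
  · rcases i with ⟨p, n⟩
    simp only
    split_ifs with h0
    · have := (Real.exp_pos (-(3/2) * lp p)); positivity
    · obtain ⟨k, rfl⟩ := Nat.exists_eq_succ_of_ne_zero h0
      have hl : Real.log (qn (pw1 (p, k.succ))) = ((k:ℝ) + 2) * lp p := by
        rw [qn_pw1]; simp only [lgp, lp]; push_cast; ring
      have hcc : cc (p, k.succ) = ((k:ℝ) + 2) * lp p ^ 2 := by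
        unfold cc; rw [hl]; simp only [lgp, lp]; ring
      rw [hcc, hl]
      have h3 : Real.exp (-(3/4) * (((k:ℝ) + 2) * lp p)) ≤ Real.exp (-(3/2) * lp p) * r ^ k := by
        rw [hr, ← Real.exp_nat_mul, ← Real.exp_add]
        apply Real.exp_le_exp.2
        have := mul_le_mul_of_nonneg_left (lp_two p) (Nat.cast_nonneg k : (0:ℝ) ≤ k)
        linarith
      have h4 : r ^ k.succ / r = r ^ k := by rw [pow_succ]; field_simp
      rw [mul_div_assoc, h4]
      push_cast
      calc ((k:ℝ) + 2) * lp p ^ 2 * Real.exp (-(3/4) * (((k:ℝ) + 2) * lp p)) ≤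
          ((k:ℝ) + 2) * lp p ^ 2 * (Real.exp (-(3/2) * lp p) * r ^ k) := by gcongr
        _ = _ := by ring

lemma stepA (q : QF R) {a b : ℝ} (ha : 0 < a) (hb : 0 < b) : ∃ A N0 : ℝ, 0 < A ∧ 1 < N0 ∧ ∀ N : ℝ, N0 ≤ N →
    Summable (fun p : PP R => lp p ^ 2 * q.Hp a b N p) ∧
    |(∑' p : PP R, lp p ^ 2 * q.Hp a b N p) - N * Real.log N * (2 / Real.pi * ∫ y, (pw a b q.L y)⁻¹)| ≤ A * N := by
  obtain ⟨A, N0, hA, hN0, h⟩ := q.fin1 ha hb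
  obtain ⟨C, hC, hH⟩ := pH_aux ha hb q.L_pos (σ := 3/4) (by norm_num) (by norm_num)
  set W := ∑' i : PP R × ℕ, if i.2 = 0 then 0 else cc i * Real.exp (-(3/4) * Real.log (qn (pw1 i))) with hW
  have hW0 : 0 ≤ W := tsum_nonneg (fun i => by
    split_ifs
    · exact le_rfl
    · exact mul_nonneg (cc_nonneg i) (Real.exp_nonneg _))
  refine ⟨A + C * W, N0, by positivity, hN0, fun N hN => ?_⟩
  obtain ⟨hs, hb1⟩ := h N hN
  have hNp : 1 < N := hN0.trans_le hN
  have hs0 := hs.comp_injective (inj0 (R := R))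
  have hs1 : Summable (fun p : PP R => lp p ^ 2 * q.Hp a b N p) := by
    refine hs0.congr (fun p => ?_)
    simp only [Function.comp]
    rw [cc_zero, pw1_zero]; rfl
  refine ⟨hs1, ?_⟩
  have hsp := tsum_split hs
  have e1 : ∑' p : PP R, cc (p, 0) * pH a b q.L (qn (pw1 (p, 0)) / N) (q.th (pw1 (p, 0))) =
      ∑' p : PP R, lp p ^ 2 * q.Hp a b N p := by
    congr 1; ext p; rw [cc_zero, pw1_zero]; rfl
  rw [e1] at hsp
  set X := ∑' i : PP R × ℕ, if i.2 = 0 then 0 else cc i * pH a b q.L (qn (pw1 i) / N) (q.th (pw1 i)) with hX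
  have hX0 : 0 ≤ X := tsum_nonneg (fun i => by
    split_ifs
    · exact le_rfl
    · exact mul_nonneg (cc_nonneg i) (pH_nonneg _ _))
  have hX1 : X ≤ C * W * N := by
    have e2 : C * W * N = ∑' i : PP R × ℕ, C * N * (if i.2 = 0 then 0 else cc i * Real.exp (-(3/4) * Real.log (qn (pw1 i)))) := by
      rw [tsum_mul_left]; ring
    rw [e2, hX]
    have hbd : ∀ i : PP R × ℕ, (if i.2 = 0 then 0 else cc i * pH a b q.L (qn (pw1 i) / N) (q.th (pw1 i))) ≤
        C * N * (if i.2 = 0 then 0 else cc i * Real.exp (-(3/4) * Real.log (qn (pw1 i)))) := by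
      intro i
      split_ifs
      · simp
      · have hQ := Q_pos i
        have hx : 0 < qn (pw1 i) / N := by positivity
        have h3 := (hH _ hx (q.th (pw1 i))).2
        have h4 : Real.exp (-(3/4) * Real.log (Real.pi * (qn (pw1 i) / N))) ≤
            N * Real.exp (-(3/4) * Real.log (qn (pw1 i))) := by
          rw [Real.log_mul Real.pi_ne_zero hx.ne', Real.log_div hQ.ne' (by linarith)]
          nth_rw 2 [← Real.exp_log (by linarith : 0 < N)]
          rw [← Real.exp_add]
          apply Real.exp_le_exp.2
          have h5 : 0 < Real.log Real.pi := Real.log_pos (by linarith [Real.pi_gt_three])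
          have h6 : 0 < Real.log N := Real.log_pos hNp
          linarith
        calc cc i * pH a b q.L (qn (pw1 i) / N) (q.th (pw1 i)) ≤
            cc i * (C * (N * Real.exp (-(3/4) * Real.log (qn (pw1 i))))) := by
              apply mul_le_mul_of_nonneg_left _ (cc_nonneg i)
              exact h3.trans (mul_le_mul_of_nonneg_left h4 hC.le)
          _ = _ := by ring
    refine Summable.tsum_le_tsum hbd ?_ (q.tail_sum.mul_left _)
    refine Summable.of_nonneg_of_le (fun i => ?_) hbd (q.tail_sum.mul_left _)
    split_ifs
    · exact le_rfl
    · exact mul_nonneg (cc_nonneg i) (pH_nonneg _ _)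
  rw [hsp] at hb1
  rw [abs_le] at hb1 ⊢
  constructor <;> nlinarith [hb1.1, hb1.2]

lemma stepB (q : QF R) {a b : ℝ} (ha : 0 < a) (hb : 0 < b) : ∃ A N0 : ℝ, 0 < A ∧ 1 < N0 ∧ ∀ N : ℝ, N0 ≤ N →
    Summable (fun p : PP R => lp p ^ 2 * (Real.exp (-(1/2) * Real.log (qn p.1 / N)) * q.Hp a b N p)) ∧
    (∑' p : PP R, lp p ^ 2 * (Real.exp (-(1/2) * Real.log (qn p.1 / N)) * q.Hp a b N p)) ≤ A * N * Real.log N := by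
  obtain ⟨A, N0, hA, hN0, h⟩ := q.fin2 ha hb
  refine ⟨A, N0, hA, hN0, fun N hN => ?_⟩
  obtain ⟨hs, hb1⟩ := h N hN
  have hs0 := hs.comp_injective (inj0 (R := R))
  have hs1 : Summable (fun p : PP R => lp p ^ 2 * (Real.exp (-(1/2) * Real.log (qn p.1 / N)) * q.Hp a b N p)) := by
    refine hs0.congr (fun p => ?_)
    simp only [Function.comp]
    rw [cc_zero, pw1_zero]; rfl
  refine ⟨hs1, ?_⟩
  have hsp := tsum_split hs
  have e1 : ∑' p : PP R, cc (p, 0) * (Real.exp (-(1/2) * Real.log (qn (pw1 (p, 0)) / N)) * pH a b q.L (qn (pw1 (p, 0)) / N) (q.th (pw1 (p, 0)))) =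
      ∑' p : PP R, lp p ^ 2 * (Real.exp (-(1/2) * Real.log (qn p.1 / N)) * q.Hp a b N p) := by
    congr 1; ext p; rw [cc_zero, pw1_zero]; rfl
  rw [e1] at hsp
  refine le_trans ?_ hb1
  rw [hsp]
  apply le_add_of_nonneg_right
  refine tsum_nonneg (fun i => ?_)
  split_ifs
  · exact le_rfl
  · exact mul_nonneg (cc_nonneg i) (mul_nonneg (Real.exp_nonneg _) (pH_nonneg _ _))

end QF
end PG1

section PG2
set_option linter.unusedSectionVars false
open Filter Topology Set

variable {R : Type} [CommRing R] [IsDedekindDomain R] [Module.Free ℤ R] [Module.Finite ℤ R]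

namespace QF

lemma Hp_nonneg (q : QF R) (a b N p) : 0 ≤ q.Hp a b N p := pH_nonneg _ _

lemma stepC_pt (q : QF R) {a b : ℝ} (ha : 0 < a) (hb : 0 < b) : ∃ C D : ℝ, 0 < C ∧ 0 < D ∧ ∀ N : ℝ, 1 < N →
    ∀ p : PP R, |Real.log N ^ 2 * q.Hp a b N p - lp p ^ 2 * q.Hp a b N p| ≤
      C / Real.log N * (lp p ^ 2 * (Real.exp (-(1/2) * Real.log (qn p.1 / N)) * q.Hp a b N p) +
        lp p ^ 2 * (Real.exp (-(1/2) * Real.log (qn p.1 / N)) * q.Hp (a/2) (b/2) N p)) +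
      D * Real.log N ^ 2 * Real.exp (7/8 * Real.log N) * Real.exp (-(5/4) * lp p) := by
  obtain ⟨C, hC, h1⟩ := pH_log ha hb q.L_pos
  obtain ⟨D, hD, h2⟩ := pH_aux ha hb q.L_pos (σ := 1/2) (by norm_num) (by norm_num)
  refine ⟨6 * C, 2 * D, by positivity, by positivity, fun N hN p => ?_⟩
  have hq := pp_pos p
  have hx : 0 < qn p.1 / N := by positivity
  have hΛ : 0 < Real.log N := Real.log_pos hN
  have hl := lp_pos p
  have hlx : Real.log (qn p.1 / N) = lp p - Real.log N := by
    rw [Real.log_div hq.ne' (by linarith)]; rfl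
  have h1' := h1 _ hx (q.th p.1)
  have h2' := (h2 _ hx (q.th p.1)).2
  have hH0 : 0 ≤ q.Hp a b N p := pH_nonneg _ _
  have hH1 : 0 ≤ q.Hp (a/2) (b/2) N p := pH_nonneg _ _
  change |_| * q.Hp a b N p ≤ C * (_ * q.Hp a b N p + _ * q.Hp (a/2) (b/2) N p) at h1'
  change q.Hp a b N p ≤ _ at h2'
  rw [Real.log_mul Real.pi_ne_zero hx.ne'] at h2'
  rw [hlx] at h1' h2' ⊢
  set H := q.Hp a b N p
  set H' := q.Hp (a/2) (b/2) N p
  set Λ := Real.log N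
  set l := lp p
  set e := Real.exp (-(1/2) * (l - Λ)) with he
  have he0 : 0 < e := Real.exp_pos _
  have key : |Λ ^ 2 * H - l ^ 2 * H| = (Λ + l) * (|l - Λ| * H) := by
    have : Λ ^ 2 * H - l ^ 2 * H = -((Λ + l) * (l - Λ) * H) := by ring
    rw [this, abs_neg, abs_mul, abs_mul, abs_of_pos (by linarith : 0 < Λ + l), abs_of_nonneg hH0]; ring
  rw [key]
  rcases le_total Λ (2 * l) with h | h
  · have e1 : Λ + l ≤ 6 / Λ * l ^ 2 := by
      rw [div_mul_eq_mul_div, le_div_iff₀ hΛ]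
      nlinarith
    have e2 : 0 ≤ 2 * D * Λ ^ 2 * Real.exp (7/8 * Λ) * Real.exp (-(5/4) * l) := by positivity
    have e3 : (Λ + l) * (|l - Λ| * H) ≤ (6 / Λ * l ^ 2) * (C * (e * H + e * H')) := by
      apply mul_le_mul e1 h1' (by positivity) (by positivity)
    have e4 : (6 / Λ * l ^ 2) * (C * (e * H + e * H')) = 6 * C / Λ * (l ^ 2 * (e * H) + l ^ 2 * (e * H')) := by ring
    linarith
  · have e1 : Λ + l ≤ 2 * Λ := by linarith
    have e2 : |l - Λ| ≤ Λ := by rw [abs_le]; constructor <;> linarith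
    have e3 : H ≤ D * (Real.exp (7/8 * Λ) * Real.exp (-(5/4) * l)) := by
      refine h2'.trans (mul_le_mul_of_nonneg_left ?_ hD.le)
      rw [← Real.exp_add]
      apply Real.exp_le_exp.2
      have h5 : 0 < Real.log Real.pi := Real.log_pos (by linarith [Real.pi_gt_three])
      linarith
    have e4 : 0 ≤ 6 * C / Λ * (l ^ 2 * (e * H) + l ^ 2 * (e * H')) := by positivity
    have e5 : (Λ + l) * (|l - Λ| * H) ≤ (2 * Λ) * (Λ * (D * (Real.exp (7/8 * Λ) * Real.exp (-(5/4) * l)))) := by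
      gcongr
    have e6 : (2 * Λ) * (Λ * (D * (Real.exp (7/8 * Λ) * Real.exp (-(5/4) * l)))) =
      2 * D * Λ ^ 2 * Real.exp (7/8 * Λ) * Real.exp (-(5/4) * l) := by ring
    linarith

lemma stepC (q : QF R) {a b : ℝ} (ha : 0 < a) (hb : 0 < b) : ∃ A N0 : ℝ, 0 < A ∧ 1 < N0 ∧ ∀ N : ℝ, N0 ≤ N →
    Summable (fun p : PP R => q.Hp a b N p) ∧
    |(∑' p : PP R, q.Hp a b N p) - (2 / Real.pi * ∫ y, (pw a b q.L y)⁻¹) * N / Real.log N| ≤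
      A * N / Real.log N ^ 2 := by
  obtain ⟨C, D, hC, hD, hpt⟩ := q.stepC_pt ha hb
  obtain ⟨A1, N1, hA1, hN1, h1⟩ := q.stepA ha hb
  obtain ⟨A2, N2, hA2, hN2, h2⟩ := q.stepB ha hb
  obtain ⟨A3, N3, hA3, hN3, h3⟩ := q.stepB (half_pos ha) (half_pos hb)
  set c := (2 / Real.pi * ∫ y, (pw a b q.L y)⁻¹)
  have hS := q.sum_p (by norm_num : (1:ℝ) < 5/4)
  set W := ∑' p : PP R, Real.exp (-(5/4) * lp p) with hW
  have hW0 : 0 ≤ W := tsum_nonneg (fun p => Real.exp_nonneg _)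
  refine ⟨A1 + C * (A2 + A3) + D * W * 256, max N1 (max N2 N3), by positivity, lt_max_of_lt_left hN1, fun N hN => ?_⟩
  have hNa : N1 ≤ N := (le_max_left _ _).trans hN
  have hNb : N2 ≤ N := ((le_max_left _ _).trans (le_max_right _ _)).trans hN
  have hNc : N3 ≤ N := ((le_max_right _ _).trans (le_max_right _ _)).trans hN
  have hN : 1 < N := hN1.trans_le hNa
  obtain ⟨s1, b1⟩ := h1 N hNa
  obtain ⟨s2, b2⟩ := h2 N hNb
  obtain ⟨s3, b3⟩ := h3 N hNc
  have hpt := hpt N hN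
  have hΛ : 0 < Real.log N := Real.log_pos hN
  set Λ := Real.log N with hΛd
  have sH : Summable (fun p : PP R => q.Hp a b N p) := by
    have hl2 : 0 < Real.log 2 := Real.log_pos (by norm_num)
    refine (s1.mul_left (1 / Real.log 2 ^ 2)).of_nonneg_of_le (fun p => q.Hp_nonneg _ _ _ _) (fun p => ?_)
    rw [div_mul_eq_mul_div, one_mul, le_div_iff₀ (by positivity), mul_comm]
    apply mul_le_mul_of_nonneg_right _ (q.Hp_nonneg _ _ _ _)
    exact pow_le_pow_left₀ hl2.le (lp_two p) 2
  refine ⟨sH, ?_⟩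
  set X := ∑' p : PP R, q.Hp a b N p
  set Y := ∑' p : PP R, lp p ^ 2 * q.Hp a b N p
  have sbd := ((s2.add s3).mul_left (C / Λ)).add (hS.mul_left (D * Λ ^ 2 * Real.exp (7/8 * Λ)))
  have sd := (sH.mul_left (Λ ^ 2)).sub s1
  have hd : |Λ ^ 2 * X - Y| ≤ C / Λ * (A2 * N * Λ + A3 * N * Λ) + D * Λ ^ 2 * Real.exp (7/8 * Λ) * W := by
    have e1 : Λ ^ 2 * X - Y = ∑' p : PP R, (Λ ^ 2 * q.Hp a b N p - lp p ^ 2 * q.Hp a b N p) := by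
      rw [(sH.mul_left (Λ ^ 2)).tsum_sub s1, tsum_mul_left]
    rw [e1]
    have e2 := Summable.tsum_le_tsum hpt sd.abs sbd
    have e3 : |∑' p : PP R, (Λ ^ 2 * q.Hp a b N p - lp p ^ 2 * q.Hp a b N p)| ≤ 
      ∑' p : PP R, |Λ ^ 2 * q.Hp a b N p - lp p ^ 2 * q.Hp a b N p| := by
      have := norm_tsum_le_tsum_norm (f := fun p : PP R => (Λ ^ 2 * q.Hp a b N p - lp p ^ 2 * q.Hp a b N p)) sd.abs
      simpa only [Real.norm_eq_abs] using this
    refine e3.trans (e2.trans ?_)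
    rw [((s2.add s3).mul_left (C / Λ)).tsum_add (hS.mul_left _), tsum_mul_left, tsum_mul_left, s2.tsum_add s3]
    gcongr
  have hexp : Λ ^ 2 * Real.exp (7/8 * Λ) ≤ 256 * N := by
    have h1 : Λ / 16 ≤ Real.exp (Λ / 16) := by linarith [Real.add_one_le_exp (Λ / 16)]
    have h2 : Λ ^ 2 ≤ 256 * Real.exp (Λ / 8) := by
      have h3 : Real.exp (Λ/8) = Real.exp (Λ/16) * Real.exp (Λ/16) := by rw [← Real.exp_add]; congr 1; ring
      rw [h3]; nlinarith
    have h4 : Real.exp (Λ / 8) * Real.exp (7/8 * Λ) = N := by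
      rw [← Real.exp_add, ← Real.exp_log (by linarith : 0 < N)]; congr 1; rw [← hΛd]; ring
    calc Λ ^ 2 * Real.exp (7/8 * Λ) ≤ 256 * Real.exp (Λ / 8) * Real.exp (7/8 * Λ) := by gcongr
      _ = 256 * N := by rw [mul_assoc, h4]
  have hd2 : |Λ ^ 2 * X - Y| ≤ (C * (A2 + A3) + D * W * 256) * N := by
    refine hd.trans ?_
    have e1 : C / Λ * (A2 * N * Λ + A3 * N * Λ) = C * (A2 + A3) * N := by field_simp
    have e2 : D * Λ ^ 2 * Real.exp (7/8 * Λ) * W = D * W * (Λ ^ 2 * Real.exp (7/8 * Λ)) := by ring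
    have e3 : D * W * (Λ ^ 2 * Real.exp (7/8 * Λ)) ≤ D * W * (256 * N) := by gcongr
    rw [e1, e2]; linarith
  have e5 : X - c * N / Λ = ((Λ ^ 2 * X - Y) + (Y - N * Λ * c)) / Λ ^ 2 := by
    field_simp; ring
  rw [e5, abs_div, abs_of_pos (by positivity : 0 < Λ ^ 2)]
  gcongr
  refine (abs_add_le _ _).trans ?_
  linarith

end QF
end PG2

section PG3
set_option linter.unusedSectionVars false
open Filter Topology Set MeasureTheory

noncomputable def cf (C a : ℕ) : ℝ := (-1 : ℝ) ^ a * (C.choose (2 * C - a))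

lemma cf_sum (C : ℕ) (X : ℝ) : (X - X ^ 2) ^ C * (-1) ^ C = ∑ a ∈ Finset.Icc C (2 * C), cf C a * X ^ a := by
  have h0 : Finset.Icc C (2 * C) = Finset.Ico C (2 * C + 1) := by ext; simp
  rw [h0, Finset.sum_Ico_eq_sum_range, ← mul_pow]
  have h1 : (X - X ^ 2) * (-1) = X ^ 2 + (-X) := by ring
  rw [h1, add_pow]
  have h2 : 2 * C + 1 - C = C + 1 := by omega
  rw [h2]
  refine Finset.sum_congr rfl (fun m hm => ?_)
  have hm : m ≤ C := by simp at hm; omega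
  obtain ⟨k, rfl⟩ := Nat.exists_eq_add_of_le hm
  unfold cf
  have h3 : m + k - m = k := by omega
  have h4 : 2 * (m + k) - (m + k + m) = k := by omega
  rw [h3, h4, neg_pow, ← pow_mul, Nat.choose_symm_add]
  have h5 : (-1 : ℝ) ^ (m + k + m) = (-1) ^ k := by
    rw [show m + k + m = k + 2 * m by ring, pow_add, pow_mul]; simp
  rw [h5]
  have h6 : X ^ (m + k + m) = X ^ (2 * m) * X ^ k := by rw [← pow_add]; congr 1; ring
  rw [h6]; ring

lemma cf_prod (C : ℕ) (X Y : ℝ) : (X - X ^ 2) ^ C * (Y - Y ^ 2) ^ C =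
    ∑ a ∈ Finset.Icc C (2 * C), ∑ b ∈ Finset.Icc C (2 * C), cf C a * cf C b * (X ^ a * Y ^ b) := by
  have h : (X - X ^ 2) ^ C * (Y - Y ^ 2) ^ C = ((X - X ^ 2) ^ C * (-1) ^ C) * ((Y - Y ^ 2) ^ C * (-1) ^ C) := by
    have : ((-1:ℝ) ^ C) * (-1) ^ C = 1 := by rw [← mul_pow]; simp
    linear_combination -((X - X ^ 2) ^ C * (Y - Y ^ 2) ^ C) * this
  rw [h, cf_sum, cf_sum, Finset.sum_mul_sum]
  refine Finset.sum_congr rfl (fun a _ => Finset.sum_congr rfl (fun b _ => by ring))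

lemma exp_pw (a b : ℕ) (L x y : ℝ) : Real.exp (-(x * Real.exp (2*L*y))) ^ a * Real.exp (-(x * Real.exp (-(2*L*y)))) ^ b =
    Real.exp (-(x * pw a b L y)) := by
  rw [← Real.exp_nat_mul, ← Real.exp_nat_mul, ← Real.exp_add]
  congr 1; unfold pw; ring

lemma exp_int0 {w : ℝ} (hw : 0 < w) : IntegrableOn (fun x => Real.exp (-(x * w))) (Ioi 0) ∧
    ∫ x in Ioi 0, Real.exp (-(x * w)) = w⁻¹ := by
  have h1 := integrableOn_exp_mul_Ioi (a := -w) (by linarith) 0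
  have h2 := integral_exp_mul_Ioi (a := -w) (by linarith) 0
  have e : (fun x => Real.exp (-(x * w))) = fun x => Real.exp (-w * x) := by ext x; congr 1; ring
  rw [e]
  refine ⟨h1, ?_⟩
  rw [h2]; simp

noncomputable def Gy (C : ℕ) (L y : ℝ) : ℝ :=
  ∑ a ∈ Finset.Icc C (2 * C), ∑ b ∈ Finset.Icc C (2 * C), cf C a * cf C b * (pw a b L y)⁻¹

lemma ab_pos {C a : ℕ} (hC : 0 < C) (ha : a ∈ Finset.Icc C (2 * C)) : (0:ℝ) < a := by
  simp at ha; exact_mod_cast (by omega : 0 < a)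

lemma Gy_pos {C : ℕ} (hC : 0 < C) (L y : ℝ) : 0 < Gy C L y := by
  set F : ℝ → ℝ := fun x => ∑ a ∈ Finset.Icc C (2 * C), ∑ b ∈ Finset.Icc C (2 * C),
    cf C a * cf C b * Real.exp (-(x * pw a b L y)) with hF
  have hFe : ∀ x, F x = (Real.exp (-(x * Real.exp (2*L*y))) - Real.exp (-(x * Real.exp (2*L*y))) ^ 2) ^ C *
      (Real.exp (-(x * Real.exp (-(2*L*y)))) - Real.exp (-(x * Real.exp (-(2*L*y)))) ^ 2) ^ C := by
    intro x
    rw [cf_prod]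
    simp_rw [exp_pw]
    rfl
  have hpos : ∀ x ∈ Ioi (0:ℝ), 0 < F x := by
    intro x hx
    rw [hFe]
    have hx : 0 < x := hx
    have key : ∀ t : ℝ, 0 < t → 0 < Real.exp (-(x * t)) - Real.exp (-(x * t)) ^ 2 := by
      intro t ht
      have h1 : Real.exp (-(x * t)) < 1 := by rw [Real.exp_lt_one_iff]; nlinarith [mul_pos hx ht]
      nlinarith [Real.exp_pos (-(x * t))]
    exact mul_pos (pow_pos (key _ (Real.exp_pos _)) _) (pow_pos (key _ (Real.exp_pos _)) _)
  have hi : ∀ a ∈ Finset.Icc C (2 * C), ∀ b ∈ Finset.Icc C (2 * C),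
      IntegrableOn (fun x => cf C a * cf C b * Real.exp (-(x * pw a b L y))) (Ioi 0) := by
    intro a ha b hb
    exact (exp_int0 (pw_pos (ab_pos hC ha) (ab_pos hC hb) y)).1.const_mul _
  have hFi : IntegrableOn F (Ioi 0) := integrable_finsetSum _ (fun a ha => integrable_finsetSum _ (fun b hb => hi a ha b hb))
  have hG : Gy C L y = ∫ x in Ioi 0, F x := by
    rw [hF, integral_finsetSum _ (fun a ha => integrable_finsetSum _ (fun b hb => hi a ha b hb))]
    refine Finset.sum_congr rfl (fun a ha => ?_)
    rw [integral_finsetSum _ (fun b hb => hi a ha b hb)]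
    refine Finset.sum_congr rfl (fun b hb => ?_)
    rw [integral_const_mul, (exp_int0 (pw_pos (ab_pos hC ha) (ab_pos hC hb) y)).2]
  rw [hG, setIntegral_pos_iff_support_of_nonneg_ae _ hFi]
  · have : Function.support F ∩ Ioi 0 = Ioi 0 := by
      rw [inter_eq_right]
      intro x hx; exact (hpos x hx).ne'
    rw [this]; simp
  · filter_upwards [ae_restrict_mem measurableSet_Ioi] with x hx
    exact (hpos x hx).le

lemma sieve_eq {C : ℕ} {E : ℝ} (hE : 1 < E) : sieveConst C E =
    ∑ a ∈ Finset.Icc C (2 * C), ∑ b ∈ Finset.Icc C (2 * C), cf C a * cf C b *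
      (2 / Real.pi * ∫ y, (pw a b (Real.log E) y)⁻¹) := by
  unfold sieveConst
  rw [Finset.mul_sum]
  refine Finset.sum_congr rfl (fun a _ => ?_)
  rw [Finset.mul_sum]
  refine Finset.sum_congr rfl (fun b _ => ?_)
  have : ∀ y : ℝ, (a:ℝ) * E ^ (2*y) + b * E ^ (-(2*y)) = pw a b (Real.log E) y := by
    intro y
    rw [Real.rpow_def_of_pos (by linarith), Real.rpow_def_of_pos (by linarith)]
    unfold pw
    congr 3 <;> ring
  simp_rw [this]
  unfold cf
  rw [pow_add]; ring

lemma sieve_pos {C : ℕ} (hC : 0 < C) {E : ℝ} (hE : 1 < E) : 0 < sieveConst C E := by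
  have hL := Real.log_pos hE
  have hi : ∀ a ∈ Finset.Icc C (2 * C), ∀ b ∈ Finset.Icc C (2 * C),
      Integrable (fun y => cf C a * cf C b * (pw a b (Real.log E) y)⁻¹) := by
    intro a ha b hb
    exact (pw_inv_integrable (ab_pos hC ha) (ab_pos hC hb) hL).const_mul _
  have hGi : Integrable (Gy C (Real.log E)) := integrable_finsetSum _ (fun a ha => integrable_finsetSum _ (fun b hb => hi a ha b hb))
  have hG : sieveConst C E = 2 / Real.pi * ∫ y, Gy C (Real.log E) y := by
    rw [sieve_eq hE]
    unfold Gy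
    rw [integral_finsetSum _ (fun a ha => integrable_finsetSum _ (fun b hb => hi a ha b hb)), Finset.mul_sum]
    refine Finset.sum_congr rfl (fun a ha => ?_)
    rw [integral_finsetSum _ (fun b hb => hi a ha b hb), Finset.mul_sum]
    refine Finset.sum_congr rfl (fun b hb => ?_)
    rw [integral_const_mul]; ring
  rw [hG]
  apply mul_pos (by have := Real.pi_pos; positivity)
  rw [integral_pos_iff_support_of_nonneg (fun y => (Gy_pos hC _ y).le) hGi]
  have : Function.support (Gy C (Real.log E)) = univ := by
    ext y; simp [(Gy_pos hC (Real.log E) y).ne']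
  rw [this]; simp

variable {R : Type} [CommRing R] [IsDedekindDomain R] [Module.Free ℤ R] [Module.Finite ℤ R]

namespace QF

lemma s_sq (q : QF R) {k : R} (hk : k ≠ 0) : q.s1 k ^ 2 = qn (Ideal.span {k}) * Real.exp (2 * q.L * q.gt k) ∧
    q.s2 k ^ 2 = qn (Ideal.span {k}) * Real.exp (-(2 * q.L * q.gt k)) := by
  have hL := q.L_pos
  have h1 := q.s1_ne hk
  have h2 := q.s2_ne hk
  have e : 2 * q.L * q.gt k = Real.log |q.s1 k| - Real.log |q.s2 k| := by
    unfold gt gth; rw [Real.log_abs, Real.log_abs]; field_simp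
  rw [← q.hn, e, neg_sub, Real.exp_sub, Real.exp_sub, Real.exp_log (abs_pos.2 h1), Real.exp_log (abs_pos.2 h2),
    abs_mul, ← sq_abs (q.s1 k), ← sq_abs (q.s2 k)]
  have h3 := abs_pos.2 h1
  have h4 := abs_pos.2 h2
  constructor <;> field_simp

lemma fwt_eq (C : ℕ) {N : ℝ} (hN : 0 < N) (u : ℝ) : fwt C (u / Real.sqrt N) =
    (Real.exp (-(Real.pi * u ^ 2 / N)) - Real.exp (-(Real.pi * u ^ 2 / N)) ^ 2) ^ C := by
  unfold fwt
  rw [div_pow, Real.sq_sqrt hN.le, ← Real.exp_nat_mul]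
  congr 3
  · ring
  · push_cast; ring

lemma fwt_prod (q : QF R) (C : ℕ) {N : ℝ} (hN : 0 < N) {k : R} (hk : k ≠ 0) :
    fwt C (q.s1 k / Real.sqrt N) * fwt C (q.s2 k / Real.sqrt N) =
    ∑ a ∈ Finset.Icc C (2 * C), ∑ b ∈ Finset.Icc C (2 * C), cf C a * cf C b *
      Real.exp (-(Real.pi * (qn (Ideal.span {k}) / N) * pw a b q.L (q.gt k))) := by
  rw [fwt_eq C hN, fwt_eq C hN, (q.s_sq hk).1, (q.s_sq hk).2, cf_prod]
  refine Finset.sum_congr rfl (fun a _ => Finset.sum_congr rfl (fun b _ => ?_))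
  rw [← exp_pw]
  congr 5 <;> ring

lemma psi_eq (q : QF R) {C : ℕ} (hC : 0 < C) {N : ℝ} (hN : 0 < N) {n : Ideal R} (hn : n ≠ ⊥) :
    HasSum (fun k : R => if Ideal.span {k} = n then fwt C (q.s1 k / Real.sqrt N) * fwt C (q.s2 k / Real.sqrt N) else 0)
    (∑ a ∈ Finset.Icc C (2 * C), ∑ b ∈ Finset.Icc C (2 * C), cf C a * cf C b * pH a b q.L (qn n / N) (q.th n)) := by
  have hx : 0 < qn n / N := by have := qn_pos hn; positivity
  rw [← (q.gm_inj hn).hasSum_iff]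
  · have e : ∀ x : Bool × ℤ, ((fun k : R => if Ideal.span {k} = n then fwt C (q.s1 k / Real.sqrt N) * fwt C (q.s2 k / Real.sqrt N) else 0) ∘ q.gm n) x
      = ∑ a ∈ Finset.Icc C (2 * C), ∑ b ∈ Finset.Icc C (2 * C), cf C a * cf C b *
        Real.exp (-(Real.pi * (qn n / N) * pw a b q.L (q.th n + x.2))) := by
      intro x
      have hk : q.gm n x ≠ 0 := by
        intro h0
        have := q.gm_span n x
        rw [h0] at this
        apply hn; rw [← this]; simp
      simp only [Function.comp]
      rw [if_pos (q.gm_span n x), q.fwt_prod C hN hk, q.gm_span, q.gm_gt hn]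
    rw [funext e]
    refine hasSum_sum (fun a ha => hasSum_sum (fun b hb => HasSum.mul_left _ ?_))
    have hs := pH_summable (ab_pos hC ha) (ab_pos hC hb) q.L_pos hx (q.th n)
    set g : ℤ → ℝ := fun j => Real.exp (-(Real.pi * (qn n / N) * pw a b q.L (q.th n + j)))
    have h5 : HasSum (fun x : (_ : Bool) × ℤ => g x.2) (∑ b : Bool, ∑' j, g j) := by
      have : Summable (fun x : (_ : Bool) × ℤ => g x.2) := by
        rw [summable_sigma_of_nonneg (fun _ => Real.exp_nonneg _)]
        exact ⟨fun b => hs, (hasSum_fintype _).summable⟩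
      exact HasSum.of_sigma (g := fun b : Bool => ∑' j, g j) (fun b => hs.hasSum) (hasSum_fintype _) this.hasSum.cauchySeq
    have h6 := (Equiv.sigmaEquivProd Bool ℤ).symm.hasSum_iff.2 h5
    have h7 : (∑ b : Bool, ∑' j, g j) = pH a b q.L (qn n / N) (q.th n) := by
      unfold pH; simp; ring
    rw [h7] at h6
    exact h6
  · intro k hk
    rw [if_neg]
    intro h
    exact hk (q.gm_surj h)

theorem main (q : QF R) {C : ℕ} (hC : 0 < C) : 0 < sieveConst C (q.s1 q.u) ∧
    ∃ M N₀ : ℝ, ∀ N : ℝ, N₀ ≤ N →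
      |(∑' s : PP R, ∑' k : R, if Ideal.span {k} = s.1 then
        fwt C (q.s1 k / Real.sqrt N) * fwt C (q.s2 k / Real.sqrt N) else 0) -
          sieveConst C (q.s1 q.u) * N / Real.log N|
        ≤ M * N * Real.log (Real.log N) / (Real.log N)^2 := by
  refine ⟨sieve_pos hC q.hu, ?_⟩
  have key : ∀ a b : ℕ, ∃ A N0 : ℝ, 0 < A ∧ 1 < N0 ∧ (a ∈ Finset.Icc C (2*C) → b ∈ Finset.Icc C (2*C) →
    ∀ N : ℝ, N0 ≤ N → Summable (fun p : PP R => q.Hp a b N p) ∧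
    |(∑' p : PP R, q.Hp a b N p) - (2 / Real.pi * ∫ y, (pw a b q.L y)⁻¹) * N / Real.log N| ≤
      A * N / Real.log N ^ 2) := by
    intro a b
    by_cases h : a ∈ Finset.Icc C (2*C) ∧ b ∈ Finset.Icc C (2*C)
    · obtain ⟨A, N0, h1, h2, h3⟩ := q.stepC (ab_pos hC h.1) (ab_pos hC h.2)
      exact ⟨A, N0, h1, h2, fun _ _ => h3⟩
    · exact ⟨1, 2, by norm_num, by norm_num, fun ha hb => absurd ⟨ha, hb⟩ h⟩
  choose A N0 hA hN0 h using key
  set I := Finset.Icc C (2*C) with hI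
  refine ⟨∑ a ∈ I, ∑ b ∈ I, |cf C a * cf C b| * A a b,
    Real.exp (Real.exp 1) + ∑ a ∈ I, ∑ b ∈ I, N0 a b, fun N hN => ?_⟩
  have hsn : ∀ a ∈ I, 0 ≤ ∑ b ∈ I, N0 a b := fun a _ => Finset.sum_nonneg (fun b _ => by linarith [hN0 a b])
  have hE : Real.exp (Real.exp 1) ≤ N := by
    have := Finset.sum_nonneg hsn
    linarith
  have hN0' : ∀ a ∈ I, ∀ b ∈ I, N0 a b ≤ N := by
    intro a ha b hb
    have h1 := Finset.single_le_sum (f := fun a => ∑ b ∈ I, N0 a b) hsn ha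
    have h2 := Finset.single_le_sum (f := fun b => N0 a b) (fun b _ => by linarith [hN0 a b]) hb
    have := Real.exp_pos (Real.exp 1)
    linarith
  have hNp : 0 < N := (Real.exp_pos _).trans_le hE
  have hΛ : Real.exp 1 ≤ Real.log N := (Real.le_log_iff_exp_le hNp).2 hE
  have hΛ0 : 0 < Real.log N := (Real.exp_pos _).trans_le hΛ
  have hll : 1 ≤ Real.log (Real.log N) := (Real.le_log_iff_exp_le hΛ0).2 hΛ
  have e1 : ∀ s : PP R, (∑' k : R, if Ideal.span {k} = s.1 then
        fwt C (q.s1 k / Real.sqrt N) * fwt C (q.s2 k / Real.sqrt N) else 0) =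
        ∑ a ∈ I, ∑ b ∈ I, cf C a * cf C b * q.Hp a b N s := fun s => (q.psi_eq hC hNp s.2.1).tsum_eq
  simp_rw [e1]
  have hH : HasSum (fun s : PP R => ∑ a ∈ I, ∑ b ∈ I, cf C a * cf C b * q.Hp a b N s)
      (∑ a ∈ I, ∑ b ∈ I, cf C a * cf C b * ∑' s, q.Hp a b N s) :=
    hasSum_sum (fun a ha => hasSum_sum (fun b hb =>
      ((h a b ha hb N (hN0' a ha b hb)).1.hasSum).mul_left _))
  rw [hH.tsum_eq, sieve_eq q.hu]
  change |_ - (∑ a ∈ I, ∑ b ∈ I, cf C a * cf C b * (2 / Real.pi * ∫ y, (pw a b q.L y)⁻¹)) * N / Real.log N| ≤ _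
  have e2 : (∑ a ∈ I, ∑ b ∈ I, cf C a * cf C b * ∑' s, q.Hp a b N s) -
      (∑ a ∈ I, ∑ b ∈ I, cf C a * cf C b * (2 / Real.pi * ∫ y, (pw a b q.L y)⁻¹)) * N / Real.log N =
      ∑ a ∈ I, ∑ b ∈ I, cf C a * cf C b * ((∑' s, q.Hp a b N s) - (2 / Real.pi * ∫ y, (pw a b q.L y)⁻¹) * N / Real.log N) := by
    rw [mul_div_assoc, Finset.sum_mul, ← Finset.sum_sub_distrib]
    refine Finset.sum_congr rfl (fun a _ => ?_)
    rw [Finset.sum_mul, ← Finset.sum_sub_distrib]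
    refine Finset.sum_congr rfl (fun b _ => by ring)
  rw [e2]
  have e3 : |∑ a ∈ I, ∑ b ∈ I, cf C a * cf C b * ((∑' s, q.Hp a b N s) - (2 / Real.pi * ∫ y, (pw a b q.L y)⁻¹) * N / Real.log N)| ≤
      ∑ a ∈ I, ∑ b ∈ I, |cf C a * cf C b| * (A a b * N / Real.log N ^ 2) := by
    refine (Finset.abs_sum_le_sum_abs _ _).trans (Finset.sum_le_sum (fun a ha => ?_))
    refine (Finset.abs_sum_le_sum_abs _ _).trans (Finset.sum_le_sum (fun b hb => ?_))
    rw [abs_mul]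
    exact mul_le_mul_of_nonneg_left (h a b ha hb N (hN0' a ha b hb)).2 (abs_nonneg _)
  refine e3.trans ?_
  have e4 : ∑ a ∈ I, ∑ b ∈ I, |cf C a * cf C b| * (A a b * N / Real.log N ^ 2) =
      (∑ a ∈ I, ∑ b ∈ I, |cf C a * cf C b| * A a b) * (N / Real.log N ^ 2) := by
    simp only [Finset.sum_mul]
    refine Finset.sum_congr rfl (fun a _ => Finset.sum_congr rfl (fun b _ => by ring))
  rw [e4]
  set M := ∑ a ∈ I, ∑ b ∈ I, |cf C a * cf C b| * A a b
  have hM : 0 ≤ M := Finset.sum_nonneg (fun a _ => Finset.sum_nonneg (fun b _ =>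
    mul_nonneg (abs_nonneg _) (hA a b).le))
  have e5 : M * N * Real.log (Real.log N) / Real.log N ^ 2 = M * (N / Real.log N ^ 2) * Real.log (Real.log N) := by ring
  rw [e5]
  exact le_mul_of_one_le_right (by positivity) hll

end QF
end PG3

section PG4
set_option linter.unusedSectionVars false

variable {R : Type} [CommRing R] [IsDedekindDomain R] [Module.Free ℤ R] [Module.Finite ℤ R]

lemma ring_hom_pair (b : Module.Basis (Fin 2) ℤ R) (s : R →+* ℝ) (x : R) :
    s x = (b.repr x 0 : ℝ) * s (b 0) + (b.repr x 1 : ℝ) * s (b 1) := by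
  conv_lhs => rw [← b.sum_repr x]
  simp [Fin.sum_univ_two, zsmul_eq_mul]

lemma det_ne (b : Module.Basis (Fin 2) ℤ R) (s1 s2 : R →+* ℝ) (sq : R) (h : s1 sq ≠ s2 sq) :
    s1 (b 0) * s2 (b 1) - s1 (b 1) * s2 (b 0) ≠ 0 := by
  intro h0
  apply h
  have a1 := ring_hom_pair b s1 sq
  have a2 := ring_hom_pair b s2 sq
  have c1 := ring_hom_pair b s1 1
  have c2 := ring_hom_pair b s2 1
  rw [map_one] at c1 c2
  linear_combination s1 sq * c2 - s2 sq * c1 +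
    ((b.repr 1 0 : ℝ) * s2 (b 0) + (b.repr 1 1 : ℝ) * s2 (b 1)) * a1 -
    ((b.repr 1 0 : ℝ) * s1 (b 0) + (b.repr 1 1 : ℝ) * s1 (b 1)) * a2 +
    ((b.repr sq 0 : ℝ) * (b.repr 1 1 : ℝ) - (b.repr sq 1 : ℝ) * (b.repr 1 0 : ℝ)) * h0

lemma norm_pair (b : Module.Basis (Fin 2) ℤ R) (s1 s2 : R →+* ℝ)
    (h : s1 (b 0) * s2 (b 1) - s1 (b 1) * s2 (b 0) ≠ 0) (k : R) :
    ((Algebra.norm ℤ k : ℤ) : ℝ) = s1 k * s2 k := by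
  rw [Algebra.norm_eq_matrix_det b, Matrix.det_fin_two]
  simp only [Algebra.leftMulMatrix_eq_repr_mul]
  have a1 := ring_hom_pair b s1 (k * b 0)
  have a2 := ring_hom_pair b s2 (k * b 0)
  have a3 := ring_hom_pair b s1 (k * b 1)
  have a4 := ring_hom_pair b s2 (k * b 1)
  rw [map_mul] at a1 a2 a3 a4
  generalize b.repr (k * b 0) 0 = m00 at *
  generalize b.repr (k * b 0) 1 = m10 at *
  generalize b.repr (k * b 1) 0 = m01 at *
  generalize b.repr (k * b 1) 1 = m11 at *
  push_cast
  apply mul_left_cancel₀ h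
  have : (s1 k * s1 (b 0)) * (s2 k * s2 (b 1)) - (s1 k * s1 (b 1)) * (s2 k * s2 (b 0)) =
     (s1 (b 0) * s2 (b 1) - s1 (b 1) * s2 (b 0)) * (s1 k * s2 k) := by ring
  rw [← this, a1, a2, a3, a4]
  ring

noncomputable def mkT (p q r s : ℝ) (h : p * s - q * r ≠ 0) : (ℝ × ℝ) ≃L[ℝ] (ℝ × ℝ) :=
  LinearEquiv.toContinuousLinearEquiv
  { toFun := fun x => (p * x.1 + q * x.2, r * x.1 + s * x.2)
    map_add' := fun x y => by ext <;> simp <;> ring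
    map_smul' := fun c x => by ext <;> simp <;> ring
    invFun := fun x => ((s * x.1 - q * x.2) / (p * s - q * r), (p * x.2 - r * x.1) / (p * s - q * r))
    left_inv := fun x => by
      ext
      · simp only; rw [div_eq_iff h]; ring
      · simp only; rw [div_eq_iff h]; ring
    right_inv := fun x => by
      ext
      · simp only; rw [← mul_div_assoc, ← mul_div_assoc, ← add_div, div_eq_iff h]; ring
      · simp only; rw [← mul_div_assoc, ← mul_div_assoc, ← add_div, div_eq_iff h]; ring }

noncomputable def mkQF (s1 s2 : R →+* ℝ) (i1 : Function.Injective s1) (i2 : Function.Injective s2)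
    (pid : IsPrincipalIdealRing R) (b : Module.Basis (Fin 2) ℤ R) (sq : R) (h : s1 sq ≠ s2 sq)
    (u : Rˣ) (hu : 1 < s1 u) (hg : ∀ v : Rˣ, ∃ n : ℤ, v = u ^ n ∨ v = -u ^ n) : QF R where
  s1 := s1
  s2 := s2
  i1 := i1
  i2 := i2
  hn k := by
    unfold qn
    rw [Ideal.absNorm_span_singleton, ← norm_pair b s1 s2 (det_ne b s1 s2 sq h), Nat.cast_natAbs, Int.cast_abs]
  pid := pid
  u := u
  hu := hu
  hg := hg
  T := mkT (s1 (b 0)) (s1 (b 1)) (s2 (b 0)) (s2 (b 1)) (det_ne b s1 s2 sq h)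
  e := (finTwoArrowEquiv ℤ).symm.trans b.equivFun.symm.toEquiv
  he k := by
    have e0 : ((finTwoArrowEquiv ℤ).symm.trans b.equivFun.symm.toEquiv) k = k.1 • b 0 + k.2 • b 1 := by
      simp [Module.Basis.equivFun_symm_apply, Fin.sum_univ_two]
    rw [e0]
    ext <;> simp [mkT, kc, zsmul_eq_mul] <;> ring

end PG4

/-- **Asymptotic for `∑_{𝔰 prime} Ψ(𝔰)` in real quadratic fields of class number one:**
with `c = sieveConst 𝒞 ϵ > 0`, one has
`∑_{𝔰∈ℙ} Ψ(𝔰) = c·N/log N + O(N log log N / log² N)` as `N → ∞`. -/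
theorem psi_prime_sum_asymptotic
    (d : ℕ) (hd : 1 < d) (hdsq : Squarefree d) (hd4 : d % 4 = 3)
    (K : Subfield ℝ) [NumberField K]
    (hdeg : Module.finrank ℚ K = 2)
    (sq : 𝓞 K) (hsq : ((sq : K) : ℝ) = Real.sqrt d)
    (hclass : NumberField.classNumber K = 1)
    (σ₂ : K →+* ℝ) (hσ₂ : σ₂ (sq : K) = -Real.sqrt d)
    (C : ℕ) (hC : 0 < C)
    (ϵ : (𝓞 K)ˣ) (hϵ1 : 1 < (((ϵ : 𝓞 K) : K) : ℝ))
    (hϵgen : ∀ u : (𝓞 K)ˣ, ∃ n : ℤ, u = ϵ ^ n ∨ u = -ϵ ^ n) :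
    0 < sieveConst C (((ϵ : 𝓞 K) : K) : ℝ) ∧
    ∃ M : ℝ, ∃ N₀ : ℝ, ∀ N : ℝ, N₀ ≤ N →
      |(∑' s : {p : Ideal (𝓞 K) // p ≠ ⊥ ∧ p.IsPrime}, PsiW K σ₂ C N s.1) -
          sieveConst C (((ϵ : 𝓞 K) : K) : ℝ) * N / Real.log N|
        ≤ M * N * Real.log (Real.log N) / (Real.log N)^2 := by
  have hd0 : 0 < Real.sqrt d := Real.sqrt_pos.2 (by exact_mod_cast (by omega : 0 < d))
  let s1 : 𝓞 K →+* ℝ := K.subtype.comp (algebraMap (𝓞 K) K)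
  let s2 : 𝓞 K →+* ℝ := σ₂.comp (algebraMap (𝓞 K) K)
  have i1 : Function.Injective s1 := K.subtype.injective.comp RingOfIntegers.coe_injective
  have i2 : Function.Injective s2 := σ₂.injective.comp RingOfIntegers.coe_injective
  have hr : Module.finrank ℤ (𝓞 K) = 2 := by rw [RingOfIntegers.rank, hdeg]
  have hne : s1 sq ≠ s2 sq := by
    change ((sq : K) : ℝ) ≠ σ₂ (sq : K)
    rw [hsq, hσ₂]; intro h; linarith
  have pid : IsPrincipalIdealRing (𝓞 K) := (NumberField.classNumber_eq_one_iff).1 hclass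
  exact (mkQF s1 s2 i1 i2 pid (Module.finBasisOfFinrankEq ℤ (𝓞 K) hr) sq hne ϵ hϵ1 hϵgen).main hC
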